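/- (Realizability of signatures) Let g ≥ 0, r ≥ 0 and ν₁,…,ν_r ≥ 2 be integers satisfying 2g − 2 + Σ_{j=1}^r (1 − 1/ν_j) > 0. Then there exists a cocompact Fuchsian group Γ ≤ PSL(2,ℝ) that is isomorphic as a group to the presented group Γ(g; ν₁,…,ν_r). -/

import Mathlib

open UpperHalfPlane Matrix
open scoped commutatorElement

/-- `SL(2,ℝ)`: 2×2 real matrices of determinant 1. -/
abbrev SL2R := Matrix.SpecialLinearGroup (Fin 2) ℝ

/-- The subspace topology on `SL(2,ℝ)` inherited from 2×2 real matrices. -/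
instance : TopologicalSpace SL2R :=
  TopologicalSpace.induced (fun g => (g : Matrix (Fin 2) (Fin 2) ℝ)) inferInstance

/-- `PSL(2,ℝ)`: the quotient of `SL(2,ℝ)` by its center `{±I}`,
with the quotient topology. -/
abbrev PSL2R := SL2R ⧸ Subgroup.center SL2R

/-- Generators for the presentation `Γ(g; ν₁,…,ν_r)`:
`Sum.inl (Sum.inl i) = aᵢ`, `Sum.inl (Sum.inr i) = bᵢ`, `Sum.inr j = cⱼ`. -/
abbrev FuchsianGen (g r : ℕ) := (Fin g ⊕ Fin g) ⊕ Fin r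

/-- The relations `[a₁,b₁]⋯[a_g,b_g] (c₁⋯c_r)⁻¹` and `cⱼ^{νⱼ}` for `1 ≤ j ≤ r`. -/
def fuchsianRels (g r : ℕ) (ν : Fin r → ℕ) : Set (FreeGroup (FuchsianGen g r)) :=
  insert
    ((List.ofFn fun i : Fin g =>
        ⁅(FreeGroup.of (Sum.inl (Sum.inl i)) : FreeGroup (FuchsianGen g r)),
          FreeGroup.of (Sum.inl (Sum.inr i))⁆).prod *
      ((List.ofFn fun j : Fin r =>
        (FreeGroup.of (Sum.inr j) : FreeGroup (FuchsianGen g r))).prod)⁻¹)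
    (Set.range fun j : Fin r =>
      (FreeGroup.of (Sum.inr j) : FreeGroup (FuchsianGen g r)) ^ (ν j))

/-- The presented group
`Γ(g; ν₁,…,ν_r) = ⟨a₁,b₁,…,a_g,b_g,c₁,…,c_r | [a₁,b₁]⋯[a_g,b_g] = c₁⋯c_r, cⱼ^{νⱼ} = 1⟩`. -/
abbrev FuchsianGroup (g r : ℕ) (ν : Fin r → ℕ) := PresentedGroup (fuchsianRels g r ν)

/-- The image of the generator `cⱼ` in `Γ(g; ν₁,…,ν_r)`. -/
def fuchsianC (g r : ℕ) (ν : Fin r → ℕ) (j : Fin r) : FuchsianGroup g r ν :=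
  PresentedGroup.of (Sum.inr j)


set_option linter.style.haveILetI false
section PartA

theorem tiling_cover_aux {X I : Type*} [MetricSpace X] [SimplyConnectedSpace X]
    [LocallyPathConnectedSpace X]
    (U : I → Set X) (R : I → I → Prop) (hUo : ∀ i, IsOpen (U i))
    (hUc : ∀ i, IsPreconnected (U i))
    (hrefl : ∀ i, R i i) (hsymm : ∀ i j, R i j → R j i)
    (hb : ∀ x i j k, x ∈ U i → x ∈ U j → x ∈ U k → R i j → R j k → R i k)
    (ε : ℝ) (hε : 0 < ε)
    (hc : ∀ x i, x ∈ U i → ∃ j, R i j ∧ Metric.ball x ε ⊆ U j)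
    (i j : I) (hij : Relation.ReflTransGen (fun a b => R a b ∧ (U a ∩ U b).Nonempty) i j)
    (x : X) (hxi : x ∈ U i) (hxj : x ∈ U j) : R i j := by
  classical
  letI : TopologicalSpace I := ⊥
  haveI : DiscreteTopology I := ⟨rfl⟩
  let Y := Σ i : I, U i
  let S : Setoid Y :=
    { r := fun a b => (a.2 : X) = b.2 ∧ R a.1 b.1
      iseqv := ⟨fun a => ⟨rfl, hrefl _⟩, fun h => ⟨h.1.symm, hsymm _ _ h.2⟩,
        fun {a b c} h1 h2 => ⟨h1.1.trans h2.1,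
          hb a.2 a.1 b.1 c.1 a.2.2 (h1.1 ▸ b.2.2) ((h1.1.trans h2.1) ▸ c.2.2) h1.2 h2.2⟩⟩ }
  let E := Quotient S
  let mk : Y → E := Quotient.mk S
  have hmkc : Continuous mk := continuous_quotient_mk'
  let D : E → X := Quotient.lift (fun a : Y => (a.2 : X)) (fun a b h => h.1)
  have hDc : Continuous D := by
    refine Continuous.quotient_lift ?_ _
    exact continuous_sigma (fun i => continuous_subtype_val)
  have hmkeq : ∀ a b : Y, mk a = mk b ↔ ((a.2 : X) = b.2 ∧ R a.1 b.1) := fun a b => Quotient.eq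
  have hmko : IsOpenMap mk := by
    intro W hW
    rw [← isQuotientMap_quotient_mk'.isOpen_preimage]
    rw [isOpen_sigma_iff]
    intro k
    rw [isOpen_iff_mem_nhds]
    rintro z ⟨⟨l, w⟩, hw, hwz⟩
    have h1 := (hmkeq _ _).1 hwz
    have hWl : IsOpen ((fun u : U l => (⟨l, u⟩ : Y)) ⁻¹' W) := isOpen_sigma_iff.1 hW l
    obtain ⟨O, hO, hOW⟩ := isOpen_induced_iff.1 hWl
    have hzO : (z : X) ∈ O ∩ U l := by
      have : w ∈ (fun u : U l => (⟨l, u⟩ : Y)) ⁻¹' W := hw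
      rw [← hOW] at this
      have h2 : (w : X) = z := h1.1
      exact ⟨h2 ▸ this, h2 ▸ w.2⟩
    have : (Subtype.val ⁻¹' (O ∩ U l) : Set (U k)) ∈ nhds z :=
      ((hO.inter (hUo l)).preimage continuous_subtype_val).mem_nhds hzO
    refine Filter.mem_of_superset this ?_
    rintro y ⟨hyO, hyl⟩
    have h3 : (⟨(y : X), hyl⟩ : U l) ∈ (fun u : U l => (⟨l, u⟩ : Y)) ⁻¹' W := by rw [← hOW]; exact hyO
    exact ⟨⟨l, ⟨y, hyl⟩⟩, h3, (hmkeq _ _).2 ⟨rfl, h1.2⟩⟩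
  have hcov : IsCoveringMap D := by
    intro x
    suffices h : ∃ (F : Type _) (t : TopologicalSpace F), IsEvenlyCovered D x F by
      obtain ⟨F, t, h⟩ := h
      exact h.to_isEvenlyCovered_preimage
    let J := {j : I // Metric.ball x ε ⊆ U j}
    have hxb : x ∈ Metric.ball x ε := Metric.mem_ball_self hε
    let SJ : Setoid J :=
      { r := fun a b => R a.1 b.1
        iseqv := ⟨fun a => hrefl _, fun h => hsymm _ _ h, fun {a b c} h1 h2 =>
          hb x _ _ _ (a.2 hxb) (b.2 hxb) (c.2 hxb) h1 h2⟩ }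
    refine ⟨Quotient SJ, ⊥, ?_⟩
    letI : TopologicalSpace (Quotient SJ) := ⊥
    haveI : DiscreteTopology (Quotient SJ) := ⟨rfl⟩
    refine ⟨inferInstance, Metric.ball x ε, hxb, Metric.isOpen_ball,
      Metric.isOpen_ball.preimage hDc, ?_⟩
    let Ψ : (Metric.ball x ε) × Quotient SJ → D ⁻¹' (Metric.ball x ε) := fun p =>
      ⟨mk ⟨p.2.out.1, ⟨p.1, p.2.out.2 p.1.2⟩⟩, p.1.2⟩
    have hinj : Function.Injective Ψ := by
      rintro ⟨z, c⟩ ⟨z', c'⟩ h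
      have h1 := (hmkeq _ _).1 (congrArg Subtype.val h)
      have h2 : z = z' := Subtype.ext h1.1
      have h3 : c = c' := by
        rw [← c.out_eq, ← c'.out_eq]
        exact Quotient.sound h1.2
      rw [h2, h3]
    have hsurj : Function.Surjective Ψ := by
      rintro ⟨e, he⟩
      obtain ⟨⟨i, z⟩, rfl⟩ := Quotient.exists_rep e
      have hz : (z : X) ∈ Metric.ball x ε := he
      obtain ⟨j, hj, hjb⟩ := hc z i z.2
      have hxj : x ∈ U j := hjb (by rwa [Metric.mem_ball_comm])
      obtain ⟨k, hk, hkb⟩ := hc x j hxj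
      refine ⟨⟨⟨z, hz⟩, Quotient.mk SJ ⟨k, hkb⟩⟩, ?_⟩
      apply Subtype.ext
      apply (hmkeq _ _).2
      refine ⟨rfl, ?_⟩
      have h1 : R (Quotient.mk SJ ⟨k, hkb⟩).out.1 k := Quotient.mk_out (s := SJ) (⟨k, hkb⟩ : J)
      have hzj : (z : X) ∈ U j := hjb (Metric.mem_ball_self hε)
      exact hb z _ k _ ((Quotient.mk SJ ⟨k, hkb⟩).out.2 hz) (hkb hz) z.2 h1
        (hsymm _ _ (hb z i j k z.2 hzj (hkb hz) hj hk))
    have hcont : Continuous Ψ := by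
      rw [continuous_prod_of_discrete_right]
      intro c
      refine Continuous.subtype_mk ?_ _
      refine hmkc.comp ?_
      have h1 : Continuous (fun z : Metric.ball x ε => (⟨z.1, c.out.2 z.2⟩ : U c.out.1)) :=
        Continuous.subtype_mk continuous_subtype_val _
      exact Continuous.comp (g := fun u : U c.out.1 => (⟨c.out.1, u⟩ : Y))
        (continuous_sigmaMk (σ := fun i : I => U i)) h1
    have hopen : IsOpenMap Ψ := by
      rw [isOpenMap_prod_of_discrete_right]
      intro c W hW
      obtain ⟨O, hO, rfl⟩ := isOpen_induced_iff.1 hW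
      have h1 : IsOpen (mk '' ((Sigma.mk c.out.1) '' (Subtype.val ⁻¹' (O ∩ Metric.ball x ε) :
          Set (U c.out.1)))) :=
        hmko _ (isOpenMap_sigmaMk (σ := fun i : I => U i) _
          ((hO.inter Metric.isOpen_ball).preimage continuous_subtype_val))
      have h2 : IsOpen (Subtype.val ⁻¹' (mk '' ((Sigma.mk c.out.1) ''
        (Subtype.val ⁻¹' (O ∩ Metric.ball x ε) : Set (U c.out.1)))) :
          Set (D ⁻¹' (Metric.ball x ε))) := h1.preimage continuous_subtype_val
      convert h2 using 1
      ext ⟨e, he⟩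
      constructor
      · rintro ⟨z, hz, hze⟩
        have h3 : mk ⟨c.out.1, ⟨z, c.out.2 z.2⟩⟩ = e := congrArg Subtype.val hze
        exact ⟨_, ⟨⟨z, c.out.2 z.2⟩, ⟨hz, z.2⟩, rfl⟩, h3⟩
      · rintro ⟨_, ⟨z, ⟨hz1, hz2⟩, rfl⟩, h3⟩
        exact ⟨⟨z, hz2⟩, hz1, Subtype.ext h3⟩
    let H := (Equiv.ofBijective Ψ ⟨hinj, hsurj⟩).toHomeomorphOfContinuousOpen hcont hopen
    refine ⟨H.symm, ?_⟩
    intro e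
    obtain ⟨p, rfl⟩ := H.surjective e
    rw [H.symm_apply_apply]
    rfl
  obtain ⟨s, ⟨hs1, hs2⟩, -⟩ := hcov.existsUnique_continuousMap_lifts (ContinuousMap.id X) x
    (mk ⟨i, ⟨x, hxi⟩⟩) rfl
  have key : ∀ k, Relation.ReflTransGen (fun a b => R a b ∧ (U a ∩ U b).Nonempty) i k →
      ∀ z (hz : z ∈ U k), s z = mk ⟨k, ⟨z, hz⟩⟩ := by
    have ext : ∀ k z (hz : z ∈ U k), s z = mk ⟨k, ⟨z, hz⟩⟩ →
        ∀ w (hw : w ∈ U k), s w = mk ⟨k, ⟨w, hw⟩⟩ := by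
      intro k z hz h w hw
      haveI : PreconnectedSpace (U k) := isPreconnected_iff_preconnectedSpace.1 (hUc k)
      have := hcov.eq_of_comp_eq (A := U k) (g₁ := fun w => s w) (g₂ := fun w => mk ⟨k, w⟩)
        (s.continuous.comp continuous_subtype_val)
        (hmkc.comp (continuous_sigmaMk (σ := fun i : I => U i)))
        (by ext w; exact congrFun hs2 w) ⟨z, hz⟩ h
      exact congrFun this ⟨w, hw⟩
    intro k hk
    induction hk with
    | refl => exact ext i x hxi hs1
    | tail _ h ih =>
      obtain ⟨hR, z, hza, hzb⟩ := h
      refine ext _ z hzb ?_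
      rw [ih z hza]
      exact (hmkeq _ _).2 ⟨rfl, hR⟩
  have h1 := key j hij x hxj
  rw [hs1] at h1
  exact ((hmkeq _ _).1 h1).2

theorem tiling_cover_univ {X I : Type*} [MetricSpace X] [PreconnectedSpace X]
    (U : I → Set X) (hUo : ∀ i, IsOpen (U i))
    (ε : ℝ) (hε : 0 < ε)
    (hc : ∀ x i, x ∈ U i → ∃ j, Metric.ball x ε ⊆ U j)
    (i : I) (x : X) (hxi : x ∈ U i) (y : X) : ∃ j, y ∈ U j := by
  have hop : IsOpen (⋃ i, U i) := isOpen_iUnion hUo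
  have hcl : IsClosed (⋃ i, U i) := by
    rw [← isOpen_compl_iff, Metric.isOpen_iff]
    intro z hz
    refine ⟨ε, hε, fun w hw hwU => hz ?_⟩
    obtain ⟨k, hk⟩ := Set.mem_iUnion.1 hwU
    obtain ⟨j, hj⟩ := hc w k hk
    exact Set.mem_iUnion.2 ⟨j, hj (by rwa [Metric.mem_ball_comm])⟩
  have := IsClopen.eq_univ ⟨hcl, hop⟩ ⟨x, Set.mem_iUnion.2 ⟨i, hxi⟩⟩
  have h2 : y ∈ ⋃ i, U i := this ▸ Set.mem_univ y
  exact Set.mem_iUnion.1 h2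
end PartA



structure CenterData {X T : Type*} (a b : T → T) (al : T → ℝ) (la lb : T → X → ℝ)
    (UA UB : T → Set X) : Prop where
  ha : Function.Involutive a
  hb : Function.Involutive b
  al_pos : ∀ τ, 0 < al τ
  al_le : ∀ τ, al τ ≤ Real.pi / 2
  al_b : ∀ τ, al (b τ) = al τ
  la_a : ∀ τ x, la (a τ) x = - la τ x
  lb_a : ∀ τ x, (lb (a τ) x + Real.cos (al (a τ)) * la (a τ) x) * Real.sin (al τ)
    = (lb τ x + Real.cos (al τ) * la τ x) * Real.sin (al (a τ))
  lb_b : ∀ τ x, lb (b τ) x = - lb τ x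
  la_b : ∀ τ x, la (b τ) x = la τ x + 2 * Real.cos (al τ) * lb τ x
  UA_b : ∀ τ, UA (b τ) = UA τ
  UB_a : ∀ τ, UB (a τ) = UB τ
  UA_pos : ∀ τ x, x ∈ UA τ → 0 < la τ x
  UB_pos : ∀ τ x, x ∈ UB τ → 0 < lb τ x
  per : ∀ τ, ∃ N : ℕ, 0 < N ∧ (fun t => a (b t))^[N] τ = τ ∧
    ∑ i ∈ Finset.range N, al ((fun t => a (b t))^[i] τ) = Real.pi

theorem sector_arg (z : ℂ) (A B : ℝ) (hA : 0 < A) (hA' : A ≤ Real.pi) (hB : 0 < B)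
    (hB' : B ≤ Real.pi) (h1 : 0 < Real.sin B * z.re - Real.cos B * z.im)
    (h2 : 0 < Real.sin A * z.re + Real.cos A * z.im) :
    ∃ t, -A < t ∧ t < B ∧ z = ‖z‖ * Complex.exp (t * Complex.I) ∧ z ≠ 0 := by
  have hz : z ≠ 0 := by
    rintro rfl; simp at h1
  have hzn : 0 < ‖z‖ := norm_pos_iff.2 hz
  have hre : z.re = ‖z‖ * Real.cos z.arg := (Complex.norm_mul_cos_arg z).symm
  have him : z.im = ‖z‖ * Real.sin z.arg := (Complex.norm_mul_sin_arg z).symm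
  have h3 : 0 < Real.sin (B - z.arg) := by
    rw [Real.sin_sub]
    rw [hre, him] at h1
    by_contra hcon
    push Not at hcon
    nlinarith
  have h4 : 0 < Real.sin (A + z.arg) := by
    rw [Real.sin_add]
    rw [hre, him] at h2
    by_contra hcon
    push Not at hcon
    nlinarith
  refine ⟨z.arg, ?_, ?_, (Complex.norm_mul_exp_arg_mul_I z).symm, hz⟩
  · by_contra hcon
    push Not at hcon
    have := Real.sin_nonpos_of_nonpos_of_neg_pi_le (x := A + z.arg) (by linarith)
      (by linarith [Complex.neg_pi_lt_arg z])
    linarith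
  · by_contra hcon
    push Not at hcon
    have := Real.sin_nonpos_of_nonpos_of_neg_pi_le (x := B - z.arg) (by linarith)
      (by linarith [Complex.arg_le_pi z])
    linarith

namespace CenterData
variable {X T : Type*} {a b : T → T} {al : T → ℝ} {la lb : T → X → ℝ}
    {UA UB : T → Set X} 

/-- polar coordinate -/
noncomputable def zt (al : T → ℝ) (la lb : T → X → ℝ) (τ : T) (x : X) : ℂ :=
  ⟨(lb τ x + Real.cos (al τ) * la τ x) / Real.sin (al τ), la τ x⟩

theorem sin_pos (h : CenterData a b al la lb UA UB) (τ : T) : 0 < Real.sin (al τ) :=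
  Real.sin_pos_of_pos_of_lt_pi (h.al_pos τ) (by linarith [h.al_le τ, Real.pi_pos])

theorem zt_a (h : CenterData a b al la lb UA UB) (τ : T) (x : X) :
    zt al la lb (a τ) x = (starRingEnd ℂ) (zt al la lb τ x) := by
  have h1 := h.sin_pos τ
  have h2 := h.sin_pos (a τ)
  apply Complex.ext
  · simp only [zt, Complex.conj_re]
    rw [div_eq_div_iff h2.ne' h1.ne']
    exact h.lb_a τ x
  · simp only [zt, Complex.conj_im]
    exact h.la_a τ x

theorem zt_b (h : CenterData a b al la lb UA UB) (τ : T) (x : X) :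
    zt al la lb (b τ) x = Complex.exp ((2 * al τ : ℝ) * Complex.I) *
      (starRingEnd ℂ) (zt al la lb τ x) := by
  have h1 := h.sin_pos τ
  have h3 := Real.sin_sq_add_cos_sq (al τ)
  apply Complex.ext
  · simp only [zt, Complex.mul_re, Complex.exp_ofReal_mul_I_re, Complex.exp_ofReal_mul_I_im,
      Complex.conj_re, Complex.conj_im, h.al_b, h.lb_b, h.la_b, Real.sin_two_mul, Real.cos_two_mul]
    field_simp
    linear_combination (-2 * la τ x * Real.cos (al τ)) * h3
  · simp only [zt, Complex.mul_im, Complex.exp_ofReal_mul_I_re, Complex.exp_ofReal_mul_I_im,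
      Complex.conj_re, Complex.conj_im, h.al_b, h.lb_b, h.la_b, Real.sin_two_mul, Real.cos_two_mul]
    field_simp
    ring

theorem zt_p (h : CenterData a b al la lb UA UB) (τ : T) (x : X) :
    zt al la lb (a (b τ)) x = Complex.exp ((-(2 * al τ) : ℝ) * Complex.I) *
      zt al la lb τ x := by
  rw [h.zt_a, h.zt_b, map_mul, Complex.conj_conj, ← Complex.exp_conj,
    map_mul, Complex.conj_ofReal, Complex.conj_I]
  congr 2
  push_cast
  ring

theorem zt_iter (h : CenterData a b al la lb UA UB) (τ : T) (x : X) (i : ℕ) :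
    zt al la lb ((fun t => a (b t))^[i] τ) x =
      Complex.exp ((-(∑ j ∈ Finset.range i, 2 * al ((fun t => a (b t))^[j] τ)) : ℝ) * Complex.I) *
      zt al la lb τ x := by
  induction i with
  | zero => simp
  | succ i ih =>
    rw [Function.iterate_succ_apply', h.zt_p, ih, Finset.sum_range_succ, ← mul_assoc,
      ← Complex.exp_add]
    congr 2
    push_cast
    ring

theorem lb_eq (h : CenterData a b al la lb UA UB) (τ : T) (x : X) :
    lb τ x = Real.sin (al τ) * (zt al la lb τ x).re - Real.cos (al τ) * (zt al la lb τ x).im := by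
  have h1 := h.sin_pos τ
  simp only [zt]
  field_simp
  ring

theorem la_eq (τ : T) (x : X) : la τ x = (zt al la lb τ x).im := rfl

theorem UB_arg (h : CenterData a b al la lb UA UB) (τ : T) (x : X) (hx : x ∈ UB τ) :
    ∃ t, - al (a τ) < t ∧ t < al τ ∧
      zt al la lb τ x = ‖zt al la lb τ x‖ * Complex.exp (t * Complex.I) ∧
      zt al la lb τ x ≠ 0 := by
  have h1 := h.UB_pos _ _ hx
  have h2 := h.UB_pos (a τ) x (by rwa [h.UB_a])
  rw [h.lb_eq] at h1 h2
  rw [h.zt_a] at h2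
  simp only [Complex.conj_re, Complex.conj_im] at h2
  have := Real.pi_pos
  exact sector_arg _ _ _ (h.al_pos _) (by linarith [h.al_le (a τ)]) (h.al_pos _)
    (by linarith [h.al_le τ]) h1 (by linarith)

theorem UA_arg (h : CenterData a b al la lb UA UB) (τ : T) (x : X) (hx : x ∈ UA τ) :
    ∃ t, 0 < t ∧ t < 2 * al τ ∧
      zt al la lb τ x = ‖zt al la lb τ x‖ * Complex.exp (t * Complex.I) ∧
      zt al la lb τ x ≠ 0 := by
  have h1 := h.UA_pos _ _ hx
  have h2 := h.UA_pos (b τ) x (by rwa [h.UA_b])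
  rw [la_eq (al := al) (la := la) (lb := lb)] at h1 h2
  rw [h.zt_b] at h2
  have := Real.pi_pos
  set z := zt al la lb τ x with hz
  simp only [Complex.mul_im, Complex.exp_ofReal_mul_I_re, Complex.exp_ofReal_mul_I_im,
      Complex.conj_re, Complex.conj_im, Real.sin_two_mul, Real.cos_two_mul] at h2
  have h3 := Real.sin_sq_add_cos_sq (al τ)
  obtain ⟨t, ht1, ht2, ht3, ht4⟩ := sector_arg
    (Complex.exp ((-(al τ) : ℝ) * Complex.I) * z) (al τ) (al τ) (h.al_pos _)
    (by linarith [h.al_le τ]) (h.al_pos _) (by linarith [h.al_le τ])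
    (by
      simp only [Complex.mul_im, Complex.mul_re, Complex.exp_ofReal_mul_I_re,
        Complex.exp_ofReal_mul_I_im, Real.sin_neg, Real.cos_neg]
      have : z.im * (Real.sin (al τ)^2 + Real.cos (al τ)^2) = z.im := by rw [h3, mul_one]
      linarith [h2])
    (by
      simp only [Complex.mul_im, Complex.mul_re, Complex.exp_ofReal_mul_I_re,
        Complex.exp_ofReal_mul_I_im, Real.sin_neg, Real.cos_neg]
      have : z.im * (Real.sin (al τ)^2 + Real.cos (al τ)^2) = z.im := by rw [h3, mul_one]
      linarith [h1])
  refine ⟨t + al τ, by linarith, by linarith, ?_, right_ne_zero_of_mul ht4⟩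
  rw [norm_mul, Complex.norm_exp_ofReal_mul_I, one_mul] at ht3
  calc z = Complex.exp ((al τ : ℝ) * Complex.I) * (Complex.exp ((-(al τ) : ℝ) * Complex.I) * z) := by
        rw [← mul_assoc, ← Complex.exp_add]; simp
    _ = _ := by
        rw [ht3, mul_left_comm, ← Complex.exp_add]
        congr 2
        push_cast; ring

theorem no_coincide (z w : ℂ) (A t t' : ℝ) (h1 : w = Complex.exp ((-A : ℝ) * Complex.I) * z)
    (hz : z ≠ 0) (ht : z = ‖z‖ * Complex.exp (t * Complex.I))
    (ht' : w = ‖w‖ * Complex.exp (t' * Complex.I))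
    (hlo : t < t' + A) (hhi : t' + A < t + 2 * Real.pi) : False := by
  have hn : ‖w‖ = ‖z‖ := by rw [h1, norm_mul, Complex.norm_exp_ofReal_mul_I, one_mul]
  have hzn : (‖z‖ : ℂ) ≠ 0 := by exact_mod_cast (norm_pos_iff.2 hz).ne'
  have h2 : (‖z‖ : ℂ) * Complex.exp (t' * Complex.I) =
      ‖z‖ * Complex.exp ((-A : ℝ) * Complex.I + t * Complex.I) := by
    calc (‖z‖ : ℂ) * Complex.exp (t' * Complex.I) = w := by rw [← hn]; exact ht'.symm
      _ = Complex.exp ((-A : ℝ) * Complex.I) * z := h1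
      _ = Complex.exp ((-A : ℝ) * Complex.I) * (‖z‖ * Complex.exp (t * Complex.I)) :=
        congrArg _ ht
      _ = _ := by rw [Complex.exp_add]; ring
  have h3 := mul_left_cancel₀ hzn h2
  rw [Complex.exp_eq_exp_iff_exists_int] at h3
  obtain ⟨n, hn⟩ := h3
  have h4 : t' = -A + t + n * (2 * Real.pi) := by
    have := congrArg Complex.im hn
    simpa using this
  have hp := Real.pi_pos
  have h5 : (0:ℝ) < n := by
    by_contra hc
    push Not at hc
    nlinarith
  have h6 : (n:ℝ) < 1 := by
    by_contra hc
    push Not at hc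
    nlinarith
  have h7 : (0:ℤ) < n := by exact_mod_cast h5
  have h8 : n < (1:ℤ) := by exact_mod_cast h6
  omega

theorem al_a_iter (h : CenterData a b al la lb UA UB) (τ : T) (i : ℕ) :
    al (a ((fun t => a (b t))^[i+1] τ)) = al ((fun t => a (b t))^[i] τ) := by
  rw [Function.iterate_succ_apply', h.ha, h.al_b]

theorem sum_mono (h : CenterData a b al la lb UA UB) (τ : T) {i j : ℕ} (hij : i ≤ j) :
    ∑ j ∈ Finset.range i, 2 * al ((fun t => a (b t))^[j] τ) ≤
    ∑ j ∈ Finset.range j, 2 * al ((fun t => a (b t))^[j] τ) :=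
  Finset.sum_le_sum_of_subset_of_nonneg (Finset.range_mono hij)
    (fun k _ _ => by linarith [h.al_pos ((fun t => a (b t))^[k] τ)])

theorem main_BB (h : CenterData a b al la lb UA UB) (τ : T) (x : X) (i : ℕ)
    (hx : x ∈ UB τ) (hx' : x ∈ UB ((fun t => a (b t))^[i] τ)) :
    (fun t => a (b t))^[i] τ = τ := by
  obtain ⟨N, hN, hper, hsum⟩ := h.per τ
  have hmod : (fun t => a (b t))^[i] τ = (fun t => a (b t))^[i % N] τ :=
    (Function.IsPeriodicPt.iterate_mod_apply (f := fun t => a (b t)) hper i).symm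
  rw [hmod] at hx' ⊢
  have hlt := Nat.mod_lt i hN
  generalize i % N = m at *
  rcases m with _ | m
  · rfl
  exfalso
  obtain ⟨N, rfl⟩ : ∃ k, N = k + 1 := ⟨N - 1, by omega⟩
  obtain ⟨t, ht1, ht2, ht3, ht4⟩ := h.UB_arg _ _ hx
  obtain ⟨t', ht1', ht2', ht3', -⟩ := h.UB_arg _ _ hx'
  rw [h.al_a_iter] at ht1'
  have haτ : al (a τ) = al ((fun t => a (b t))^[N] τ) := by
    conv_lhs => rw [← hper]
    exact h.al_a_iter τ N
  rw [haτ] at ht1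
  have m1 := h.sum_mono τ (show 0 ≤ m by omega)
  have m2 := h.sum_mono τ (show m + 1 ≤ N by omega)
  have hS : ∑ j ∈ Finset.range (N+1), 2 * al ((fun t => a (b t))^[j] τ) = 2 * Real.pi := by
    rw [← Finset.mul_sum, hsum]
  have e1 := Finset.sum_range_succ (fun j => 2 * al ((fun t => a (b t))^[j] τ)) m
  have e2 := Finset.sum_range_succ (fun j => 2 * al ((fun t => a (b t))^[j] τ)) N
  have e3 := Finset.sum_range_succ (fun j => 2 * al ((fun t => a (b t))^[j] τ)) (m+1)
  have e0 := Finset.sum_range_one (fun j => 2 * al ((fun t => a (b t))^[j] τ))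
  simp only [Function.iterate_zero, id] at e0
  simp only [Finset.range_zero, Finset.sum_empty] at m1
  have p1 := h.al_pos ((fun t => a (b t))^[m] τ)
  have p2 := h.al_pos ((fun t => a (b t))^[m+1] τ)
  refine no_coincide _ _ _ t t' (h.zt_iter τ x (m+1)) ht4 ht3 ht3' ?_ ?_
  · rcases m with _ | m
    · simp only [Function.iterate_zero, id] at *
      linarith
    · have m3 := h.sum_mono τ (show 1 ≤ m + 1 by omega)
      linarith [h.al_pos τ]
  · rcases Nat.lt_or_ge (m+1) N with hm | hm
    · have m4 := h.sum_mono τ (show m + 1 + 1 ≤ N by omega)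
      linarith [h.al_pos ((fun t => a (b t))^[N] τ)]
    · obtain rfl : N = m + 1 := by omega
      linarith

theorem main_AA (h : CenterData a b al la lb UA UB) (τ : T) (x : X) (i : ℕ)
    (hx : x ∈ UA τ) (hx' : x ∈ UA ((fun t => a (b t))^[i] τ)) :
    (fun t => a (b t))^[i] τ = τ := by
  obtain ⟨N, hN, hper, hsum⟩ := h.per τ
  have hmod : (fun t => a (b t))^[i] τ = (fun t => a (b t))^[i % N] τ :=
    (Function.IsPeriodicPt.iterate_mod_apply (f := fun t => a (b t)) hper i).symm
  rw [hmod] at hx' ⊢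
  have hlt := Nat.mod_lt i hN
  generalize i % N = m at *
  rcases m with _ | m
  · rfl
  exfalso
  obtain ⟨t, ht1, ht2, ht3, ht4⟩ := h.UA_arg _ _ hx
  obtain ⟨t', ht1', ht2', ht3', -⟩ := h.UA_arg _ _ hx'
  have hS : ∑ j ∈ Finset.range N, 2 * al ((fun t => a (b t))^[j] τ) = 2 * Real.pi := by
    rw [← Finset.mul_sum, hsum]
  have e0 := Finset.sum_range_one (fun j => 2 * al ((fun t => a (b t))^[j] τ))
  simp only [Function.iterate_zero, id] at e0
  have m2 := h.sum_mono τ (show 1 ≤ m + 1 by omega)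
  have m3 := h.sum_mono τ (show m + 1 + 1 ≤ N by omega)
  have e3 := Finset.sum_range_succ (fun j => 2 * al ((fun t => a (b t))^[j] τ)) (m+1)
  refine no_coincide _ _ _ t t' (h.zt_iter τ x (m+1)) ht4 ht3 ht3' ?_ ?_ <;> linarith

theorem main_AB (h : CenterData a b al la lb UA UB) (τ : T) (x : X) (i : ℕ)
    (hx : x ∈ UA τ) (hx' : x ∈ UB ((fun t => a (b t))^[i] τ)) :
    (fun t => a (b t))^[i] τ = τ ∨ (fun t => a (b t))^[i] τ = a (b τ) := by
  obtain ⟨N, hN, hper, hsum⟩ := h.per τ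
  have hmod : (fun t => a (b t))^[i] τ = (fun t => a (b t))^[i % N] τ :=
    (Function.IsPeriodicPt.iterate_mod_apply (f := fun t => a (b t)) hper i).symm
  rw [hmod] at hx' ⊢
  have hlt := Nat.mod_lt i hN
  generalize i % N = m at *
  rcases m with _ | _ | m
  · left; rfl
  · right; rfl
  exfalso
  obtain ⟨t, ht1, ht2, ht3, ht4⟩ := h.UA_arg _ _ hx
  obtain ⟨t', ht1', ht2', ht3', -⟩ := h.UB_arg _ _ hx'
  rw [h.al_a_iter] at ht1'
  have hS : ∑ j ∈ Finset.range N, 2 * al ((fun t => a (b t))^[j] τ) = 2 * Real.pi := by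
    rw [← Finset.mul_sum, hsum]
  have e0 := Finset.sum_range_one (fun j => 2 * al ((fun t => a (b t))^[j] τ))
  simp only [Function.iterate_zero, id] at e0
  have m2 := h.sum_mono τ (show 1 ≤ m + 1 by omega)
  have m3 := h.sum_mono τ (show m + 1 + 1 + 1 ≤ N by omega)
  have e3 := Finset.sum_range_succ (fun j => 2 * al ((fun t => a (b t))^[j] τ)) (m+1)
  have e4 := Finset.sum_range_succ (fun j => 2 * al ((fun t => a (b t))^[j] τ)) (m+1+1)
  have p1 := h.al_pos ((fun t => a (b t))^[m+1] τ)
  have p2 := h.al_pos ((fun t => a (b t))^[m+1+1] τ)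
  refine no_coincide _ _ _ t t' (h.zt_iter τ x (m+1+1)) ht4 ht3 ht3' ?_ ?_ <;> linarith

theorem main_cover (h : CenterData a b al la lb UA UB) (τ : T) (x : X) :
    ∃ i, (0 ≤ la ((fun t => a (b t))^[i] τ) x ∧ 0 ≤ lb ((fun t => a (b t))^[i] τ) x) ∨
      (0 ≤ la (b ((fun t => a (b t))^[i] τ)) x ∧ 0 ≤ lb (b ((fun t => a (b t))^[i] τ)) x) := by
  obtain ⟨N, hN, hper, hsum⟩ := h.per τ
  have hS : ∑ j ∈ Finset.range N, 2 * al ((fun t => a (b t))^[j] τ) = 2 * Real.pi := by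
    rw [← Finset.mul_sum, hsum]
  have hpi := Real.pi_pos
  obtain ⟨t, ht0, ht1, ht⟩ : ∃ t : ℝ, 0 ≤ t ∧ t < 2 * Real.pi ∧
      zt al la lb τ x = ‖zt al la lb τ x‖ * Complex.exp (t * Complex.I) := by
    have e := (Complex.norm_mul_exp_arg_mul_I (zt al la lb τ x)).symm
    rcases le_or_gt 0 (zt al la lb τ x).arg with h0 | h0
    · exact ⟨_, h0, by linarith [Complex.arg_le_pi (zt al la lb τ x)], e⟩
    · refine ⟨(zt al la lb τ x).arg + 2 * Real.pi,
        by linarith [Complex.neg_pi_lt_arg (zt al la lb τ x)], by linarith, ?_⟩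
      conv_lhs => rw [e]
      congr 1
      push_cast
      rw [add_mul, Complex.exp_add, Complex.exp_two_pi_mul_I, mul_one]
  obtain ⟨i, hi1, hi2⟩ : ∃ i, ∑ j ∈ Finset.range i, 2 * al ((fun t => a (b t))^[j] τ) ≤ t ∧
      t < ∑ j ∈ Finset.range (i+1), 2 * al ((fun t => a (b t))^[j] τ) := by
    classical
    have hex : ∃ m, t < ∑ j ∈ Finset.range m, 2 * al ((fun t => a (b t))^[j] τ) :=
      ⟨N, by rw [hS]; exact ht1⟩
    have hm := Nat.find_spec hex
    have hm2 := fun k => Nat.find_min hex (m := k)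
    rcases hk : Nat.find hex with _ | k
    · rw [hk] at hm; simp at hm; linarith
    · rw [hk] at hm hm2
      exact ⟨k, not_lt.1 (hm2 k (by omega)), hm⟩
  rw [Finset.sum_range_succ] at hi2
  have hz := h.zt_iter τ x i
  set τ' := (fun t => a (b t))^[i] τ with hτ'
  set A := ∑ j ∈ Finset.range i, 2 * al ((fun t => a (b t))^[j] τ) with hA
  have hz2 : zt al la lb τ' x = ‖zt al la lb τ x‖ * Complex.exp ((t - A : ℝ) * Complex.I) := by
    rw [hz]
    conv_lhs => rw [ht]
    rw [mul_left_comm, ← Complex.exp_add]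
    congr 2
    push_cast
    ring
  set n := ‖zt al la lb τ x‖ with hn
  have hn0 : 0 ≤ n := norm_nonneg _
  have hal := h.al_le τ'
  have key : ∀ (τ'' : T) (ψ : ℝ), zt al la lb τ'' x = n * Complex.exp ((ψ : ℝ) * Complex.I) →
      0 ≤ ψ → ψ ≤ al τ'' → 0 ≤ la τ'' x ∧ 0 ≤ lb τ'' x := by
    intro τ'' ψ hz h0 h1
    have hal := h.al_le τ''
    rw [h.lb_eq, la_eq (al := al) (la := la) (lb := lb), hz]
    simp only [Complex.re_ofReal_mul, Complex.im_ofReal_mul, Complex.exp_ofReal_mul_I_re,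
      Complex.exp_ofReal_mul_I_im]
    constructor
    · exact mul_nonneg hn0 (Real.sin_nonneg_of_nonneg_of_le_pi h0 (by linarith))
    · have : 0 ≤ n * Real.sin (al τ'' - ψ) :=
        mul_nonneg hn0 (Real.sin_nonneg_of_nonneg_of_le_pi (by linarith) (by linarith))
      rw [Real.sin_sub] at this
      linarith
  refine ⟨i, ?_⟩
  rcases le_or_gt (t - A) (al τ') with hc | hc
  · left
    exact key τ' (t - A) hz2 (by linarith) hc
  · right
    refine key (b τ') (2 * al τ' - (t - A)) ?_ (by linarith) (by rw [h.al_b]; linarith)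
    rw [h.zt_b, hz2, map_mul, ← Complex.exp_conj, map_mul, Complex.conj_ofReal, Complex.conj_ofReal,
      Complex.conj_I, mul_left_comm, ← Complex.exp_add]
    congr 2
    push_cast
    ring

end CenterData



namespace CenterData
variable {X T : Type*} {a b : T → T} {al : T → ℝ} {la lb : T → X → ℝ}
    {UA UB : T → Set X}

theorem orbit (h : CenterData a b al la lb UA UB) (τ τ' : T)
    (hE : Relation.EqvGen (fun x y => y = a x ∨ y = b x) τ τ') :
    ∃ i, τ' = (fun t => a (b t))^[i] τ ∨ τ' = b ((fun t => a (b t))^[i] τ) := by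
  have hA : ∀ i, ∃ j, a ((fun t => a (b t))^[i] τ) = b ((fun t => a (b t))^[j] τ) := by
    intro i
    obtain ⟨N, hN, hper, -⟩ := h.per τ
    obtain ⟨N, rfl⟩ : ∃ k, N = k + 1 := ⟨N - 1, by omega⟩
    refine ⟨i + N, ?_⟩
    have : (fun t => a (b t))^[i] τ = (fun t => a (b t))^[i + N + 1] τ := by
      conv_lhs => rw [← hper]
      rw [← Function.iterate_add_apply, add_assoc]
    rw [this, Function.iterate_succ_apply', h.ha]
  have hcl : ∀ x, (∃ i, x = (fun t => a (b t))^[i] τ ∨ x = b ((fun t => a (b t))^[i] τ)) →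
      (∃ i, a x = (fun t => a (b t))^[i] τ ∨ a x = b ((fun t => a (b t))^[i] τ)) ∧
      (∃ i, b x = (fun t => a (b t))^[i] τ ∨ b x = b ((fun t => a (b t))^[i] τ)) := by
    rintro x ⟨i, rfl | rfl⟩
    · obtain ⟨j, hj⟩ := hA i
      exact ⟨⟨j, Or.inr hj⟩, ⟨i, Or.inr rfl⟩⟩
    · exact ⟨⟨i+1, Or.inl (Function.iterate_succ_apply' (fun t => a (b t)) i τ).symm⟩, ⟨i, Or.inl (h.hb _)⟩⟩
  have : ∀ x y, Relation.EqvGen (fun x y => y = a x ∨ y = b x) x y →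
      ((∃ i, x = (fun t => a (b t))^[i] τ ∨ x = b ((fun t => a (b t))^[i] τ)) ↔
      (∃ i, y = (fun t => a (b t))^[i] τ ∨ y = b ((fun t => a (b t))^[i] τ))) := by
    intro x y hxy
    induction hxy with
    | rel x y hxy =>
      rcases hxy with rfl | rfl
      · refine ⟨fun hx => (hcl x hx).1, fun hx => ?_⟩
        have := (hcl _ hx).1
        rwa [h.ha] at this
      · refine ⟨fun hx => (hcl x hx).2, fun hx => ?_⟩
        have := (hcl _ hx).2
        rwa [h.hb] at this
    | refl x => rfl
    | symm x y _ ih => exact ih.symm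
    | trans x y z _ _ ih1 ih2 => exact ih1.trans ih2
  exact (this τ τ' hE).1 ⟨0, Or.inl rfl⟩

theorem adj_AA (h : CenterData a b al la lb UA UB) (f f' : T)
    (hE : Relation.EqvGen (fun x y => y = a x ∨ y = b x) f f') (x : X)
    (hx : x ∈ UA f) (hx' : x ∈ UA f') : f' = f ∨ f' = b f := by
  obtain ⟨i, rfl | rfl⟩ := h.orbit f f' hE
  · exact Or.inl (h.main_AA f x i hx hx')
  · rw [h.UA_b] at hx'
    exact Or.inr (congrArg b (h.main_AA f x i hx hx'))

theorem adj_BB (h : CenterData a b al la lb UA UB) (f f' : T)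
    (hE : Relation.EqvGen (fun x y => y = a x ∨ y = b x) f f') (x : X)
    (hx : x ∈ UB f) (hx' : x ∈ UB f') : f' = f ∨ f' = a f := by
  obtain ⟨i, rfl | rfl⟩ := h.orbit f f' hE
  · exact Or.inl (h.main_BB f x i hx hx')
  · rw [← h.UB_a] at hx'
    have := h.main_BB f x (i+1) hx (by rwa [Function.iterate_succ_apply'])
    rw [Function.iterate_succ_apply'] at this
    right
    conv_rhs => rw [← this]
    exact (h.ha _).symm

theorem adj_AB (h : CenterData a b al la lb UA UB) (f f' : T)
    (hE : Relation.EqvGen (fun x y => y = a x ∨ y = b x) f f') (x : X)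
    (hx : x ∈ UA f) (hx' : x ∈ UB f') :
    ∃ e, (e = f ∨ e = b f) ∧ (e = f' ∨ e = a f') := by
  obtain ⟨i, rfl | rfl⟩ := h.orbit f f' hE
  · rcases h.main_AB f x i hx hx' with h1 | h1
    · exact ⟨f, Or.inl rfl, Or.inl h1.symm⟩
    · refine ⟨b f, Or.inr rfl, Or.inr ?_⟩
      rw [h1, h.ha]
  · rw [← h.UB_a] at hx'
    have := h.main_AB f x (i+1) hx (by rwa [Function.iterate_succ_apply'])
    rw [Function.iterate_succ_apply'] at this
    rcases this with h1 | h1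
    · exact ⟨f, Or.inl rfl, Or.inr h1.symm⟩
    · exact ⟨b f, Or.inr rfl, Or.inl (h.ha.injective h1).symm⟩

end CenterData

/-- same vertex of type `s` -/
def SameV {T : Type*} (σ : Fin 3 → T → T) (s : Fin 3) : T → T → Prop :=
  Relation.EqvGen (fun x y => ∃ t, t ≠ s ∧ y = σ t x)

section
variable {X T : Type*}

structure CenterAt (σ : Fin 3 → T → T) (al : Fin 3 → T → ℝ) (l : Fin 3 → T → X → ℝ)
    (U : Fin 3 → T → Set X) (s a b : Fin 3) : Prop where
  dat : CenterData (σ a) (σ b) (al s) (l a) (l b) (U a) (U b)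
  hs : ∀ t, t ≠ s ↔ (t = a ∨ t = b)
  hab : a ≠ b

variable {σ : Fin 3 → T → T} {al : Fin 3 → T → ℝ} {l : Fin 3 → T → X → ℝ}
    {U : Fin 3 → T → Set X} {s a b : Fin 3}

theorem SameV.symm {s : Fin 3} {x y : T} (h : SameV σ s x y) : SameV σ s y x :=
  Relation.EqvGen.symm _ _ h
theorem SameV.trans {s : Fin 3} {x y z : T} (h : SameV σ s x y) (h' : SameV σ s y z) :
    SameV σ s x z := Relation.EqvGen.trans _ _ _ h h'
theorem SameV.refl {s : Fin 3} (x : T) : SameV σ s x x := Relation.EqvGen.refl _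
theorem SameV.mk {s t : Fin 3} (x : T) (h : t ≠ s) : SameV σ s x (σ t x) :=
  Relation.EqvGen.rel _ _ ⟨t, h, rfl⟩

theorem CenterAt.eqv (h : CenterAt σ al l U s a b) {f f' : T} (hE : SameV σ s f f') :
    Relation.EqvGen (fun x y => y = σ a x ∨ y = σ b x) f f' := by
  have : ∀ x y, (∃ t, t ≠ s ∧ y = σ t x) → (y = σ a x ∨ y = σ b x) := by
    rintro x y ⟨t, ht, rfl⟩
    rcases (h.hs t).1 ht with rfl | rfl
    · exact Or.inl rfl
    · exact Or.inr rfl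
  induction hE with
  | rel x y h => exact Relation.EqvGen.rel _ _ (this _ _ h)
  | refl x => exact Relation.EqvGen.refl _
  | symm x y _ ih => exact ih.symm
  | trans x y z _ _ ih1 ih2 => exact ih1.trans _ _ _ ih2

theorem CenterAt.step (h : CenterAt σ al l U s a b) (f f' : T) (hE : SameV σ s f f') (x : X)
    (s1 s3 : Fin 3) (h1 : s1 ≠ s) (h3 : s3 ≠ s) (hx : x ∈ U s1 f) (hx' : x ∈ U s3 f') :
    ∃ e, SameV σ s1 e f ∧ SameV σ s3 e f' := by
  have hEE := h.eqv hE
  have hEE' := h.eqv hE.symm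
  have eA : ∀ f f' : T, (f' = f ∨ f' = σ b f) → SameV σ a f' f := by
    rintro f f' (rfl | rfl)
    · exact SameV.refl _
    · exact (SameV.mk _ h.hab.symm).symm
  have eB : ∀ f f' : T, (f' = f ∨ f' = σ a f) → SameV σ b f' f := by
    rintro f f' (rfl | rfl)
    · exact SameV.refl _
    · exact (SameV.mk _ h.hab).symm
  rcases (h.hs s1).1 h1 with rfl | rfl <;> rcases (h.hs s3).1 h3 with rfl | rfl
  · exact ⟨f', eA _ _ (h.dat.adj_AA f f' hEE x hx hx'), SameV.refl _⟩
  · obtain ⟨e, he1, he2⟩ := h.dat.adj_AB f f' hEE x hx hx'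
    exact ⟨e, eA _ _ he1, eB _ _ he2⟩
  · obtain ⟨e, he1, he2⟩ := h.dat.adj_AB f' f hEE' x hx' hx
    exact ⟨e, eB _ _ he2, eA _ _ he1⟩
  · exact ⟨f', eB _ _ (h.dat.adj_BB f f' hEE x hx hx'), SameV.refl _⟩

theorem CenterAt.cover (h : CenterAt σ al l U s a b) (τ : T) (x : X) :
    ∃ τ', SameV σ s τ τ' ∧ 0 ≤ l a τ' x ∧ 0 ≤ l b τ' x := by
  have ha : a ≠ s := (h.hs a).2 (Or.inl rfl)
  have hb : b ≠ s := (h.hs b).2 (Or.inr rfl)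
  have hit : ∀ i, SameV σ s τ ((fun t => σ a (σ b t))^[i] τ) := by
    intro i
    induction i with
    | zero => exact SameV.refl _
    | succ i ih =>
      rw [Function.iterate_succ_apply']
      exact ih.trans ((SameV.mk _ hb).trans (SameV.mk _ ha))
  obtain ⟨i, h1 | h1⟩ := h.dat.main_cover τ x
  · exact ⟨_, hit i, h1⟩
  · exact ⟨_, (hit i).trans (SameV.mk _ hb), h1⟩

theorem tess_main [MetricSpace X] [SimplyConnectedSpace X]
    [LocallyPathConnectedSpace X]
    (h0 : CenterAt σ al l U 0 2 1) (h1 : CenterAt σ al l U 1 2 0) (h2 : CenterAt σ al l U 2 0 1)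
    (hUo : ∀ s τ, IsOpen (U s τ)) (hUc : ∀ s τ, IsPreconnected (U s τ))
    (hOV : ∀ τ, (U 0 τ ∩ U 1 τ).Nonempty)
    (ε : ℝ) (hε : 0 < ε)
    (hcov : ∀ τ x, (∀ s, 0 ≤ l s τ x) → ∃ s, Metric.ball x ε ⊆ U s τ) (τ₀ : T) :
    (∀ τ τ', Relation.ReflTransGen (fun t t' => ∃ s, t' = σ s t) τ τ' →
      (U 0 τ ∩ U 0 τ').Nonempty → SameV σ 0 τ τ') ∧ ∀ x, ∃ s τ, x ∈ U s τ := by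
  have hC : ∀ s, ∃ a b, CenterAt σ al l U s a b := by
    intro s
    fin_cases s
    · exact ⟨_, _, h0⟩
    · exact ⟨_, _, h1⟩
    · exact ⟨_, _, h2⟩
  have inv : ∀ s t τ, t ≠ s → U s (σ t τ) = U s τ := by
    intro s t τ hst
    fin_cases s <;> fin_cases t <;> first | exact absurd rfl hst | skip
    · exact h2.dat.UA_b τ
    · exact h1.dat.UB_a τ
    · exact h2.dat.UB_a τ
    · exact h0.dat.UB_a τ
    · exact h1.dat.UA_b τ
    · exact h0.dat.UA_b τ
  have pos : ∀ s τ x, x ∈ U s τ → 0 < l s τ x := by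
    intro s
    fin_cases s
    · exact h1.dat.UB_pos
    · exact h0.dat.UB_pos
    · exact h0.dat.UA_pos
  have invE : ∀ s τ τ', SameV σ s τ τ' → U s τ = U s τ' := by
    intro s τ τ' h
    induction h with
    | rel x y h => obtain ⟨t, ht, rfl⟩ := h; exact (inv s t x ht).symm
    | refl x => rfl
    | symm x y _ ih => exact ih.symm
    | trans x y z _ _ ih1 ih2 => exact ih1.trans ih2
  let R : T × Fin 3 → T × Fin 3 → Prop := fun i j => ∃ f, SameV σ i.2 f i.1 ∧ SameV σ j.2 f j.1
  let V : T × Fin 3 → Set X := fun i => U i.2 i.1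
  have hRrefl : ∀ i, R i i := fun i => ⟨i.1, SameV.refl _, SameV.refl _⟩
  have hRsymm : ∀ i j, R i j → R j i := fun i j ⟨f, h1, h2⟩ => ⟨f, h2, h1⟩
  have hb : ∀ x i j k, x ∈ V i → x ∈ V j → x ∈ V k → R i j → R j k → R i k := by
    rintro x ⟨τ1, s1⟩ ⟨τ2, s2⟩ ⟨τ3, s3⟩ hx1 hx2 hx3 ⟨f, hf1, hf2⟩ ⟨f', hf1', hf2'⟩
    dsimp only at *
    have hff : SameV σ s2 f f' := hf2.trans hf1'.symm
    by_cases e1 : s1 = s2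
    · subst e1
      exact ⟨f', hff.symm.trans hf1, hf2'⟩
    by_cases e3 : s3 = s2
    · subst e3
      exact ⟨f, hf1, hff.trans hf2'⟩
    obtain ⟨a, b, hc⟩ := hC s2
    obtain ⟨e, he1, he2⟩ := hc.step f f' hff x s1 s3 e1 e3
      (by rw [invE _ _ _ hf1]; exact hx1) (by rw [invE _ _ _ hf2']; exact hx3)
    exact ⟨e, he1.trans hf1, he2.trans hf2'⟩
  have hc : ∀ x i, x ∈ V i → ∃ j, R i j ∧ Metric.ball x ε ⊆ V j := by
    rintro x ⟨τ, s⟩ hx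
    obtain ⟨a, b, hc⟩ := hC s
    obtain ⟨τ', hτ', ha, hb⟩ := hc.cover τ x
    have hx' : x ∈ U s τ' := by rw [← invE _ _ _ hτ']; exact hx
    obtain ⟨t, ht⟩ := hcov τ' x (by
      intro t
      by_cases e : t = s
      · subst e; exact (pos _ _ _ hx').le
      · rcases (hc.hs t).1 e with rfl | rfl <;> assumption)
    exact ⟨(τ', t), ⟨τ', hτ'.symm, SameV.refl _⟩, ht⟩
  constructor
  · rintro τ τ' hlink ⟨x, hx, hx'⟩
    have ne0 : ∀ τ, (U 0 τ).Nonempty := fun τ => (hOV τ).mono Set.inter_subset_left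
    have ne1 : ∀ τ, (U 1 τ).Nonempty := fun τ => (hOV τ).mono Set.inter_subset_right
    have L0 : ∀ τ τ', SameV σ 0 τ τ' →
        Relation.ReflTransGen (fun a b => R a b ∧ (V a ∩ V b).Nonempty) (τ, 0) (τ', 0) := by
      intro τ τ' h
      refine Relation.ReflTransGen.single ⟨⟨τ, SameV.refl _, h⟩, ?_⟩
      show (U 0 τ ∩ U 0 τ').Nonempty
      rw [invE _ _ _ h, Set.inter_self]
      exact ne0 _
    have L1 : ∀ τ τ', SameV σ 1 τ τ' →
        Relation.ReflTransGen (fun a b => R a b ∧ (V a ∩ V b).Nonempty) (τ, 0) (τ', 0) := by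
      intro τ τ' h
      refine Relation.ReflTransGen.trans (b := (τ, 1)) (Relation.ReflTransGen.single
        ⟨⟨τ, SameV.refl _, SameV.refl _⟩, hOV τ⟩) ?_
      refine Relation.ReflTransGen.trans (b := (τ', 1)) (Relation.ReflTransGen.single
        ⟨⟨τ, SameV.refl _, h⟩, ?_⟩) (Relation.ReflTransGen.single
        ⟨⟨τ', SameV.refl _, SameV.refl _⟩, by rw [Set.inter_comm]; exact hOV τ'⟩)
      show (U 1 τ ∩ U 1 τ').Nonempty
      rw [invE _ _ _ h, Set.inter_self]
      exact ne1 _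
    have hl : Relation.ReflTransGen (fun a b => R a b ∧ (V a ∩ V b).Nonempty) (τ, 0) (τ', 0) := by
      clear hx'
      induction hlink with
      | refl => exact Relation.ReflTransGen.refl
      | tail _ h ih =>
        obtain ⟨s, rfl⟩ := h
        refine ih.trans ?_
        by_cases hs : s = 0
        · subst hs
          exact L1 _ _ (SameV.mk _ (by decide))
        · exact L0 _ _ (SameV.mk _ hs)
    obtain ⟨f, hf1, hf2⟩ := tiling_cover_aux V R (fun i => hUo _ _) (fun i => hUc _ _) hRrefl hRsymm hb ε hε hc
      (τ, 0) (τ', 0) hl x hx hx'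
    exact hf1.symm.trans hf2
  · intro x
    obtain ⟨z, hz, -⟩ := hOV τ₀
    obtain ⟨j, hj⟩ := tiling_cover_univ V (fun i => hUo _ _) ε hε
      (fun x i hx => (hc x i hx).imp fun j h => h.2) (τ₀, 0) z hz x
    exact ⟨_, _, hj⟩
end



theorem hp_lemma (X0 X1 X2 P0 P1 P2 n1 n2 Rc : ℝ) (hX0 : 0 < X0) (hP0 : 0 < P0)
    (hX : X0^2 = 1 + X1^2 + X2^2) (hP : P0^2 = 1 + P1^2 + P2^2) (hn : n1^2 + n2^2 = 1)
    (hp : 0 ≤ P1 * n1 + P2 * n2) (hRc : Rc^2 ≤ 1 + (P1 * n1 + P2 * n2)^2)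
    (h : X0 * P0 - X1 * P1 - X2 * P2 < Rc) : 0 < X1 * n1 + X2 * n2 := by
  by_contra hq
  push Not at hq
  set p := P1 * n1 + P2 * n2 with hpd
  set q := X1 * n1 + X2 * n2 with hqd
  set α := -X1 * n2 + X2 * n1 with hα
  set β := -P1 * n2 + P2 * n1 with hβ
  have hX' : X0^2 = 1 + q^2 + α^2 := by
    rw [hX, hqd, hα]; linear_combination (-(X1^2) - X2^2) * hn
  have hP' : P0^2 = 1 + p^2 + β^2 := by
    rw [hP, hpd, hβ]; linear_combination (-(P1^2) - P2^2) * hn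
  have hdot : X1 * P1 + X2 * P2 = p * q + α * β := by
    rw [hpd, hqd, hα, hβ]; linear_combination (-(X1 * P1) - X2 * P2) * hn
  set w := Real.sqrt (1 + p^2) with hw
  have hw2 : w^2 = 1 + p^2 := Real.sq_sqrt (by positivity)
  have hw0 : 0 ≤ w := Real.sqrt_nonneg _
  have hRw : Rc ≤ w := Real.le_sqrt_of_sq_le hRc
  have h1 : X0 * P0 < w + α * β := by nlinarith [mul_nonneg hp (neg_nonneg.2 hq)]
  have h2 : (w + α * β)^2 ≤ (X0 * P0)^2 := by
    rw [mul_pow, hX', hP', ← hw2]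
    nlinarith [sq_nonneg (β - α * w), mul_nonneg (sq_nonneg q) (sq_nonneg w), mul_nonneg (sq_nonneg q) (sq_nonneg β)]
  have h3 : 0 ≤ X0 * P0 := by positivity
  nlinarith

theorem cover_lemma (C S s c y0 y1 y2 : ℝ) (hC : 1 < C) (hS : 0 < S) (hCS : S^2 = C^2 - 1)
    (hs : 0 < s) (hc : 0 < c) (hy0 : 0 < y0) (hy : y0^2 = 1 + y1^2 + y2^2)
    (h0 : 0 ≤ s * (S * y0 - C * y1) - c * y2) (h1 : 0 ≤ s * (S * y0 + C * y1) - c * y2)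
    (h2 : 0 ≤ y2) :
    C * y0 + S * y1 < Real.sqrt (2 * C^2 - 1) ∨ C * y0 - S * y1 < Real.sqrt (2 * C^2 - 1) ∨
      c * y0 - S * s * y2 < c := by
  by_contra hcon
  push Not at hcon
  obtain ⟨a0, a1, a2⟩ := hcon
  have hr : C < Real.sqrt (2 * C^2 - 1) := Real.lt_sqrt_of_sq_lt (by nlinarith)
  have hy1 : 1 ≤ y0 := by nlinarith [sq_nonneg y1, sq_nonneg y2]
  have key : ∀ u, y1^2 = u^2 → 0 ≤ u → C < C * y0 - S * u →
      0 ≤ s * (S * y0 - C * u) - c * y2 → False := by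
    intro u hu hu0 e1 e2
    have f1 : 0 < C * (y0 - 1) - S * u := by linarith
    have f2 : 0 ≤ c * (y0 - 1) - S * s * y2 := by linarith
    have f3 : 0 ≤ S * s * y0 - C * s * u - c * y2 := by linarith
    -- S s (y0-1) y0 ≥ (y0-1) (C s u + c y2) ≥ s u (S u) + y2 (S s y2)
    have g1 : 0 ≤ (y0 - 1) * (S * s * y0 - C * s * u - c * y2) :=
      mul_nonneg (by linarith) f3
    have g2 : 0 ≤ s * u * (C * (y0 - 1) - S * u) := by positivity
    have g3 : 0 ≤ y2 * (c * (y0 - 1) - S * s * y2) := mul_nonneg h2 f2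
    have g4 : 0 ≤ S * s * ((y0 - 1) * y0 - u^2 - y2^2) := by nlinarith
    have g5 : (y0 - 1) * y0 - u^2 - y2^2 = -(y0 - 1) := by rw [← hu]; nlinarith
    rw [g5] at g4
    have hSs : 0 < S * s := mul_pos hS hs
    have g6 : y0 = 1 := by nlinarith
    rw [g6] at f1
    nlinarith
  rcases le_or_gt 0 y1 with hh | hh
  · exact key y1 rfl hh (by linarith) h0
  · exact key (-y1) (by ring) (by linarith) (by linarith) (by linarith)

structure Geo {T X : Type*} (C S : ℝ) (σ : Fin 3 → T → T) (th ph : T → ℝ)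
    (y0 y1 y2 : T → X → ℝ) : Prop where
  hC : 1 < C
  hS : 0 < S
  hCS : S^2 = C^2 - 1
  inv : ∀ s, Function.Involutive (σ s)
  ph_pos : ∀ τ, 0 < ph τ
  ph_le : ∀ τ, ph τ ≤ Real.pi / 4
  th_pos : ∀ τ, 0 < th τ
  th_lt : ∀ τ, th τ < Real.pi / 2
  hth : ∀ τ, C * Real.sin (th τ) = Real.cos (ph τ)
  th0 : ∀ τ, th (σ 0 τ) = th τ
  th1 : ∀ τ, th (σ 1 τ) = th τ
  ph0 : ∀ τ, ph (σ 0 τ) = ph τ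
  ph1 : ∀ τ, ph (σ 1 τ) = ph τ
  y0_pos : ∀ τ x, 0 < y0 τ x
  hyp : ∀ τ x, y0 τ x ^ 2 = 1 + y1 τ x ^ 2 + y2 τ x ^ 2
  r00 : ∀ τ x, y0 (σ 0 τ) x = y0 τ x + 2 * (Real.sin (th τ) * (S * y0 τ x - C * y1 τ x) - Real.cos (th τ) * y2 τ x) * (Real.sin (th τ) * S)
  r01 : ∀ τ x, y1 (σ 0 τ) x = y1 τ x + 2 * (Real.sin (th τ) * (S * y0 τ x - C * y1 τ x) - Real.cos (th τ) * y2 τ x) * (Real.sin (th τ) * C)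
  r02 : ∀ τ x, y2 (σ 0 τ) x = y2 τ x + 2 * (Real.sin (th τ) * (S * y0 τ x - C * y1 τ x) - Real.cos (th τ) * y2 τ x) * Real.cos (th τ)
  r10 : ∀ τ x, y0 (σ 1 τ) x = y0 τ x + 2 * (Real.sin (th τ) * (S * y0 τ x + C * y1 τ x) - Real.cos (th τ) * y2 τ x) * (Real.sin (th τ) * S)
  r11 : ∀ τ x, y1 (σ 1 τ) x = y1 τ x - 2 * (Real.sin (th τ) * (S * y0 τ x + C * y1 τ x) - Real.cos (th τ) * y2 τ x) * (Real.sin (th τ) * C)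
  r12 : ∀ τ x, y2 (σ 1 τ) x = y2 τ x + 2 * (Real.sin (th τ) * (S * y0 τ x + C * y1 τ x) - Real.cos (th τ) * y2 τ x) * Real.cos (th τ)
  r20 : ∀ τ x, y0 (σ 2 τ) x = y0 τ x
  r21 : ∀ τ x, y1 (σ 2 τ) x = y1 τ x
  r22 : ∀ τ x, y2 (σ 2 τ) x = - y2 τ x
  perO : ∀ τ, ∃ N : ℕ, 0 < N ∧ (fun t => σ 2 (σ 1 t))^[N] τ = τ ∧
    ∑ i ∈ Finset.range N, th ((fun t => σ 2 (σ 1 t))^[i] τ) = Real.pi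
  perV : ∀ τ, ∃ N : ℕ, 0 < N ∧ (fun t => σ 2 (σ 0 t))^[N] τ = τ ∧
    ∑ i ∈ Finset.range N, th ((fun t => σ 2 (σ 0 t))^[i] τ) = Real.pi
  perM : ∀ τ, ∃ N : ℕ, 0 < N ∧ (fun t => σ 0 (σ 1 t))^[N] τ = τ ∧
    ∑ i ∈ Finset.range N, 2 * ph ((fun t => σ 0 (σ 1 t))^[i] τ) = Real.pi

namespace Geo
variable {T X : Type*} {C S : ℝ} {σ : Fin 3 → T → T} {th ph : T → ℝ} {y0 y1 y2 : T → X → ℝ}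

noncomputable def L0 (C S : ℝ) (th : T → ℝ) (y0 y1 y2 : T → X → ℝ) (τ : T) (x : X) : ℝ :=
  Real.sin (th τ) * (S * y0 τ x - C * y1 τ x) - Real.cos (th τ) * y2 τ x
noncomputable def L1 (C S : ℝ) (th : T → ℝ) (y0 y1 y2 : T → X → ℝ) (τ : T) (x : X) : ℝ :=
  Real.sin (th τ) * (S * y0 τ x + C * y1 τ x) - Real.cos (th τ) * y2 τ x
noncomputable def B0 (C S : ℝ) (y0 y1 : T → X → ℝ) (τ : T) : Set X :=
  {x | C * y0 τ x + S * y1 τ x < Real.sqrt (2 * C^2 - 1)}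
noncomputable def B1 (C S : ℝ) (y0 y1 : T → X → ℝ) (τ : T) : Set X :=
  {x | C * y0 τ x - S * y1 τ x < Real.sqrt (2 * C^2 - 1)}
noncomputable def B2 (S : ℝ) (th : T → ℝ) (y0 y2 : T → X → ℝ) (τ : T) : Set X :=
  {x | Real.cos (th τ) * y0 τ x - S * Real.sin (th τ) * y2 τ x < Real.cos (th τ)}

theorem sin_pos (h : Geo C S σ th ph y0 y1 y2) (τ : T) : 0 < Real.sin (th τ) :=
  Real.sin_pos_of_pos_of_lt_pi (h.th_pos τ) (by linarith [h.th_lt τ, Real.pi_pos])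
theorem cos_pos (h : Geo C S σ th ph y0 y1 y2) (τ : T) : 0 < Real.cos (th τ) :=
  Real.cos_pos_of_mem_Ioo ⟨by linarith [h.th_pos τ, Real.pi_pos], h.th_lt τ⟩

theorem cosph (h : Geo C S σ th ph y0 y1 y2) (τ : T) : 1 ≤ 2 * (C * Real.sin (th τ))^2 := by
  rw [h.hth]
  have : 0 ≤ Real.cos (2 * ph τ) := Real.cos_nonneg_of_neg_pi_div_two_le_of_le
    (by linarith [h.ph_pos τ, Real.pi_pos]) (by linarith [h.ph_le τ])
  rw [Real.cos_two_mul] at this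
  linarith

theorem cos2ph (h : Geo C S σ th ph y0 y1 y2) (τ : T) :
    Real.cos (2 * ph τ) = 2 * (C * Real.sin (th τ))^2 - 1 := by
  rw [h.hth, Real.cos_two_mul]

theorem B0_pos (h : Geo C S σ th ph y0 y1 y2) (τ : T) (x : X) (hx : x ∈ B0 C S y0 y1 τ) :
    0 < L0 C S th y0 y1 y2 τ x := by
  have hx' : C * y0 τ x + S * y1 τ x < Real.sqrt (2 * C^2 - 1) := hx
  have h1 := h.hC
  have h2 := h.hS
  have h3 := h.hCS
  have h4 := h.hyp τ x
  have h5 := h.y0_pos τ x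
  have h6 := Real.sin_sq_add_cos_sq (th τ)
  have h7 := h.sin_pos τ
  have h8 := h.cosph τ
  have hlt : S * y1 τ x < C * y0 τ x := by
    have hsq : (S * y1 τ x)^2 < (C * y0 τ x)^2 := by
      have : (C * y0 τ x)^2 - (S * y1 τ x)^2 = y0 τ x ^2 + S^2 * (1 + y2 τ x ^2) := by
        linear_combination (-(y0 τ x ^2)) * h3 + S^2 * h4
      have : 0 < y0 τ x ^2 + S^2 * (1 + y2 τ x ^2) := by positivity
      linarith
    have hh := abs_lt_of_sq_lt_sq' hsq (by positivity)
    exact hh.2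
  have := hp_lemma (C * y0 τ x - S * y1 τ x) (S * y0 τ x - C * y1 τ x) (y2 τ x)
    (2 * C^2 - 1) (2 * C * S) 0 (Real.sin (th τ)) (- Real.cos (th τ)) (Real.sqrt (2 * C^2 - 1))
    (by linarith) (by nlinarith)
    (by linear_combination h4 + (y1 τ x ^2 - y0 τ x^2) * h3)
    (by linear_combination (-4 * C^2) * h3) (by linear_combination h6) (by
      have : 0 < 2 * C * S * Real.sin (th τ) := by positivity
      linarith)
    (by
      rw [Real.sq_sqrt (by nlinarith)]
      nlinarith [mul_nonneg (sq_nonneg S) (sub_nonneg.2 h8)])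
    (by
      have e : (C * y0 τ x - S * y1 τ x) * (2 * C^2 - 1) - (S * y0 τ x - C * y1 τ x) * (2 * C * S)
        - y2 τ x * 0 = C * y0 τ x + S * y1 τ x := by
        linear_combination (-2 * C * y0 τ x + 2 * S * y1 τ x - 2 * S * y1 τ x) * h3
      rw [e]; exact hx')
  unfold L0
  linarith

theorem B1_pos (h : Geo C S σ th ph y0 y1 y2) (τ : T) (x : X) (hx : x ∈ B1 C S y0 y1 τ) :
    0 < L1 C S th y0 y1 y2 τ x := by
  have hx' : C * y0 τ x - S * y1 τ x < Real.sqrt (2 * C^2 - 1) := hx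
  have h1 := h.hC
  have h2 := h.hS
  have h3 := h.hCS
  have h4 := h.hyp τ x
  have h5 := h.y0_pos τ x
  have h6 := Real.sin_sq_add_cos_sq (th τ)
  have h7 := h.sin_pos τ
  have h8 := h.cosph τ
  have hlt : - (S * y1 τ x) < C * y0 τ x := by
    have hsq : (S * y1 τ x)^2 < (C * y0 τ x)^2 := by
      have : (C * y0 τ x)^2 - (S * y1 τ x)^2 = y0 τ x ^2 + S^2 * (1 + y2 τ x ^2) := by
        linear_combination (-(y0 τ x ^2)) * h3 + S^2 * h4
      have : 0 < y0 τ x ^2 + S^2 * (1 + y2 τ x ^2) := by positivity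
      linarith
    have hh := abs_lt_of_sq_lt_sq' hsq (by positivity)
    linarith [hh.1]
  have := hp_lemma (C * y0 τ x + S * y1 τ x) (S * y0 τ x + C * y1 τ x) (y2 τ x)
    (2 * C^2 - 1) (2 * C * S) 0 (Real.sin (th τ)) (- Real.cos (th τ)) (Real.sqrt (2 * C^2 - 1))
    (by linarith) (by nlinarith)
    (by linear_combination h4 + (y1 τ x ^2 - y0 τ x^2) * h3)
    (by linear_combination (-4 * C^2) * h3) (by linear_combination h6) (by
      have : 0 < 2 * C * S * Real.sin (th τ) := by positivity
      linarith)
    (by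
      rw [Real.sq_sqrt (by nlinarith)]
      nlinarith [mul_nonneg (sq_nonneg S) (sub_nonneg.2 h8)])
    (by
      have e : (C * y0 τ x + S * y1 τ x) * (2 * C^2 - 1) - (S * y0 τ x + C * y1 τ x) * (2 * C * S)
        - y2 τ x * 0 = C * y0 τ x - S * y1 τ x := by
        linear_combination (-2 * C * y0 τ x) * h3
      rw [e]; exact hx')
  unfold L1
  linarith

theorem B2_pos (h : Geo C S σ th ph y0 y1 y2) (τ : T) (x : X) (hx : x ∈ B2 S th y0 y2 τ) :
    0 < y2 τ x := by
  have hx' : Real.cos (th τ) * y0 τ x - S * Real.sin (th τ) * y2 τ x < Real.cos (th τ) := hx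
  have h1 := h.y0_pos τ x
  have h2 := h.hyp τ x
  have h3 : 1 ≤ y0 τ x := by nlinarith [sq_nonneg (y1 τ x), sq_nonneg (y2 τ x)]
  have h4 := h.cos_pos τ
  have h5 := mul_pos h.hS (h.sin_pos τ)
  by_contra hc
  push Not at hc
  nlinarith [mul_nonneg h5.le (neg_nonneg.2 hc)]

theorem c0 (h : Geo C S σ th ph y0 y1 y2) : CenterData (σ 2) (σ 1) th y2 (L1 C S th y0 y1 y2)
    (B2 S th y0 y2) (B1 C S y0 y1) where
  ha := h.inv 2
  hb := h.inv 1
  al_pos := h.th_pos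
  al_le τ := (h.th_lt τ).le
  al_b := h.th1
  la_a := h.r22
  lb_a τ x := by
    simp only [L1, h.r20, h.r21, h.r22]; ring
  lb_b τ x := by
    simp only [L1, h.r10, h.r11, h.r12, h.th1]
    have h3 := h.hCS
    have h6 := Real.sin_sq_add_cos_sq (th τ)
    linear_combination (-2 * (Real.sin (th τ) * (S * y0 τ x + C * y1 τ x) - Real.cos (th τ) * y2 τ x)) * (h6 - Real.sin (th τ)^2 * h3)
  la_b τ x := by
    simp only [L1, h.r12]; ring
  UA_b τ := by
    ext x
    simp only [B2, Set.mem_ofPred_eq, h.r10, h.r12, h.th1]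
    ring_nf
  UB_a τ := by
    ext x
    simp only [B1, Set.mem_ofPred_eq, h.r20, h.r21]
  UA_pos := h.B2_pos
  UB_pos := h.B1_pos
  per := h.perO

theorem c1 (h : Geo C S σ th ph y0 y1 y2) : CenterData (σ 2) (σ 0) th y2 (L0 C S th y0 y1 y2)
    (B2 S th y0 y2) (B0 C S y0 y1) where
  ha := h.inv 2
  hb := h.inv 0
  al_pos := h.th_pos
  al_le τ := (h.th_lt τ).le
  al_b := h.th0
  la_a := h.r22
  lb_a τ x := by
    simp only [L0, h.r20, h.r21, h.r22]; ring
  lb_b τ x := by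
    simp only [L0, h.r00, h.r01, h.r02, h.th0]
    have h3 := h.hCS
    have h6 := Real.sin_sq_add_cos_sq (th τ)
    linear_combination (-2 * (Real.sin (th τ) * (S * y0 τ x - C * y1 τ x) - Real.cos (th τ) * y2 τ x)) * (h6 - Real.sin (th τ)^2 * h3)
  la_b τ x := by
    simp only [L0, h.r02]; ring
  UA_b τ := by
    ext x
    simp only [B2, Set.mem_ofPred_eq, h.r00, h.r02, h.th0]
    ring_nf
  UB_a τ := by
    ext x
    simp only [B0, Set.mem_ofPred_eq, h.r20, h.r21]
  UA_pos := h.B2_pos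
  UB_pos := h.B0_pos
  per := h.perV

theorem c2 (h : Geo C S σ th ph y0 y1 y2) : CenterData (σ 0) (σ 1) (fun τ => 2 * ph τ)
    (L0 C S th y0 y1 y2) (L1 C S th y0 y1 y2) (B0 C S y0 y1) (B1 C S y0 y1) where
  ha := h.inv 0
  hb := h.inv 1
  al_pos τ := by linarith [h.ph_pos τ]
  al_le τ := by linarith [h.ph_le τ]
  al_b τ := by rw [h.ph1]
  la_a := h.c1.lb_b
  lb_a τ x := by
    rw [h.c1.lb_b, h.ph0, h.cos2ph]
    have h3 := h.hCS
    have h6 := Real.sin_sq_add_cos_sq (th τ)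
    have : L1 C S th y0 y1 y2 (σ 0 τ) x = L1 C S th y0 y1 y2 τ x +
        2 * (2 * (C * Real.sin (th τ))^2 - 1) * L0 C S th y0 y1 y2 τ x := by
      simp only [L0, L1, h.r00, h.r01, h.r02, h.th0]
      linear_combination (-2 * (Real.sin (th τ) * (S * y0 τ x - C * y1 τ x) - Real.cos (th τ) * y2 τ x)) * (h6 - Real.sin (th τ)^2 * h3)
    rw [this]
    ring
  lb_b := h.c0.lb_b
  la_b τ x := by
    rw [h.cos2ph]
    have h3 := h.hCS
    have h6 := Real.sin_sq_add_cos_sq (th τ)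
    simp only [L0, L1, h.r10, h.r11, h.r12, h.th1]
    linear_combination (-2 * (Real.sin (th τ) * (S * y0 τ x + C * y1 τ x) - Real.cos (th τ) * y2 τ x)) * (h6 - Real.sin (th τ)^2 * h3)
  UA_b τ := by
    ext x
    simp only [B0, Set.mem_ofPred_eq, h.r10, h.r11]
    ring_nf
  UB_a τ := by
    ext x
    simp only [B1, Set.mem_ofPred_eq, h.r00, h.r01]
    ring_nf
  UA_pos := h.B0_pos
  UB_pos := h.B1_pos
  per := h.perM

theorem main [MetricSpace X] [SimplyConnectedSpace X]
    [LocallyPathConnectedSpace X] (h : Geo C S σ th ph y0 y1 y2)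
    (hO0 : ∀ τ, IsOpen (B0 C S y0 y1 τ)) (hO1 : ∀ τ, IsOpen (B1 C S y0 y1 τ))
    (hO2 : ∀ τ, IsOpen (B2 S th y0 y2 τ))
    (hc0 : ∀ τ, IsPreconnected (B0 C S y0 y1 τ)) (hc1 : ∀ τ, IsPreconnected (B1 C S y0 y1 τ))
    (hc2 : ∀ τ, IsPreconnected (B2 S th y0 y2 τ))
    (hOV : ∀ τ, (B0 C S y0 y1 τ ∩ B1 C S y0 y1 τ).Nonempty)
    (ε : ℝ) (hε : 0 < ε)
    (hcov : ∀ τ x, 0 ≤ L0 C S th y0 y1 y2 τ x → 0 ≤ L1 C S th y0 y1 y2 τ x → 0 ≤ y2 τ x →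
      Metric.ball x ε ⊆ B0 C S y0 y1 τ ∨ Metric.ball x ε ⊆ B1 C S y0 y1 τ ∨
      Metric.ball x ε ⊆ B2 S th y0 y2 τ) (τ₀ : T) :
    (∀ τ τ', Relation.ReflTransGen (fun t t' => ∃ s, t' = σ s t) τ τ' →
      (B0 C S y0 y1 τ ∩ B0 C S y0 y1 τ').Nonempty → SameV σ 0 τ τ') ∧
    ∀ x, ∃ τ, x ∈ B0 C S y0 y1 τ ∨ x ∈ B1 C S y0 y1 τ ∨ x ∈ B2 S th y0 y2 τ := by
  obtain ⟨h1, h2⟩ := tess_main (σ := σ) (al := ![th, th, fun τ => 2 * ph τ])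
    (l := ![L0 C S th y0 y1 y2, L1 C S th y0 y1 y2, y2])
    (U := ![B0 C S y0 y1, B1 C S y0 y1, B2 S th y0 y2])
    ⟨h.c0, by decide, by decide⟩ ⟨h.c1, by decide, by decide⟩ ⟨h.c2, by decide, by decide⟩
    (by intro s; fin_cases s; exacts [hO0, hO1, hO2])
    (by intro s; fin_cases s; exacts [hc0, hc1, hc2])
    hOV ε hε
    (by
      intro τ x hs
      rcases hcov τ x (hs 0) (hs 1) (hs 2) with h | h | h
      exacts [⟨0, h⟩, ⟨1, h⟩, ⟨2, h⟩]) τ₀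
  refine ⟨h1, fun x => ?_⟩
  obtain ⟨s, τ, hs⟩ := h2 x
  refine ⟨τ, ?_⟩
  fin_cases s
  exacts [Or.inl hs, Or.inr (Or.inl hs), Or.inr (Or.inr hs)]

end Geo


open UpperHalfPlane Matrix

noncomputable def hX0 (z : ℍ) : ℝ := (z.re ^ 2 + z.im ^ 2 + 1) / (2 * z.im)
noncomputable def hX1 (z : ℍ) : ℝ := (z.re ^ 2 + z.im ^ 2 - 1) / (2 * z.im)
noncomputable def hX2 (z : ℍ) : ℝ := z.re / z.im

theorem hX_hyp (z : ℍ) : hX0 z ^ 2 = 1 + hX1 z ^ 2 + hX2 z ^ 2 := by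
  have := z.im_pos
  unfold hX0 hX1 hX2
  field_simp
  ring

theorem hX0_pos (z : ℍ) : 0 < hX0 z := by
  have := z.im_pos
  unfold hX0
  positivity

theorem hX0_cont : Continuous hX0 := by
  unfold hX0
  exact Continuous.div (by fun_prop) (by fun_prop) (fun z => by have := z.im_pos; positivity)
theorem hX1_cont : Continuous hX1 := by
  unfold hX1
  exact Continuous.div (by fun_prop) (by fun_prop) (fun z => by have := z.im_pos; positivity)
theorem hX2_cont : Continuous hX2 := by
  unfold hX2
  exact Continuous.div (by fun_prop) (by fun_prop) (fun z => by have := z.im_pos; positivity)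

theorem hX_dist (z w : ℍ) :
    Real.cosh (dist z w) = hX0 z * hX0 w - hX1 z * hX1 w - hX2 z * hX2 w := by
  have h1 := z.im_pos
  have h2 := w.im_pos
  have h3 : dist (z : ℂ) (w : ℂ) ^ 2 = (z.re - w.re) ^ 2 + (z.im - w.im) ^ 2 := by
    rw [Complex.dist_eq, ← Complex.normSq_eq_norm_sq, Complex.normSq_apply]
    simp
    ring
  rw [cosh_dist, h3]
  unfold hX0 hX1 hX2
  field_simp
  ring

theorem hX_surj (A0 A1 A2 : ℝ) (h0 : 0 < A0) (h : A0 ^ 2 = 1 + A1 ^ 2 + A2 ^ 2) :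
    ∃ w : ℍ, hX0 w = A0 ∧ hX1 w = A1 ∧ hX2 w = A2 := by
  have hp : 0 < A0 - A1 := by nlinarith [sq_nonneg A2, sq_nonneg (A0 + A1)]
  refine ⟨⟨⟨A2 / (A0 - A1), 1 / (A0 - A1)⟩, by simpa using hp⟩, ?_, ?_, ?_⟩
  · unfold hX0
    simp only [UpperHalfPlane.re, UpperHalfPlane.im]
    field_simp
    linear_combination -h
  · unfold hX1
    simp only [UpperHalfPlane.re, UpperHalfPlane.im]
    field_simp
    linear_combination -h
  · unfold hX2
    simp only [UpperHalfPlane.re, UpperHalfPlane.im]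
    field_simp

theorem hX_inj {z w : ℍ} (h0 : hX0 z = hX0 w) (h1 : hX1 z = hX1 w) (h2 : hX2 z = hX2 w) :
    z = w := by
  have h := hX_dist z w
  rw [h0, h1, h2] at h
  have h3 := hX_hyp w
  have h4 : Real.cosh (dist z w) = 1 := by rw [h]; linear_combination h3
  by_contra hne
  have h5 := Real.one_lt_cosh.2 (dist_pos.2 hne).ne'
  linarith

theorem ball_preconn (w : ℍ) (r : ℝ) : IsPreconnected (Metric.ball w r) := by
  rw [← UpperHalfPlane.isEmbedding_coe.isInducing.isPreconnected_image, image_coe_ball]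
  exact (convex_ball _ _).isPreconnected

theorem coshset (w : ℍ) (R : ℝ) : ∃ r, {z : ℍ | Real.cosh (dist z w) < R} = Metric.ball w r := by
  rcases le_or_gt 1 R with h | h
  · refine ⟨Real.arcosh R, ?_⟩
    ext z
    rw [Set.mem_ofPred_eq, Metric.mem_ball]
    conv_lhs => rw [← Real.cosh_arcosh h]
    rw [Real.cosh_lt_cosh, abs_of_nonneg dist_nonneg, abs_of_nonneg (Real.arcosh_nonneg h)]
  · refine ⟨0, ?_⟩
    ext z
    simp only [Set.mem_ofPred_eq, Metric.ball_zero, Set.mem_empty_iff_false, iff_false, not_lt]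
    exact h.le.trans (Real.one_le_cosh _)

theorem hset (A0 A1 A2 R : ℝ) (h0 : 0 < A0) (h : A0 ^ 2 = 1 + A1 ^ 2 + A2 ^ 2) (F : ℍ ≃ᵢ ℍ) :
    IsOpen {x | hX0 (F x) * A0 - hX1 (F x) * A1 - hX2 (F x) * A2 < R} ∧
    IsPreconnected {x | hX0 (F x) * A0 - hX1 (F x) * A1 - hX2 (F x) * A2 < R} := by
  obtain ⟨w, w0, w1, w2⟩ := hX_surj A0 A1 A2 h0 h
  obtain ⟨r, hr⟩ := coshset (F.symm w) R
  have : {x | hX0 (F x) * A0 - hX1 (F x) * A1 - hX2 (F x) * A2 < R}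
      = {z : ℍ | Real.cosh (dist z (F.symm w)) < R} := by
    ext x
    rw [Set.mem_ofPred_eq, Set.mem_ofPred_eq, ← w0, ← w1, ← w2, ← hX_dist, ← F.dist_eq x,
      F.apply_symm_apply]
  rw [this, hr]
  exact ⟨Metric.isOpen_ball, ball_preconn _ _⟩

theorem tri_bdd (C S s c y0 y1 y2 : ℝ) (hC : 1 < C) (hS : 0 < S) (hCS : S^2 = C^2 - 1)
    (hs : 0 < s) (hc : 0 < c) (hsc : S ^ 2 * s ^ 2 < c ^ 2) (hy0 : 0 < y0)
    (hy : y0^2 = 1 + y1^2 + y2^2)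
    (h0 : 0 ≤ s * (S * y0 - C * y1) - c * y2) (h1 : 0 ≤ s * (S * y0 + C * y1) - c * y2)
    (h2 : 0 ≤ y2) :
    y0 ^ 2 * (1 - max (S ^ 2 / C ^ 2) (S ^ 2 * s ^ 2 / c ^ 2)) ≤ 1 := by
  set μ := max (S ^ 2 / C ^ 2) (S ^ 2 * s ^ 2 / c ^ 2) with hμ
  have m1 : S ^ 2 / C ^ 2 ≤ μ := le_max_left _ _
  have m2 : S ^ 2 * s ^ 2 / c ^ 2 ≤ μ := le_max_right _ _
  rw [div_le_iff₀ (by positivity)] at m1 m2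
  have hμ0 : 0 ≤ μ := le_trans (by positivity) (le_max_left _ _)
  -- a = C|y1|/S , b = c y2/(S s)
  set a := C * |y1| / S with ha
  set b := c * y2 / (S * s) with hb
  have hab : a + b ≤ y0 := by
    rw [ha, hb, div_add_div _ _ hS.ne' (by positivity), div_le_iff₀ (by positivity)]
    have : 0 ≤ s * (S * y0 - C * |y1|) - c * y2 := by
      rcases abs_cases y1 with ⟨e, _⟩ | ⟨e, _⟩ <;> rw [e] <;> linarith
    nlinarith
  have ha0 : 0 ≤ a := by positivity
  have hb0 : 0 ≤ b := by positivity
  have e1 : y1 ^ 2 ≤ μ * a ^ 2 := by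
    have : y1 ^ 2 = a ^ 2 * S ^ 2 / C ^ 2 := by rw [ha]; field_simp; rw [sq_abs]
    rw [this, div_le_iff₀ (by positivity)]
    nlinarith [mul_le_mul_of_nonneg_left m1 (sq_nonneg a)]
  have e2 : y2 ^ 2 ≤ μ * b ^ 2 := by
    have : y2 ^ 2 = b ^ 2 * (S ^ 2 * s ^ 2) / c ^ 2 := by rw [hb]; field_simp
    rw [this, div_le_iff₀ (by positivity)]
    nlinarith [mul_le_mul_of_nonneg_left m2 (sq_nonneg b)]
  have e3 : a ^ 2 + b ^ 2 ≤ y0 ^ 2 := by nlinarith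
  nlinarith [mul_le_mul_of_nonneg_left e3 hμ0]

theorem tri_compact (C S s c e : ℝ) (hC : 1 < C) (hS : 0 < S) (hCS : S^2 = C^2 - 1)
    (hs : 0 < s) (hc : 0 < c) (hsc : S ^ 2 * s ^ 2 < c ^ 2) (he : e ^ 2 = 1) :
    IsCompact {z : ℍ | 0 ≤ s * (S * hX0 z - C * hX1 z) - c * (e * hX2 z) ∧
      0 ≤ s * (S * hX0 z + C * hX1 z) - c * (e * hX2 z) ∧ 0 ≤ e * hX2 z} := by
  have k0 := hX0_cont
  have k1 := hX1_cont
  have k2 := hX2_cont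
  obtain ⟨w, w0, w1, w2⟩ := hX_surj 1 0 0 one_pos (by norm_num)
  set μ := max (S ^ 2 / C ^ 2) (S ^ 2 * s ^ 2 / c ^ 2) with hμ
  have hμ1 : μ < 1 := by
    apply max_lt
    · rw [div_lt_one (by positivity)]; linarith
    · rw [div_lt_one (by positivity)]; linarith
  refine Metric.isCompact_of_isClosed_isBounded ?_ ?_
  · refine IsClosed.and (isClosed_le ?_ ?_) (IsClosed.and (isClosed_le ?_ ?_) (isClosed_le ?_ ?_)) <;>
      fun_prop
  · refine (Metric.isBounded_ball (x := w) (r := Real.arcosh (1 + 1 / (1 - μ)))).subset ?_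
    rintro z ⟨z0, z1, z2⟩
    have hb := tri_bdd C S s c (hX0 z) (hX1 z) (e * hX2 z) hC hS hCS hs hc hsc (hX0_pos z)
      (by rw [mul_pow, he, one_mul]; exact hX_hyp z) z0 z1 z2
    rw [← hμ, ← le_div_iff₀ (by linarith)] at hb
    have h1 : 0 < 1 / (1 - μ) := by
      have : 0 < 1 - μ := by linarith
      positivity
    rw [Metric.mem_ball, ← abs_of_nonneg (dist_nonneg (x := z) (y := w)),
      ← abs_of_nonneg (Real.arcosh_nonneg (x := 1 + 1 / (1 - μ)) (by linarith)),
      ← Real.cosh_lt_cosh, Real.cosh_arcosh (by linarith), hX_dist, w0, w1, w2]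
    nlinarith

theorem tri_leb (C S s c e : ℝ) (hC : 1 < C) (hS : 0 < S) (hCS : S^2 = C^2 - 1)
    (hs : 0 < s) (hc : 0 < c) (hsc : S ^ 2 * s ^ 2 < c ^ 2) (he : e ^ 2 = 1) :
    ∃ ε > 0, ∀ z : ℍ, 0 ≤ s * (S * hX0 z - C * hX1 z) - c * (e * hX2 z) →
      0 ≤ s * (S * hX0 z + C * hX1 z) - c * (e * hX2 z) → 0 ≤ e * hX2 z →
      (Metric.ball z ε ⊆ {z | C * hX0 z + S * hX1 z < Real.sqrt (2 * C^2 - 1)} ∨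
       Metric.ball z ε ⊆ {z | C * hX0 z - S * hX1 z < Real.sqrt (2 * C^2 - 1)} ∨
       Metric.ball z ε ⊆ {z | c * hX0 z - S * s * (e * hX2 z) < c}) := by
  have k0 := hX0_cont
  have k1 := hX1_cont
  have k2 := hX2_cont
  obtain ⟨ε, hε, h⟩ := lebesgue_number_lemma_of_metric
    (c := ![{z | C * hX0 z + S * hX1 z < Real.sqrt (2 * C^2 - 1)},
      {z | C * hX0 z - S * hX1 z < Real.sqrt (2 * C^2 - 1)},
      {z | c * hX0 z - S * s * (e * hX2 z) < c}])
    (tri_compact C S s c e hC hS hCS hs hc hsc he)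
    (by
      intro i
      fin_cases i
      · exact isOpen_lt (by fun_prop) (by fun_prop)
      · exact isOpen_lt (by fun_prop) (by fun_prop)
      · exact isOpen_lt (by fun_prop) (by fun_prop))
    (by
      rintro z ⟨z0, z1, z2⟩
      rw [Set.mem_iUnion]
      rcases cover_lemma C S s c (hX0 z) (hX1 z) (e * hX2 z) hC hS hCS hs hc (hX0_pos z)
        (by rw [mul_pow, he, one_mul]; exact hX_hyp z) z0 z1 z2 with h | h | h
      · exact ⟨0, h⟩
      · exact ⟨1, h⟩
      · exact ⟨2, h⟩)
  refine ⟨ε, hε, fun z z0 z1 z2 => ?_⟩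
  obtain ⟨i, hi⟩ := h z ⟨z0, z1, z2⟩
  fin_cases i
  exacts [Or.inl hi, Or.inr (Or.inl hi), Or.inr (Or.inr hi)]

theorem Geo.mainH {T L : Type*} [Finite L] {C S : ℝ} {σ : Fin 3 → T → T} {th ph : T → ℝ}
    {F : T → ℍ ≃ᵢ ℍ} {e : T → ℝ} (he : ∀ τ, e τ ^ 2 = 1)
    (h : Geo C S σ th ph (fun τ x => hX0 (F τ x)) (fun τ x => hX1 (F τ x))
      (fun τ x => e τ * hX2 (F τ x)))
    (lab : T → L) (hlab : ∀ τ τ', lab τ = lab τ' → th τ = th τ' ∧ e τ = e τ') (τ₀ : T) :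
    (∀ τ τ', Relation.ReflTransGen (fun t t' => ∃ s, t' = σ s t) τ τ' →
      ({x | C * hX0 (F τ x) + S * hX1 (F τ x) < Real.sqrt (2 * C^2 - 1)} ∩
       {x | C * hX0 (F τ' x) + S * hX1 (F τ' x) < Real.sqrt (2 * C^2 - 1)}).Nonempty →
        SameV σ 0 τ τ') ∧
    ∀ x, ∃ τ, C * hX0 (F τ x) + S * hX1 (F τ x) < Real.sqrt (2 * C^2 - 1) ∨
      C * hX0 (F τ x) - S * hX1 (F τ x) < Real.sqrt (2 * C^2 - 1) ∨
      Real.cos (th τ) * hX0 (F τ x) - S * Real.sin (th τ) * (e τ * hX2 (F τ x))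
        < Real.cos (th τ) := by
  have hC := h.hC
  have hS := h.hS
  have hCS := h.hCS
  have hsin := h.sin_pos
  have hcos := h.cos_pos
  have hsc : ∀ τ, S ^ 2 * Real.sin (th τ) ^ 2 < Real.cos (th τ) ^ 2 := by
    intro τ
    have h1 := Real.sin_sq_add_cos_sq (th τ)
    have h2 := Real.sin_sq_add_cos_sq (ph τ)
    have h3 : 0 < Real.sin (ph τ) := Real.sin_pos_of_pos_of_lt_pi (h.ph_pos τ)
      (by linarith [h.ph_le τ, Real.pi_pos])
    have h4 := h.hth τ
    have h5 : C ^ 2 * Real.sin (th τ) ^ 2 = Real.cos (ph τ) ^ 2 := by rw [← h4]; ring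
    nlinarith
  have hb0 : ∀ τ, IsOpen (Geo.B0 C S (fun τ x => hX0 (F τ x)) (fun τ x => hX1 (F τ x)) τ) ∧
      IsPreconnected (Geo.B0 C S (fun τ x => hX0 (F τ x)) (fun τ x => hX1 (F τ x)) τ) := by
    intro τ
    convert hset C (-S) 0 (Real.sqrt (2 * C^2 - 1)) (by linarith) (by linarith) (F τ) using 2 <;>
    · unfold Geo.B0
      ext x; simp only [Set.mem_ofPred_eq]; ring_nf
  have hb1 : ∀ τ, IsOpen (Geo.B1 C S (fun τ x => hX0 (F τ x)) (fun τ x => hX1 (F τ x)) τ) ∧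
      IsPreconnected (Geo.B1 C S (fun τ x => hX0 (F τ x)) (fun τ x => hX1 (F τ x)) τ) := by
    intro τ
    convert hset C S 0 (Real.sqrt (2 * C^2 - 1)) (by linarith) (by linarith) (F τ) using 2 <;>
    · unfold Geo.B1
      ext x; simp only [Set.mem_ofPred_eq]; ring_nf
  have hb2 : ∀ τ, IsOpen (Geo.B2 S th (fun τ x => hX0 (F τ x)) (fun τ x => e τ * hX2 (F τ x)) τ) ∧
      IsPreconnected
        (Geo.B2 S th (fun τ x => hX0 (F τ x)) (fun τ x => e τ * hX2 (F τ x)) τ) := by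
    intro τ
    set q := Real.sqrt (Real.cos (th τ) ^ 2 - S ^ 2 * Real.sin (th τ) ^ 2) with hq
    have hqp : 0 < q := Real.sqrt_pos.2 (by linarith [hsc τ])
    have hq2 : q ^ 2 = Real.cos (th τ) ^ 2 - S ^ 2 * Real.sin (th τ) ^ 2 :=
      Real.sq_sqrt (by linarith [hsc τ])
    have hset2 : Geo.B2 S th (fun τ x => hX0 (F τ x)) (fun τ x => e τ * hX2 (F τ x)) τ =
      {x | hX0 (F τ x) * (Real.cos (th τ) / q) - hX1 (F τ x) * 0
        - hX2 (F τ x) * (e τ * S * Real.sin (th τ) / q) < Real.cos (th τ) / q} := by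
      unfold Geo.B2
      ext x
      simp only [Set.mem_ofPred_eq]
      rw [lt_div_iff₀ hqp]
      have : (hX0 (F τ x) * (Real.cos (th τ) / q) - hX1 (F τ x) * 0
        - hX2 (F τ x) * (e τ * S * Real.sin (th τ) / q)) * q =
        Real.cos (th τ) * hX0 (F τ x) - S * Real.sin (th τ) * (e τ * hX2 (F τ x)) := by
        field_simp
        ring
      rw [this]
    rw [hset2]
    apply hset
    · have := hcos τ
      positivity
    · field_simp
      rw [he τ, hq2]; ring
  obtain ⟨w, w0, w1, w2⟩ := hX_surj 1 0 0 one_pos (by norm_num)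
  have hr : C < Real.sqrt (2 * C^2 - 1) := Real.lt_sqrt_of_sq_lt (by nlinarith)
  have hleb : ∃ ε > 0, ∀ τ z, 0 ≤ Real.sin (th τ) * (S * hX0 z - C * hX1 z) - Real.cos (th τ) * (e τ * hX2 z) →
      0 ≤ Real.sin (th τ) * (S * hX0 z + C * hX1 z) - Real.cos (th τ) * (e τ * hX2 z) → 0 ≤ e τ * hX2 z →
      (Metric.ball z ε ⊆ {z | C * hX0 z + S * hX1 z < Real.sqrt (2 * C^2 - 1)} ∨
       Metric.ball z ε ⊆ {z | C * hX0 z - S * hX1 z < Real.sqrt (2 * C^2 - 1)} ∨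
       Metric.ball z ε ⊆ {z | Real.cos (th τ) * hX0 z - S * Real.sin (th τ) * (e τ * hX2 z) < Real.cos (th τ)}) := by
    have hx : ∀ l : Set.range lab, ∃ ε > 0, ∀ τ, lab τ = l → ∀ z, 0 ≤ Real.sin (th τ) * (S * hX0 z - C * hX1 z) - Real.cos (th τ) * (e τ * hX2 z) →
      0 ≤ Real.sin (th τ) * (S * hX0 z + C * hX1 z) - Real.cos (th τ) * (e τ * hX2 z) → 0 ≤ e τ * hX2 z →
      (Metric.ball z ε ⊆ {z | C * hX0 z + S * hX1 z < Real.sqrt (2 * C^2 - 1)} ∨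
       Metric.ball z ε ⊆ {z | C * hX0 z - S * hX1 z < Real.sqrt (2 * C^2 - 1)} ∨
       Metric.ball z ε ⊆ {z | Real.cos (th τ) * hX0 z - S * Real.sin (th τ) * (e τ * hX2 z) < Real.cos (th τ)}) := by
      rintro ⟨l, τ, rfl⟩
      obtain ⟨ε, hε, hh⟩ := tri_leb C S _ _ (e τ) hC hS hCS (hsin τ) (hcos τ) (hsc τ) (he τ)
      refine ⟨ε, hε, fun τ' hl => ?_⟩
      obtain ⟨e1, e2⟩ := hlab τ' τ hl
      rw [e1, e2]
      exact hh
    choose ε hε hh using hx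
    haveI : Nonempty (Set.range lab) := ⟨⟨_, τ₀, rfl⟩⟩
    obtain ⟨l0, hl0⟩ := Finite.exists_min ε
    refine ⟨ε l0, hε l0, fun τ z z0 z1 z2 => ?_⟩
    have hs := Metric.ball_subset_ball (x := z) (hl0 ⟨lab τ, τ, rfl⟩)
    rcases hh ⟨lab τ, τ, rfl⟩ τ rfl z z0 z1 z2 with k | k | k
    exacts [Or.inl (hs.trans k), Or.inr (Or.inl (hs.trans k)), Or.inr (Or.inr (hs.trans k))]
  obtain ⟨ε, hε, hleb⟩ := hleb
  refine h.main (fun τ => (hb0 τ).1) (fun τ => (hb1 τ).1) (fun τ => (hb2 τ).1)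
    (fun τ => (hb0 τ).2) (fun τ => (hb1 τ).2) (fun τ => (hb2 τ).2) ?_ ε hε ?_ τ₀
  · intro τ
    refine ⟨(F τ).symm w, ?_, ?_⟩
    · simp only [Geo.B0, Set.mem_ofPred_eq, IsometryEquiv.apply_symm_apply, w0, w1]; linarith
    · simp only [Geo.B1, Set.mem_ofPred_eq, IsometryEquiv.apply_symm_apply, w0, w1]; linarith
  · intro τ x x0 x1 x2
    have hball : ∀ A : Set ℍ, Metric.ball (F τ x) ε ⊆ A → Metric.ball x ε ⊆ {y | F τ y ∈ A} := by
      intro A hA y hy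
      apply hA
      rw [Metric.mem_ball, (F τ).dist_eq]
      exact hy
    rcases hleb τ (F τ x) x0 x1 x2 with k | k | k
    · exact Or.inl (hball _ k)
    · exact Or.inr (Or.inl (hball _ k))
    · exact Or.inr (Or.inr (hball _ k))


open UpperHalfPlane Matrix

theorem sl_smul_P (γ : SL2R) (z : ℍ) :
    (γ • z).im = z.im / ((γ 1 0 * z.re + γ 1 1) ^ 2 + (γ 1 0 * z.im) ^ 2) ∧
    (γ • z).re = ((γ 0 0 * z.re + γ 0 1) * (γ 1 0 * z.re + γ 1 1) + γ 0 0 * γ 1 0 * z.im ^ 2)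
      / ((γ 1 0 * z.re + γ 1 1) ^ 2 + (γ 1 0 * z.im) ^ 2) := by
  have hdet := γ.det_coe
  rw [Matrix.det_fin_two] at hdet
  have h := coe_specialLinearGroup_apply γ z
  have him : (γ • z).im = ((γ • z : ℍ) : ℂ).im := rfl
  have hre : (γ • z).re = ((γ • z : ℍ) : ℂ).re := rfl
  rw [him, hre, h, Complex.div_im, Complex.div_re]
  simp [Complex.normSq_apply]
  have hz := z.im_pos
  have hD : 0 < (γ 1 0 * z.re + γ 1 1) ^ 2 + (γ 1 0 * z.im) ^ 2 := by
    rcases eq_or_ne (γ 1 0) 0 with h0 | h0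
    · rw [h0] at hdet ⊢
      have : γ 1 1 ≠ 0 := by rintro h1; rw [h1] at hdet; simp at hdet
      simp
      positivity
    · positivity
  constructor
  · rw [← sub_div]
    congr 1
    · linear_combination z.im * hdet
    · ring
  · rw [← add_div]
    congr 1
    · ring
    · ring

theorem sl_denom_pos (γ : SL2R) (z : ℍ) :
    0 < (γ 1 0 * z.re + γ 1 1) ^ 2 + (γ 1 0 * z.im) ^ 2 := by
  have h := (sl_smul_P γ z).1
  have h1 := (γ • z).im_pos
  have hz := z.im_pos
  rw [h] at h1
  by_contra hcon
  have := div_nonpos_of_nonneg_of_nonpos hz.le (not_lt.1 hcon)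
  linarith

theorem sl_hX (γ : SL2R) (z : ℍ) :
    2 * hX0 (γ • z) = (γ 0 0 ^ 2 + γ 1 0 ^ 2) * (hX0 z + hX1 z)
      + 2 * (γ 0 0 * γ 0 1 + γ 1 0 * γ 1 1) * hX2 z + (γ 0 1 ^ 2 + γ 1 1 ^ 2) * (hX0 z - hX1 z) ∧
    2 * hX1 (γ • z) = (γ 0 0 ^ 2 - γ 1 0 ^ 2) * (hX0 z + hX1 z)
      + 2 * (γ 0 0 * γ 0 1 - γ 1 0 * γ 1 1) * hX2 z + (γ 0 1 ^ 2 - γ 1 1 ^ 2) * (hX0 z - hX1 z) ∧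
    hX2 (γ • z) = γ 0 0 * γ 1 0 * (hX0 z + hX1 z)
      + (γ 0 0 * γ 1 1 + γ 0 1 * γ 1 0) * hX2 z + γ 0 1 * γ 1 1 * (hX0 z - hX1 z) := by
  have hdet := γ.det_coe
  rw [Matrix.det_fin_two] at hdet
  obtain ⟨h1, h2⟩ := sl_smul_P γ z
  have hD := sl_denom_pos γ z
  have hz := z.im_pos
  have e : hX0 z + hX1 z = (z.re ^ 2 + z.im ^ 2) / z.im := by
    unfold hX0 hX1; field_simp; ring
  have e' : hX0 z - hX1 z = 1 / z.im := by
    unfold hX0 hX1; field_simp; ring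
  have e2 : hX2 z = z.re / z.im := rfl
  set D := (γ 1 0 * z.re + γ 1 1) ^ 2 + (γ 1 0 * z.im) ^ 2 with hDd
  have p22 : hX0 (γ • z) - hX1 (γ • z) = D / z.im := by
    have : hX0 (γ • z) - hX1 (γ • z) = 1 / (γ • z).im := by
      have := (γ • z).im_pos
      unfold hX0 hX1; field_simp; ring
    rw [this, h1]; field_simp
  have p12 : hX2 (γ • z) = ((γ 0 0 * z.re + γ 0 1) * (γ 1 0 * z.re + γ 1 1) + γ 0 0 * γ 1 0 * z.im ^ 2) / z.im := by
    unfold hX2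
    rw [h1, h2]; field_simp
  have p11 : hX0 (γ • z) + hX1 (γ • z) = ((γ 0 0 * z.re + γ 0 1) ^ 2 + (γ 0 0 * z.im) ^ 2) / z.im := by
    have hh := hX_hyp (γ • z)
    have : (hX0 (γ • z) + hX1 (γ • z)) * (hX0 (γ • z) - hX1 (γ • z)) = 1 + hX2 (γ • z) ^ 2 := by
      linear_combination hh
    rw [p22, p12] at this
    rw [eq_div_iff hz.ne']
    apply mul_left_cancel₀ hD.ne'
    field_simp at this
    rw [hDd]
    linear_combination this - z.im ^ 2 * (γ 0 0 * γ 1 1 - γ 0 1 * γ 1 0 + 1) * hdet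
  rw [e, e', e2]
  refine ⟨?_, ?_, ?_⟩
  · have : 2 * hX0 (γ • z) = (hX0 (γ • z) + hX1 (γ • z)) + (hX0 (γ • z) - hX1 (γ • z)) := by ring
    rw [this, p11, p22, hDd]
    field_simp; ring
  · have : 2 * hX1 (γ • z) = (hX0 (γ • z) + hX1 (γ • z)) - (hX0 (γ • z) - hX1 (γ • z)) := by ring
    rw [this, p11, p22, hDd]
    field_simp; ring
  · rw [p12]
    field_simp; ring

/-- isometric action of SL2R -/
noncomputable def slact : SL2R →* (ℍ ≃ᵢ ℍ) where
  toFun γ := IsometryEquiv.constSMul γ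
  map_one' := by ext z; simp
  map_mul' a b := by ext z; simp [mul_smul]

theorem slact_apply (γ : SL2R) (z : ℍ) : slact γ z = γ • z := rfl

theorem sl_center {A : SL2R} {r : ℝ} (h00 : A 0 0 = r) (h01 : A 0 1 = 0) (h10 : A 1 0 = 0)
    (h11 : A 1 1 = r) : A ∈ Subgroup.center SL2R := by
  rw [Matrix.SpecialLinearGroup.mem_center_iff]
  have hdet := A.det_coe
  rw [Matrix.det_fin_two, h00, h01, h10, h11] at hdet
  refine ⟨r, ?_, ?_⟩
  · rw [Fintype.card_fin]; linear_combination hdet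
  · ext i j
    fin_cases i <;> fin_cases j <;> simp [h00, h01, h10, h11]

/-- action of PSL2R -/
noncomputable def pact : PSL2R →* (ℍ ≃ᵢ ℍ) :=
  QuotientGroup.lift (Subgroup.center SL2R) slact (by
    intro A hA
    rw [Matrix.SpecialLinearGroup.mem_center_iff] at hA
    obtain ⟨r, hr, hA⟩ := hA
    have h00 : A 0 0 = r := by rw [← hA]; simp
    have h01 : A 0 1 = 0 := by rw [← hA]; simp
    have h10 : A 1 0 = 0 := by rw [← hA]; simp
    have h11 : A 1 1 = r := by rw [← hA]; simp
    have hr2 : r ^ 2 = 1 := by simpa using hr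
    rw [MonoidHom.mem_ker]
    ext z : 1
    rw [slact_apply]
    obtain ⟨a, b, c⟩ := sl_hX A z
    rw [h00, h01, h10, h11] at a b c
    refine hX_inj ?_ ?_ ?_
    · change hX0 (A • z) = hX0 z
      linear_combination a / 2 + hX0 z * hr2
    · change hX1 (A • z) = hX1 z
      linear_combination b / 2 + hX1 z * hr2
    · change hX2 (A • z) = hX2 z
      linear_combination c + hX2 z * hr2)

theorem pact_mk (γ : SL2R) (z : ℍ) : pact (QuotientGroup.mk γ) z = γ • z := rfl

/-- rotation about the point with coordinates (C,-S,0) -/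
noncomputable def rotM (C S : ℝ) (h : S ^ 2 = C ^ 2 - 1) (t : ℝ) : SL2R :=
  ⟨!![Real.cos t, -(C - S) * Real.sin t; (C + S) * Real.sin t, Real.cos t], by
    rw [Matrix.det_fin_two]
    simp
    linear_combination Real.sin_sq_add_cos_sq t - Real.sin t ^ 2 * h⟩

noncomputable def rot (C S : ℝ) (h : S ^ 2 = C ^ 2 - 1) (t : ℝ) : PSL2R :=
  QuotientGroup.mk (rotM C S h t)

theorem rotM_00 (C S : ℝ) (h : S ^ 2 = C ^ 2 - 1) (t : ℝ) : rotM C S h t 0 0 = Real.cos t := rfl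
theorem rotM_01 (C S : ℝ) (h : S ^ 2 = C ^ 2 - 1) (t : ℝ) :
    rotM C S h t 0 1 = -(C - S) * Real.sin t := rfl
theorem rotM_10 (C S : ℝ) (h : S ^ 2 = C ^ 2 - 1) (t : ℝ) :
    rotM C S h t 1 0 = (C + S) * Real.sin t := rfl
theorem rotM_11 (C S : ℝ) (h : S ^ 2 = C ^ 2 - 1) (t : ℝ) : rotM C S h t 1 1 = Real.cos t := rfl

theorem sl_mul_apply (A B : SL2R) (i j : Fin 2) : (A * B) i j = A i 0 * B 0 j + A i 1 * B 1 j := by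
  rw [Matrix.SpecialLinearGroup.coe_mul, Matrix.mul_apply, Fin.sum_univ_two]

theorem rot_add (C S : ℝ) (h : S ^ 2 = C ^ 2 - 1) (t u : ℝ) :
    rot C S h (t + u) = rot C S h t * rot C S h u := by
  unfold rot
  rw [← QuotientGroup.mk_mul]
  congr 1
  ext i j
  rw [sl_mul_apply]
  fin_cases i <;> fin_cases j <;>
    simp only [Fin.zero_eta, Fin.mk_one, rotM_00, rotM_01, rotM_10, rotM_11, Real.cos_add, Real.sin_add]
  · linear_combination (-Real.sin t * Real.sin u) * h
  · ring
  · ring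
  · linear_combination (-Real.sin t * Real.sin u) * h

theorem rot_zero (C S : ℝ) (h : S ^ 2 = C ^ 2 - 1) : rot C S h 0 = 1 := by
  have := rot_add C S h 0 0
  rw [add_zero] at this
  exact (mul_eq_left.1 this.symm)

theorem rot_neg (C S : ℝ) (h : S ^ 2 = C ^ 2 - 1) (t : ℝ) : rot C S h (-t) = (rot C S h t)⁻¹ := by
  rw [eq_inv_iff_mul_eq_one, ← rot_add, neg_add_cancel, rot_zero]

theorem rot_pi (C S : ℝ) (h : S ^ 2 = C ^ 2 - 1) : rot C S h Real.pi = 1 := by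
  unfold rot
  rw [QuotientGroup.eq_one_iff]
  apply sl_center (r := -1) <;> simp [rotM]

theorem rot_hX (C S : ℝ) (h : S ^ 2 = C ^ 2 - 1) (t e : ℝ) (he : e = 1 ∨ e = -1) (z : ℍ) :
    hX0 (pact (rot C S h (-(e * t))) z) = hX0 z + 2 * (Real.sin t * (S * hX0 z + C * hX1 z)
      - Real.cos t * (e * hX2 z)) * (Real.sin t * S) ∧
    hX1 (pact (rot C S h (-(e * t))) z) = hX1 z - 2 * (Real.sin t * (S * hX0 z + C * hX1 z)
      - Real.cos t * (e * hX2 z)) * (Real.sin t * C) ∧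
    -e * hX2 (pact (rot C S h (-(e * t))) z) = e * hX2 z + 2 * (Real.sin t * (S * hX0 z + C * hX1 z)
      - Real.cos t * (e * hX2 z)) * Real.cos t := by
  unfold rot
  rw [pact_mk]
  obtain ⟨a, b, c⟩ := sl_hX (rotM C S h (-(e * t))) z
  have hsc := Real.sin_sq_add_cos_sq t
  have hco : Real.cos (e * t) = Real.cos t := by rcases he with rfl | rfl <;> simp
  have hsi : Real.sin (e * t) = e * Real.sin t := by rcases he with rfl | rfl <;> simp
  have he2 : e ^ 2 = 1 := by rcases he with rfl | rfl <;> simp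
  simp only [rotM_00, rotM_01, rotM_10, rotM_11, Real.cos_neg, Real.sin_neg, hco, hsi] at a b c
  set s := Real.sin t
  set k := Real.cos t
  refine ⟨?_, ?_, ?_⟩
  · linear_combination a / 2 + hX0 z * hsc - s ^ 2 * hX0 z * h + (s^2 * (C^2 + S^2) * hX0 z + 2 * s^2 * C * S * hX1 z) * he2
  · linear_combination b / 2 + hX1 z * hsc - s ^ 2 * hX1 z * h - s ^ 2 * (2 * C * S * hX0 z + (C ^ 2 + S ^ 2) * hX1 z) * he2
  · linear_combination -e * c - e ^ 3 * s ^ 2 * hX2 z * h + e * hX2 z * hsc + (e * s ^ 2 * hX2 z + 2 * k * C * s * hX1 z + 2 * k * S * s * hX0 z) * he2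

theorem rot_fix (C S : ℝ) (h : S ^ 2 = C ^ 2 - 1) (t : ℝ) (z : ℍ) (z0 : hX0 z = C)
    (z1 : hX1 z = -S) (z2 : hX2 z = 0) : pact (rot C S h t) z = z := by
  obtain ⟨a, b, c⟩ := rot_hX C S h (-t) 1 (Or.inl rfl) z
  rw [z0, z1, z2] at a b c
  rw [one_mul, neg_neg] at a b c
  apply hX_inj
  · rw [a, z0]; ring
  · rw [b, z1]; ring
  · rw [z2]; linear_combination -c

theorem sl_pow (E : SL2R) (b : ℝ) (htr : E 0 0 + E 1 1 = 2 * Real.cos b) (k : ℕ) :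
    ∀ i j : Fin 2, Real.sin b * (E ^ (k + 1)) i j =
      Real.sin ((k + 1) * b) * E i j - Real.sin (k * b) * (1 : SL2R) i j := by
  have hdet := E.det_coe
  rw [Matrix.det_fin_two] at hdet
  induction k with
  | zero => intro i j; simp
  | succ k ih =>
    intro i j
    rw [pow_succ, sl_mul_apply]
    have h1 : Real.sin (((k + 1 : ℕ) + 1 : ℝ) * b) = 2 * Real.cos b * Real.sin ((k + 1) * b) - Real.sin (k * b) := by
      have e1 : (((k + 1 : ℕ) + 1 : ℝ) * b) = (k + 1) * b + b := by push_cast; ring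
      have e2 : (k * b : ℝ) = (k + 1) * b - b := by ring
      rw [e1, e2, Real.sin_add, Real.sin_sub]; ring
    have h2 : (((k + 1 : ℕ) : ℝ)) = k + 1 := by push_cast; ring
    have i0 := ih i 0
    have i1 := ih i 1
    have key : Real.sin b * ((E ^ (k+1)) i 0 * E 0 j + (E ^ (k+1)) i 1 * E 1 j) =
      (Real.sin ((k + 1) * b) * E i 0 - Real.sin (k * b) * (1 : SL2R) i 0) * E 0 j +
      (Real.sin ((k + 1) * b) * E i 1 - Real.sin (k * b) * (1 : SL2R) i 1) * E 1 j := by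
      linear_combination E 0 j * i0 + E 1 j * i1
    rw [key, h1, h2, ← htr]
    fin_cases i <;> fin_cases j <;> simp
    · linear_combination -Real.sin ((k + 1) * b) * hdet
    · ring
    · ring
    · linear_combination -Real.sin ((k + 1) * b) * hdet

theorem rot_E_pow (C S : ℝ) (h : S ^ 2 = C ^ 2 - 1) (h' : (-S) ^ 2 = C ^ 2 - 1) (t p : ℝ) (n : ℕ)
    (hn : 2 ≤ n)
    (hp : p = Real.pi / (2 * n)) (htp : C * Real.sin t = Real.cos p) :
    (rot C S h t * rot C (-S) h' t) ^ n = 1 := by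
  have hn0 : (0 : ℝ) < n := by positivity
  set b := Real.pi - 2 * p with hb
  have hnb : n * b = n * Real.pi - Real.pi := by
    rw [hb, hp]; field_simp
  have hsb : 0 < Real.sin b := by
    rw [hb, Real.sin_pi_sub]
    have h2 : (2 : ℝ) ≤ n := by exact_mod_cast hn
    have : 2 * p = Real.pi / n := by rw [hp]; field_simp
    rw [this]
    apply Real.sin_pos_of_pos_of_lt_pi (by have := Real.pi_pos; positivity)
    rw [div_lt_iff₀ hn0]
    nlinarith [Real.pi_pos]
  unfold rot
  rw [← QuotientGroup.mk_mul, ← QuotientGroup.mk_pow, QuotientGroup.eq_one_iff]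
  set E := rotM C S h t * rotM C (-S) h' t with hE
  have htr : E 0 0 + E 1 1 = 2 * Real.cos b := by
    rw [hE, sl_mul_apply, sl_mul_apply]
    simp only [rotM_00, rotM_01, rotM_10, rotM_11]
    rw [hb, Real.cos_pi_sub, Real.cos_two_mul, ← htp]
    linear_combination 2 * Real.sin_sq_add_cos_sq t - 2 * Real.sin t ^ 2 * h
  obtain ⟨k, rfl⟩ : ∃ k, n = k + 1 := ⟨n - 1, by omega⟩
  have hpow := sl_pow E b htr k
  have e1 : Real.sin ((k + 1) * b) = 0 := by
    have : ((k : ℝ) + 1) * b = (k : ℝ) * Real.pi := by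
      push_cast at hnb; rw [hnb]; ring
    rw [this, Real.sin_nat_mul_pi]
  have e2 : Real.sin (k * b) = -(Real.cos (k * Real.pi) * Real.sin b) := by
    have : (k : ℝ) * b = (k : ℝ) * Real.pi - b := by
      push_cast at hnb; linarith
    rw [this, Real.sin_sub, Real.sin_nat_mul_pi]; ring
  have e3 : ∀ i j, (E ^ (k + 1)) i j = Real.cos (k * Real.pi) * (1 : SL2R) i j := by
    intro i j
    apply mul_left_cancel₀ hsb.ne'
    rw [hpow, e1, e2]; ring
  apply sl_center (r := Real.cos (k * Real.pi)) <;> rw [e3] <;> simp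


open UpperHalfPlane Matrix

theorem sl_entry_cont (i j : Fin 2) : Continuous (fun A : SL2R => A i j) := by
  have : Continuous (fun A : SL2R => (A : Matrix (Fin 2) (Fin 2) ℝ)) := continuous_induced_dom
  exact this.matrix_elem i j

theorem pact_cont (z w : ℍ) : Continuous (fun h : PSL2R => Real.cosh (dist (pact h z) w)) := by
  have hq : Topology.IsQuotientMap (QuotientGroup.mk : SL2R → PSL2R) := isQuotientMap_quot_mk
  rw [hq.continuous_iff]
  change Continuous (fun A : SL2R => Real.cosh (dist (A • z) w))
  · have h00 := sl_entry_cont 0 0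
    have h01 := sl_entry_cont 0 1
    have h10 := sl_entry_cont 1 0
    have h11 := sl_entry_cont 1 1
    have e : (fun A : SL2R => Real.cosh (dist (A • z) w)) = fun A =>
      ((A 0 0 ^ 2 + A 1 0 ^ 2) * (hX0 z + hX1 z)
      + 2 * (A 0 0 * A 0 1 + A 1 0 * A 1 1) * hX2 z + (A 0 1 ^ 2 + A 1 1 ^ 2) * (hX0 z - hX1 z)) / 2 * hX0 w
      - ((A 0 0 ^ 2 - A 1 0 ^ 2) * (hX0 z + hX1 z)
      + 2 * (A 0 0 * A 0 1 - A 1 0 * A 1 1) * hX2 z + (A 0 1 ^ 2 - A 1 1 ^ 2) * (hX0 z - hX1 z)) / 2 * hX1 w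
      - (A 0 0 * A 1 0 * (hX0 z + hX1 z)
      + (A 0 0 * A 1 1 + A 0 1 * A 1 0) * hX2 z + A 0 1 * A 1 1 * (hX0 z - hX1 z)) * hX2 w := by
      funext A
      obtain ⟨a, b, c⟩ := sl_hX A z
      rw [hX_dist, ← a, ← b, ← c]
      ring
    rw [e]
    fun_prop

theorem sl_compact (M : ℝ) : IsCompact {A : SL2R | ∀ i j, A i j ∈ Set.Icc (-M) M} := by
  have hemb : Topology.IsClosedEmbedding (fun A : SL2R => (A : Matrix (Fin 2) (Fin 2) ℝ)) := by
    refine ⟨⟨⟨rfl⟩, Subtype.val_injective⟩, ?_⟩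
    have : Set.range (fun A : SL2R => (A : Matrix (Fin 2) (Fin 2) ℝ)) = {B | B.det = 1} := by
      ext B
      constructor
      · rintro ⟨A, rfl⟩; exact A.det_coe
      · intro hB; exact ⟨⟨B, hB⟩, rfl⟩
    rw [this]
    exact isClosed_eq (Continuous.matrix_det continuous_id) continuous_const
  have hK : IsCompact (Set.pi Set.univ fun _ : Fin 2 => Set.pi Set.univ fun _ : Fin 2 => Set.Icc (-M) M) :=
    isCompact_univ_pi fun _ => isCompact_univ_pi fun _ => isCompact_Icc
  have := hemb.isCompact_preimage hK
  convert this using 1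
  ext A
  constructor
  · intro h i _ j _
    exact h i j
  · intro h i j
    exact h i trivial j trivial

theorem fuchsian_final {G : Type*} [Group G] (ρ : G →* PSL2R) (O w : ℍ) (r : ℝ) (hr : 0 < r)
    (hdisc : ∀ g, dist (pact (ρ g) O) O < r → g = 1)
    (w0 : hX0 w = 1) (w1 : hX1 w = 0) (w2 : hX2 w = 0)
    (R : ℝ) (hcov : ∀ x, ∃ g, dist (pact (ρ g) w) x ≤ R) :
    ∃ Γ : Subgroup PSL2R, DiscreteTopology Γ ∧ CompactSpace (PSL2R ⧸ Γ) ∧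
      Nonempty (Γ ≃* G) := by
  have hinj : Function.Injective ρ := by
    rw [injective_iff_map_eq_one]
    intro g hg
    apply hdisc
    rw [hg, map_one]
    simpa using hr
  refine ⟨ρ.range, ?_, ?_, ⟨(MonoidHom.ofInjective hinj).symm⟩⟩
  · rw [discreteTopology_iff_isOpen_singleton]
    rintro ⟨_, g, rfl⟩
    have hop : IsOpen {h : PSL2R | Real.cosh (dist (pact h O) (pact (ρ g) O)) < Real.cosh r} :=
      isOpen_lt (pact_cont _ _) continuous_const
    convert hop.preimage (continuous_subtype_val (p := fun x => x ∈ ρ.range)) using 1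
    ext ⟨_, g', rfl⟩
    rw [Set.mem_singleton_iff, Subtype.ext_iff]
    simp only [Set.mem_preimage, Set.mem_ofPred_eq]
    constructor
    · intro h
      rw [h, dist_self, Real.cosh_zero]
      exact Real.one_lt_cosh.2 hr.ne'
    · intro h
      rw [Real.cosh_lt_cosh, abs_of_nonneg dist_nonneg, abs_of_pos hr] at h
      have : g⁻¹ * g' = 1 := by
        apply hdisc
        rw [map_mul, map_mul, IsometryEquiv.mul_apply, ← (pact (ρ g)).dist_eq,
          ← IsometryEquiv.mul_apply, ← map_mul, ← map_mul, mul_inv_cancel, map_one, map_one]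
        exact h
      rw [inv_mul_eq_one] at this
      rw [this]
  · set M := Real.sqrt (2 * Real.cosh R) with hM
    have hK := (sl_compact M).image (f := fun A : SL2R => (QuotientGroup.mk (QuotientGroup.mk A : PSL2R) : PSL2R ⧸ ρ.range))
      (continuous_quot_mk.comp continuous_quot_mk)
    refine ⟨?_⟩
    convert hK
    symm
    rw [Set.eq_univ_iff_forall]
    intro q
    obtain ⟨h, rfl⟩ := QuotientGroup.mk_surjective q
    obtain ⟨g, hg⟩ := hcov (pact h⁻¹ w)
    obtain ⟨A, hA⟩ := QuotientGroup.mk_surjective (h * ρ g)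
    refine ⟨A, ?_, ?_⟩
    · have h1 : dist (pact (h * ρ g) w) w ≤ R := by
        rw [map_mul, IsometryEquiv.mul_apply, ← (pact h⁻¹).dist_eq, ← IsometryEquiv.mul_apply,
          ← map_mul, inv_mul_cancel, map_one]
        exact hg
      have hR : 0 ≤ R := dist_nonneg.trans h1
      have h2 : Real.cosh (dist (pact (h * ρ g) w) w) ≤ Real.cosh R := by
        rw [Real.cosh_le_cosh, abs_of_nonneg dist_nonneg, abs_of_nonneg hR]
        exact h1
      rw [← hA, pact_mk, hX_dist, w0, w1, w2] at h2
      obtain ⟨a, -, -⟩ := sl_hX A w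
      rw [w0, w1, w2] at a
      have h3 : A 0 0 ^ 2 + A 0 1 ^ 2 + A 1 0 ^ 2 + A 1 1 ^ 2 ≤ 2 * Real.cosh R := by linarith
      intro i j
      rw [Set.mem_Icc, ← abs_le]
      apply Real.abs_le_sqrt
      fin_cases i <;> fin_cases j <;> simp <;>
        nlinarith [sq_nonneg (A 0 0), sq_nonneg (A 0 1), sq_nonneg (A 1 0), sq_nonneg (A 1 1)]
    · change (QuotientGroup.mk (QuotientGroup.mk A : PSL2R) : PSL2R ⧸ ρ.range) = QuotientGroup.mk h
      rw [hA]
      rw [QuotientGroup.eq]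
      exact ⟨g⁻¹, by simp⟩


open UpperHalfPlane Matrix

def dsig {D : Type*} (p0 p1 : Equiv.Perm D) : Fin 3 → D × Bool → D × Bool
  | 0, (d, true) => (p1⁻¹ d, false)
  | 0, (d, false) => (p1 d, true)
  | 1, (d, true) => (p0 d, false)
  | 1, (d, false) => (p0⁻¹ d, true)
  | 2, (d, b) => (d, !b)

def dval {D α : Type*} (p0 : Equiv.Perm D) (F : D → α) : D × Bool → α
  | (d, true) => F d
  | (d, false) => F (p0⁻¹ d)

def dsgn {D : Type*} : D × Bool → ℝ
  | (_, true) => 1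
  | (_, false) => -1

theorem perm_ai {D : Type*} (P : Equiv.Perm D) (d : D) : P (P⁻¹ d) = d := P.apply_symm_apply d
theorem perm_ia {D : Type*} (P : Equiv.Perm D) (d : D) : P⁻¹ (P d) = d := P.symm_apply_apply d

theorem perm_sum_inv {D : Type*} (P : Equiv.Perm D) (N : ℕ) (hP : ∀ d, (P ^ N) d = d) (θ : D → ℝ)
    (c : ℝ) (h : ∀ d, ∑ i ∈ Finset.range N, θ ((P ^ i) d) = c) (d : D) :
    (P⁻¹ ^ N) d = d ∧ ∑ i ∈ Finset.range N, θ ((P⁻¹ ^ i) d) = c := by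
  have h1 : P ^ N = 1 := Equiv.ext hP
  constructor
  · rw [inv_pow, h1]; rfl
  · rw [← h (P d), ← Finset.sum_range_reflect]
    apply Finset.sum_congr rfl
    intro i hi
    rw [Finset.mem_range] at hi
    rw [← Equiv.Perm.mul_apply, ← pow_succ]
    congr 2
    rw [inv_pow, inv_eq_iff_mul_eq_one, ← pow_add, ← h1]
    congr 1
    omega

theorem iter_lift {D : Type*} (M : D × Bool → D × Bool) (P : Equiv.Perm D) (b : Bool)
    (h : ∀ d, M (d, b) = (P d, b)) (i : ℕ) (d : D) : M^[i] (d, b) = ((P ^ i) d, b) := by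
  induction i generalizing d with
  | zero => rfl
  | succ i ih => rw [Function.iterate_succ_apply, h, ih, pow_succ, Equiv.Perm.mul_apply]

theorem dart_geo {D : Type*} (p0 p1 : Equiv.Perm D) (θ φ : D → ℝ) (Fr : D → PSL2R)
    (C S : ℝ) (hC : 1 < C) (hS : 0 < S) (h : S ^ 2 = C ^ 2 - 1) (h' : (-S) ^ 2 = C ^ 2 - 1)
    (ph_pos : ∀ d, 0 < φ d) (ph_le : ∀ d, φ d ≤ Real.pi / 4) (th_pos : ∀ d, 0 < θ d)
    (th_lt : ∀ d, θ d < Real.pi / 2) (hth : ∀ d, C * Real.sin (θ d) = Real.cos (φ d))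
    (hp0 : ∀ d, Fr (p0 d) = rot C S h (-θ d) * Fr d)
    (hp1 : ∀ d, Fr (p1⁻¹ d) = rot C (-S) h' (θ d) * Fr d)
    (hθ : ∀ d, θ (p1 (p0 d)) = θ d) (hφ : ∀ d, φ (p1 (p0 d)) = φ d)
    (N : ℕ) (hN : 0 < N) (perO : ∀ d, (p0 ^ N) d = d)
    (sumO : ∀ d, ∑ i ∈ Finset.range N, θ ((p0 ^ i) d) = Real.pi)
    (perV : ∀ d, (p1 ^ N) d = d)
    (sumV : ∀ d, ∑ i ∈ Finset.range N, θ ((p1 ^ i) d) = Real.pi)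
    (perM : ∀ d, ∃ m : ℕ, 0 < m ∧ ((p1 * p0) ^ m) d = d ∧ m * (2 * φ d) = Real.pi) :
    Geo C S (dsig p0 p1) (dval p0 θ) (dval p0 φ) (fun τ x => hX0 (pact (Fr τ.1) x))
      (fun τ x => hX1 (pact (Fr τ.1) x)) (fun τ x => dsgn τ * hX2 (pact (Fr τ.1) x)) := by
  have hθ' : ∀ d, θ (p0⁻¹ d) = θ (p1 d) := fun d => by
    have := hθ (p0⁻¹ d); rw [perm_ai] at this; exact this.symm
  have hφ' : ∀ d, φ (p0⁻¹ d) = φ (p1 d) := fun d => by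
    have := hφ (p0⁻¹ d); rw [perm_ai] at this; exact this.symm
  have f0 : ∀ d x, pact (Fr (p0 d)) x = pact (rot C S h (-(1 * θ d))) (pact (Fr d) x) := by
    intro d x; rw [hp0, map_mul, one_mul]; rfl
  have f0' : ∀ d x, pact (Fr (p0⁻¹ d)) x =
      pact (rot C S h (-(-1 * θ (p0⁻¹ d)))) (pact (Fr d) x) := by
    intro d x
    have := hp0 (p0⁻¹ d)
    rw [perm_ai, rot_neg, eq_inv_mul_iff_mul_eq] at this
    rw [← this, map_mul, neg_mul, one_mul, neg_neg]; rfl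
  have f1 : ∀ d x, pact (Fr (p1⁻¹ d)) x = pact (rot C (-S) h' (-(-1 * θ d))) (pact (Fr d) x) := by
    intro d x; rw [hp1, map_mul, neg_mul, one_mul, neg_neg]; rfl
  have f1' : ∀ d x, pact (Fr (p1 d)) x =
      pact (rot C (-S) h' (-(1 * θ (p0⁻¹ d)))) (pact (Fr d) x) := by
    intro d x
    have := hp1 (p1 d)
    rw [perm_ia] at this
    rw [this, hθ', rot_neg, one_mul, map_mul, map_inv]
    simp
  refine ⟨hC, hS, h, ?_, ?_, ?_, ?_, ?_, ?_, ?_, ?_, ?_, ?_, ?_, ?_, ?_, ?_, ?_, ?_, ?_, ?_, ?_, ?_, ?_, ?_, ?_, ?_⟩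
  · intro s
    rintro ⟨d, _ | _⟩ <;> fin_cases s <;> simp [dsig]
  · rintro ⟨d, _ | _⟩ <;> exact ph_pos _
  · rintro ⟨d, _ | _⟩ <;> exact ph_le _
  · rintro ⟨d, _ | _⟩ <;> exact th_pos _
  · rintro ⟨d, _ | _⟩ <;> exact th_lt _
  · rintro ⟨d, _ | _⟩ <;> exact hth _
  · rintro ⟨d, _ | _⟩ <;> simp only [dsig, dval, hθ', perm_ai]
  · rintro ⟨d, _ | _⟩ <;> simp [dsig, dval]
  · rintro ⟨d, _ | _⟩ <;> simp only [dsig, dval, hφ', perm_ai]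
  · rintro ⟨d, _ | _⟩ <;> simp [dsig, dval]
  · intro τ x; exact hX0_pos _
  · rintro ⟨d, _ | _⟩ x <;> simp only [dsgn] <;> rw [hX_hyp] <;> ring
  · rintro ⟨d, _ | _⟩ x <;> simp only [dsig, dval, dsgn]
    · rw [f1', (rot_hX C (-S) h' _ 1 (Or.inl rfl) _).1]; ring
    · rw [f1, (rot_hX C (-S) h' _ (-1) (Or.inr rfl) _).1]; ring
  · rintro ⟨d, _ | _⟩ x <;> simp only [dsig, dval, dsgn]
    · rw [f1', (rot_hX C (-S) h' _ 1 (Or.inl rfl) _).2.1]; ring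
    · rw [f1, (rot_hX C (-S) h' _ (-1) (Or.inr rfl) _).2.1]; ring
  · rintro ⟨d, _ | _⟩ x <;> simp only [dsig, dval, dsgn]
    · rw [f1']; linear_combination -(rot_hX C (-S) h' (θ (p0⁻¹ d)) 1 (Or.inl rfl) (pact (Fr d) x)).2.2
    · rw [f1]; linear_combination -(rot_hX C (-S) h' (θ d) (-1) (Or.inr rfl) (pact (Fr d) x)).2.2
  · rintro ⟨d, _ | _⟩ x <;> simp only [dsig, dval, dsgn]
    · rw [f0', (rot_hX C S h _ (-1) (Or.inr rfl) _).1]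
    · rw [f0, (rot_hX C S h _ 1 (Or.inl rfl) _).1]
  · rintro ⟨d, _ | _⟩ x <;> simp only [dsig, dval, dsgn]
    · rw [f0', (rot_hX C S h _ (-1) (Or.inr rfl) _).2.1]
    · rw [f0, (rot_hX C S h _ 1 (Or.inl rfl) _).2.1]
  · rintro ⟨d, _ | _⟩ x <;> simp only [dsig, dval, dsgn]
    · rw [f0']; linear_combination (rot_hX C S h (θ (p0⁻¹ d)) (-1) (Or.inr rfl) (pact (Fr d) x)).2.2
    · rw [f0]; linear_combination (rot_hX C S h (θ d) 1 (Or.inl rfl) (pact (Fr d) x)).2.2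
  · rintro ⟨d, _ | _⟩ x <;> rfl
  · rintro ⟨d, _ | _⟩ x <;> rfl
  · rintro ⟨d, _ | _⟩ x <;> simp [dsig, dsgn]
  · rintro ⟨d, _ | _⟩
    · have hit := iter_lift (fun t => dsig p0 p1 2 (dsig p0 p1 1 t)) p0⁻¹ false (fun d => rfl)
      refine ⟨N, hN, ?_, ?_⟩
      · rw [hit, (perm_sum_inv p0 N perO θ _ sumO d).1]
      · simp only [hit, dval]
        rw [← (perm_sum_inv p0 N perO θ _ sumO (p0⁻¹ d)).2]
        apply Finset.sum_congr rfl
        intro i _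
        rw [← Equiv.Perm.mul_apply, ← Equiv.Perm.mul_apply, ← pow_succ, ← pow_succ']
    · have hit := iter_lift (fun t => dsig p0 p1 2 (dsig p0 p1 1 t)) p0 true (fun d => rfl)
      refine ⟨N, hN, ?_, ?_⟩
      · rw [hit, perO]
      · simp only [hit, dval]
        exact sumO d
  · rintro ⟨d, _ | _⟩
    · have hit := iter_lift (fun t => dsig p0 p1 2 (dsig p0 p1 0 t)) p1 false (fun d => rfl)
      refine ⟨N, hN, ?_, ?_⟩
      · rw [hit, perV]
      · simp only [hit, dval, hθ']
        rw [← sumV (p1 d)]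
        apply Finset.sum_congr rfl
        intro i _
        rw [← Equiv.Perm.mul_apply, ← Equiv.Perm.mul_apply, ← pow_succ, ← pow_succ']
    · have hit := iter_lift (fun t => dsig p0 p1 2 (dsig p0 p1 0 t)) p1⁻¹ true (fun d => rfl)
      refine ⟨N, hN, ?_, ?_⟩
      · rw [hit, (perm_sum_inv p1 N perV θ _ sumV d).1]
      · simp only [hit, dval]
        exact (perm_sum_inv p1 N perV θ _ sumV d).2
  · have hc : ∀ (i : ℕ) d, φ (((p1 * p0) ^ i) d) = φ d := by
      intro i
      induction i with
      | zero => intro d; rfl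
      | succ i ih => intro d; rw [pow_succ, Equiv.Perm.mul_apply, ih]; exact hφ d
    have hc' : ∀ (i : ℕ) d, φ (((p1 * p0)⁻¹ ^ i) d) = φ d := by
      intro i d
      rw [← hc i (((p1 * p0)⁻¹ ^ i) d), inv_pow, perm_ai]
    rintro ⟨d, _ | _⟩
    · have hit := iter_lift (fun t => dsig p0 p1 0 (dsig p0 p1 1 t)) (p1⁻¹ * p0⁻¹) false (fun d => rfl)
      obtain ⟨m, hm, h1, h2⟩ := perM (p0⁻¹ d)
      have hconj : ∀ i : ℕ, (p1⁻¹ * p0⁻¹) ^ i = p0 * (p1 * p0)⁻¹ ^ i * p0⁻¹ := by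
        intro i
        rw [← conj_pow]
        congr 1
        group
      refine ⟨m, hm, ?_, ?_⟩
      · rw [hit, hconj, Equiv.Perm.mul_apply, Equiv.Perm.mul_apply, inv_pow]
        have : ((p1 * p0) ^ m)⁻¹ (p0⁻¹ d) = p0⁻¹ d := by
          rw [Equiv.Perm.inv_eq_iff_eq]; exact h1.symm
        rw [this, perm_ai]
      · simp only [hit, dval, hconj, Equiv.Perm.mul_apply, perm_ia, hc']
        rw [Finset.sum_const, Finset.card_range, nsmul_eq_mul]; exact h2
    · have hit := iter_lift (fun t => dsig p0 p1 0 (dsig p0 p1 1 t)) (p1 * p0) true (fun d => rfl)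
      obtain ⟨m, hm, h1, h2⟩ := perM d
      refine ⟨m, hm, ?_, ?_⟩
      · rw [hit, h1]
      · simp only [hit, dval, hc]
        rw [Finset.sum_const, Finset.card_range, nsmul_eq_mul]; exact h2


open UpperHalfPlane Matrix

def dP0 (G : Type*) {K : Type*} (s : Equiv.Perm K) : Equiv.Perm (G × K) :=
  Equiv.prodCongr (Equiv.refl G) s⁻¹

def dP2 {G K : Type*} [Group G] (f : Equiv.Perm K) (hl : K → G) : Equiv.Perm (G × K) where
  toFun d := (d.1 * hl d.2, f d.2)
  invFun d := (d.1 * (hl (f⁻¹ d.2))⁻¹, f⁻¹ d.2)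
  left_inv d := by simp
  right_inv d := by simp

theorem dP0_pow {G K : Type*} (s : Equiv.Perm K) (n : ℕ) (d : G × K) :
    ((dP0 G s) ^ n) d = (d.1, (s⁻¹ ^ n) d.2) := by
  induction n with
  | zero => rfl
  | succ n ih => rw [pow_succ', Equiv.Perm.mul_apply, ih, pow_succ']; rfl

theorem dP1_snd {G K : Type*} [Group G] (s f : Equiv.Perm K) (hl : K → G) (n : ℕ) (d : G × K) :
    (((dP2 f hl * (dP0 G s)⁻¹) ^ n) d).2 = ((f * s) ^ n) d.2 := by
  induction n with
  | zero => rfl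
  | succ n ih =>
    rw [pow_succ', Equiv.Perm.mul_apply, pow_succ', Equiv.Perm.mul_apply _ _ d.2, ← ih]
    rfl

theorem dart_main {D K : Type*} [Finite K] (p0 p1 : Equiv.Perm D) (θ : K → ℝ) (κ : D → K)
    (φ : D → ℝ) (Fr : D → PSL2R) (C S : ℝ) (geo : Geo C S (dsig p0 p1)
      (dval p0 (fun d => θ (κ d))) (dval p0 φ) (fun τ x => hX0 (pact (Fr τ.1) x))
      (fun τ x => hX1 (pact (Fr τ.1) x)) (fun τ x => dsgn τ * hX2 (pact (Fr τ.1) x))) (d0 : D) :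
    (∀ τ τ', Relation.ReflTransGen (fun t t' => ∃ s, t' = dsig p0 p1 s t) τ τ' →
      ({x | C * hX0 (pact (Fr τ.1) x) + S * hX1 (pact (Fr τ.1) x) < Real.sqrt (2 * C^2 - 1)} ∩
       {x | C * hX0 (pact (Fr τ'.1) x) + S * hX1 (pact (Fr τ'.1) x) < Real.sqrt (2 * C^2 - 1)}).Nonempty →
        SameV (dsig p0 p1) 0 τ τ') ∧
    ∀ x, ∃ τ : D × Bool, C * hX0 (pact (Fr τ.1) x) + S * hX1 (pact (Fr τ.1) x) < Real.sqrt (2 * C^2 - 1) ∨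
      C * hX0 (pact (Fr τ.1) x) - S * hX1 (pact (Fr τ.1) x) < Real.sqrt (2 * C^2 - 1) ∨
      Real.cos (θ (dval p0 κ τ)) * hX0 (pact (Fr τ.1) x) -
        S * Real.sin (θ (dval p0 κ τ)) * (dsgn τ * hX2 (pact (Fr τ.1) x))
        < Real.cos (θ (dval p0 κ τ)) := by
  have hkof : ∀ τ, dval p0 (fun d : D => θ (κ d)) τ = θ (dval p0 κ τ) := by
    rintro ⟨d, _ | _⟩ <;> rfl
  have he : ∀ τ : D × Bool, (dsgn τ) ^ 2 = 1 := by rintro ⟨d, _ | _⟩ <;> simp [dsgn]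
  have := Geo.mainH (T := D × Bool) (L := K × Bool) (C := C) (S := S) (σ := dsig p0 p1)
    (th := dval p0 (fun d => θ (κ d))) (ph := dval p0 φ) (F := fun τ => pact (Fr τ.1)) (e := dsgn)
    he geo (fun τ => (dval p0 κ τ, τ.2))
    (by
      rintro ⟨d, b⟩ ⟨d', b'⟩ hl
      simp only [Prod.mk.injEq] at hl
      obtain ⟨e1, rfl⟩ := hl
      refine ⟨by rw [hkof, hkof, e1], ?_⟩
      cases b <;> rfl) (d0, true)
  simpa only [hkof] using this

set_option maxHeartbeats 1000000 in
theorem poincare {G K : Type*} [Group G] [Fintype K] (k0 : K) (s f : Equiv.Perm K)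
    (hl : K → G) (θ : K → ℝ) (nu : K → ℕ) (Φ : K → PSL2R) (ρ : G →* PSL2R)
    (C S : ℝ) (hC : 1 < C) (hS : 0 < S) (h : S ^ 2 = C ^ 2 - 1) (h' : (-S) ^ 2 = C ^ 2 - 1)
    (hnu : ∀ k, 2 ≤ nu k) (hfθ : ∀ k, θ (f k) = θ k) (hfn : ∀ k, nu (f k) = nu k)
    (th_pos : ∀ k, 0 < θ k) (th_lt : ∀ k, θ k < Real.pi / 2)
    (hth : ∀ k, C * Real.sin (θ k) = Real.cos (Real.pi / (2 * nu k)))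
    (hΦ : ∀ k, Φ (s⁻¹ k) = Φ k * rot C S h (θ k)) (hΦO : ∀ k, ∃ t, Φ k = rot C S h t)
    (hH : ∀ k, ρ (hl k) = Φ k * (rot C S h (θ k) * rot C (-S) h' (θ k)) * (Φ (f k))⁻¹)
    (gen : Subgroup.closure (Set.range hl) = ⊤)
    (N : ℕ) (hN : 0 < N) (hs : s ^ N = 1) (hcyc : ∀ k, ∃ i : ℕ, (s⁻¹ ^ i) k0 = k)
    (sumO : ∀ k, ∑ i ∈ Finset.range N, θ ((s ^ i) k) = Real.pi)
    (perV : ∀ d, ((dP2 f hl * (dP0 G s)⁻¹) ^ N) d = d)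
    (sumV : ∀ k, ∑ i ∈ Finset.range N, θ (((f * s) ^ i) k) = Real.pi)
    (perM : ∀ d : G × K, ((dP2 f hl) ^ (nu d.2)) d = d) :
    ∃ Γ : Subgroup PSL2R, DiscreteTopology Γ ∧ CompactSpace (PSL2R ⧸ Γ) ∧
      Nonempty (Γ ≃* G) := by
  set p0 := dP0 G s with hp0
  set p1 := dP2 f hl * (dP0 G s)⁻¹ with hp1
  have hp2 : p1 * p0 = dP2 f hl := by rw [hp1, hp0]; group
  let Fr : G × K → PSL2R := fun d => (ρ d.1 * Φ d.2)⁻¹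
  have hsum0 := perm_sum_inv s N (fun k => by rw [hs]; rfl) θ _ sumO
  have geo := dart_geo p0 p1 (fun d => θ d.2) (fun d => Real.pi / (2 * nu d.2)) Fr C S hC hS h h'
    (by
      intro d
      have := hnu d.2
      have := Real.pi_pos
      have : (0 : ℝ) < nu d.2 := by exact_mod_cast (by omega)
      positivity)
    (by
      intro d
      have h2 : (2 : ℝ) ≤ nu d.2 := by exact_mod_cast hnu d.2
      have := Real.pi_pos
      apply div_le_div_of_nonneg_left <;> linarith)
    (fun d => th_pos _) (fun d => th_lt _) (fun d => hth _)
    (by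
      rintro ⟨g, k⟩
      change (ρ g * Φ (s⁻¹ k))⁻¹ = rot C S h (-θ k) * (ρ g * Φ k)⁻¹
      rw [hΦ, rot_neg]; group)
    (by
      rintro ⟨g, k⟩
      change (ρ (g * (hl (f⁻¹ k))⁻¹) * Φ (s⁻¹ (f⁻¹ k)))⁻¹ = rot C (-S) h' (θ k) * (ρ g * Φ k)⁻¹
      have e : θ (f⁻¹ k) = θ k := by rw [← hfθ, perm_ai]
      rw [map_mul, map_inv, hH, hΦ, perm_ai, e]
      group)
    (by
      intro d
      rw [← Equiv.Perm.mul_apply, hp2]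
      exact hfθ d.2)
    (by
      intro d
      rw [← Equiv.Perm.mul_apply, hp2]
      change Real.pi / (2 * (nu (f d.2) : ℝ)) = _
      rw [hfn])
    N hN
    (by
      intro d
      rw [hp0, dP0_pow, (hsum0 d.2).1])
    (by
      intro d
      simp only [hp0, dP0_pow, (hsum0 d.2).2])
    perV
    (by
      intro d
      simp only [hp1, dP1_snd, sumV])
    (by
      intro d
      have h2 := hnu d.2
      have h3 : (0 : ℝ) < nu d.2 := by exact_mod_cast (by omega)
      refine ⟨nu d.2, by omega, ?_, ?_⟩
      · rw [hp2]; exact perM d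
      · field_simp)
  obtain ⟨hdis, hcov⟩ := dart_main p0 p1 θ Prod.snd _ Fr C S geo (1, k0)
  obtain ⟨w, w0, w1, w2⟩ := hX_surj 1 0 0 one_pos (by norm_num)
  obtain ⟨O, o0, o1, o2⟩ := hX_surj C (-S) 0 (by linarith) (by linarith)
  have hr : C < Real.sqrt (2 * C^2 - 1) := Real.lt_sqrt_of_sq_lt (by nlinarith)
  have hR1 : 1 < Real.sqrt (2 * C^2 - 1) := by linarith
  -- connectivity
  let rel : (G × K) × Bool → (G × K) × Bool → Prop := fun t t' => ∃ i, t' = dsig p0 p1 i t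
  have rel_symm : ∀ a b, rel a b → rel b a := by
    rintro a b ⟨i, rfl⟩
    exact ⟨i, (geo.inv i a).symm⟩
  have reach_symm : ∀ a b, Relation.ReflTransGen rel a b → Relation.ReflTransGen rel b a := by
    intro a b hab
    induction hab with
    | refl => exact .refl
    | tail _ hbc ih => exact (Relation.ReflTransGen.single (rel_symm _ _ hbc)).trans ih
  have m0 : ∀ d, Relation.ReflTransGen rel (d, true) (p0 d, true) := fun d =>
    (Relation.ReflTransGen.single (⟨1, rfl⟩ : rel (d, true) (p0 d, false))).tail ⟨2, rfl⟩
  have m2 : ∀ d, Relation.ReflTransGen rel (d, true) (dP2 f hl d, true) := fun d => by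
    rw [← hp2]
    exact (Relation.ReflTransGen.single (⟨1, rfl⟩ : rel (d, true) (p0 d, false))).tail ⟨0, rfl⟩
  have mk : ∀ g k, Relation.ReflTransGen rel ((g, k0), true) ((g, k), true) := by
    intro g k
    obtain ⟨i, rfl⟩ := hcyc k
    induction i with
    | zero => exact .refl
    | succ i ih =>
      refine ih.trans ?_
      rw [pow_succ', Equiv.Perm.mul_apply]
      exact m0 (g, (s⁻¹ ^ i) k0)
  have mk' : ∀ g k k', Relation.ReflTransGen rel ((g, k), true) ((g, k'), true) :=
    fun g k k' => (reach_symm _ _ (mk g k)).trans (mk g k')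
  have reach : ∀ g, Relation.ReflTransGen rel ((1, k0), true) ((g, k0), true) := by
    intro g
    have hg : g ∈ Subgroup.closure (Set.range hl) := by rw [gen]; trivial
    induction hg using Subgroup.closure_induction_right with
    | one => exact .refl
    | mul_right x _ y hy ih =>
      obtain ⟨k, rfl⟩ := hy
      exact ih.trans ((mk' x k0 k).trans ((m2 (x, k)).trans (mk' _ _ _)))
    | mul_inv_cancel x _ y hy ih =>
      obtain ⟨k, rfl⟩ := hy
      refine ih.trans ((mk' x k0 (f k)).trans ((reach_symm _ _ ?_).trans (mk' _ k _)))
      have := m2 (x * (hl k)⁻¹, k)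
      simpa [dP2] using this
  have same : ∀ a b, SameV (dsig p0 p1) 0 a b → a.1.1 = b.1.1 := by
    intro a b hab
    induction hab with
    | rel x y hxy =>
      obtain ⟨t, ht, rfl⟩ := hxy
      rcases x with ⟨d, _ | _⟩ <;> fin_cases t <;> first | exact absurd rfl ht | rfl
    | refl => rfl
    | symm _ _ _ ih => exact ih.symm
    | trans _ _ _ _ _ ih1 ih2 => exact ih1.trans ih2
  have hΦfix : ∀ k, pact (Φ k)⁻¹ O = O := by
    intro k
    obtain ⟨t, ht⟩ := hΦO k
    rw [ht, ← rot_neg]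
    exact rot_fix _ _ _ _ _ o0 o1 o2
  have hFrO : ∀ g k x, pact (Fr (g, k)) x = pact (Φ k)⁻¹ (pact (ρ g)⁻¹ x) := by
    intro g k x
    change pact (ρ g * Φ k)⁻¹ x = _
    rw [_root_.mul_inv_rev, map_mul, IsometryEquiv.mul_apply]
  have hB0 : ∀ d x, C * hX0 (pact (Fr d) x) + S * hX1 (pact (Fr d) x) =
      Real.cosh (dist (pact (Fr d) x) O) := by
    intro d x
    rw [hX_dist, o0, o1, o2]; ring
  -- bounds
  have hsc : ∀ k, S * Real.sin (θ k) < Real.cos (θ k) := by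
    intro k
    have hs0 : 0 < Real.sin (θ k) := geo.sin_pos ((1, k), true)
    have hc0 : 0 < Real.cos (θ k) := geo.cos_pos ((1, k), true)
    have h1 := Real.sin_sq_add_cos_sq (θ k)
    have h3 : 0 < Real.sin (Real.pi / (2 * nu k)) :=
      Real.sin_pos_of_pos_of_lt_pi (geo.ph_pos ((1, k), true))
        (by have := geo.ph_le ((1, k), true); simp only [dval] at this; linarith [Real.pi_pos])
    have h2 := Real.sin_sq_add_cos_sq (Real.pi / (2 * nu k))
    rw [← hth] at h2
    apply lt_of_pow_lt_pow_left₀ 2 hc0.le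
    have h4 : (C * Real.sin (θ k)) ^ 2 < 1 := by nlinarith
    nlinarith
  have hCS : 0 < C - S := by nlinarith
  set R0 : ℝ := Real.sqrt (2 * C^2 - 1) / (C - S) +
    ∑ k, Real.cos (θ k) / (Real.cos (θ k) - S * Real.sin (θ k)) with hR0
  have hterm : ∀ k, 0 ≤ Real.cos (θ k) / (Real.cos (θ k) - S * Real.sin (θ k)) := by
    intro k
    have hc0 : 0 < Real.cos (θ k) := geo.cos_pos ((1, k), true)
    have := hsc k
    exact div_nonneg hc0.le (by linarith)
  have hbound : ∀ x, ∃ d : G × K, hX0 (pact (Fr d) x) ≤ R0 := by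
    intro x
    obtain ⟨τ, hτ⟩ := hcov x
    refine ⟨τ.1, ?_⟩
    have y0 := hX0_pos (pact (Fr τ.1) x)
    have hy := hX_hyp (pact (Fr τ.1) x)
    have a1 : |hX1 (pact (Fr τ.1) x)| ≤ hX0 (pact (Fr τ.1) x) :=
      abs_le_of_sq_le_sq (by nlinarith [sq_nonneg (hX2 (pact (Fr τ.1) x))]) y0.le
    have a2 : |hX2 (pact (Fr τ.1) x)| ≤ hX0 (pact (Fr τ.1) x) :=
      abs_le_of_sq_le_sq (by nlinarith [sq_nonneg (hX1 (pact (Fr τ.1) x))]) y0.le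
    have hsum : 0 ≤ ∑ k, Real.cos (θ k) / (Real.cos (θ k) - S * Real.sin (θ k)) :=
      Finset.sum_nonneg fun k _ => hterm k
    have b1 := abs_le.1 a1
    have b2 := abs_le.1 a2
    have hsq : 0 ≤ Real.sqrt (2 * C^2 - 1) / (C - S) := by positivity
    rcases hτ with hτ | hτ | hτ
    · have : hX0 (pact (Fr τ.1) x) ≤ Real.sqrt (2 * C^2 - 1) / (C - S) := by
        rw [le_div_iff₀ hCS]; nlinarith
      linarith
    · have : hX0 (pact (Fr τ.1) x) ≤ Real.sqrt (2 * C^2 - 1) / (C - S) := by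
        rw [le_div_iff₀ hCS]; nlinarith
      linarith
    · set kof := dval p0 (Prod.snd : G × K → K) with hkof
      have hs0 : 0 < Real.sin (θ (kof τ)) := geo.sin_pos ((1, kof τ), true)
      have h5 := hsc (kof τ)
      have : hX0 (pact (Fr τ.1) x) ≤ Real.cos (θ (kof τ)) / (Real.cos (θ (kof τ)) - S * Real.sin (θ (kof τ))) := by
        rw [le_div_iff₀ (by linarith)]
        have hb : dsgn τ * hX2 (pact (Fr τ.1) x) ≤ hX0 (pact (Fr τ.1) x) := by
          rcases τ with ⟨d, _ | _⟩ <;> simp only [dsgn] <;> linarith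
        have hSs : 0 < S * Real.sin (θ (kof τ)) := by positivity
        nlinarith
      have h6 := Finset.single_le_sum (f := fun k => Real.cos (θ k) / (Real.cos (θ k) - S * Real.sin (θ k)))
        (fun k _ => hterm k) (Finset.mem_univ (kof τ))
      linarith
  refine fuchsian_final ρ O w (Real.arcosh (Real.sqrt (2 * C^2 - 1))) (Real.arcosh_pos hR1) ?_
    w0 w1 w2 (∑ k, dist w (pact (Φ k) w) + Real.arcosh R0) ?_
  · intro g hg
    have := same _ _ (hdis _ _ (reach g) ⟨pact (ρ g) O, ?_, ?_⟩)
    · exact this.symm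
    · simp only [Set.mem_ofPred_eq]
      rw [hB0, hFrO, map_one, inv_one, map_one]
      rw [← Real.cosh_arcosh hR1.le, Real.cosh_lt_cosh, abs_of_nonneg dist_nonneg,
        abs_of_nonneg (Real.arcosh_nonneg hR1.le)]
      nth_rewrite 2 [← hΦfix k0]
      rw [IsometryEquiv.dist_eq]
      exact hg
    · simp only [Set.mem_ofPred_eq]
      rw [hB0, hFrO, ← IsometryEquiv.mul_apply (pact (ρ g)⁻¹), ← map_mul, inv_mul_cancel, map_one]
      change Real.cosh (dist (pact (Φ k0)⁻¹ O) O) < _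
      rw [hΦfix, dist_self, Real.cosh_zero]
      exact hR1
  · intro x
    obtain ⟨⟨g, k⟩, hd⟩ := hbound x
    refine ⟨g, ?_⟩
    have h1 : dist (pact (Fr (g, k)) x) w ≤ Real.arcosh R0 := by
      have h2 : hX0 (pact (Fr (g, k)) x) = Real.cosh (dist (pact (Fr (g, k)) x) w) := by
        rw [hX_dist, w0, w1, w2]; ring
      rw [h2] at hd
      have h3 : 1 ≤ R0 := (Real.one_le_cosh _).trans hd
      rw [← Real.cosh_arcosh h3, Real.cosh_le_cosh, abs_of_nonneg dist_nonneg,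
        abs_of_nonneg (Real.arcosh_nonneg h3)] at hd
      exact hd
    have h2 : dist (pact (ρ g * Φ k) w) x ≤ Real.arcosh R0 := by
      rw [← (pact (Fr (g, k))).dist_eq, ← IsometryEquiv.mul_apply, ← map_mul]
      change dist (pact ((ρ g * Φ k)⁻¹ * (ρ g * Φ k)) w) _ ≤ _
      rw [inv_mul_cancel, map_one, dist_comm]
      exact h1
    have h3 : dist (pact (ρ g) w) (pact (ρ g * Φ k) w) = dist w (pact (Φ k) w) := by
      rw [map_mul, IsometryEquiv.mul_apply, IsometryEquiv.dist_eq]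
    have h4 := Finset.single_le_sum (f := fun k => dist w (pact (Φ k) w))
        (fun k _ => dist_nonneg) (Finset.mem_univ k)
    have h5 := dist_triangle (pact (ρ g) w) (pact (ρ g * Φ k) w) x
    linarith



theorem ivt_C {K : Type*} [Fintype K] (φ : K → ℝ) (h0 : ∀ k, 0 < φ k) (h1 : ∀ k, φ k ≤ Real.pi / 4)
    (hs : Real.pi < ∑ k, (Real.pi / 2 - φ k)) :
    ∃ C : ℝ, 1 < C ∧ ∑ k, Real.arcsin (Real.cos (φ k) / C) = Real.pi := by
  have hpi := Real.pi_pos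
  have hc : Continuous (fun x : ℝ => ∑ k, Real.arcsin (x * Real.cos (φ k))) := by
    refine continuous_finset_sum _ fun k _ => Real.continuous_arcsin.comp (by fun_prop)
  have e0 : (∑ k, Real.arcsin ((0:ℝ) * Real.cos (φ k))) = 0 := by simp
  have e1 : (∑ k, Real.arcsin ((1:ℝ) * Real.cos (φ k))) = ∑ k, (Real.pi / 2 - φ k) := by
    refine Finset.sum_congr rfl fun k _ => ?_
    rw [one_mul, ← Real.sin_pi_div_two_sub]
    refine Real.arcsin_sin ?_ ?_ <;> linarith [h0 k, h1 k]
  obtain ⟨x, ⟨hx0, hx1⟩, hx⟩ := intermediate_value_Icc (zero_le_one (α := ℝ)) hc.continuousOn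
    (show Real.pi ∈ Set.Icc _ _ by simp only [e0, e1]; exact ⟨hpi.le, hs.le⟩)
  simp only at hx
  have x0 : x ≠ 0 := by rintro rfl; rw [e0] at hx; linarith
  have x1 : x ≠ 1 := by rintro rfl; rw [e1] at hx; linarith
  have x0' := lt_of_le_of_ne hx0 x0.symm
  refine ⟨x⁻¹, (one_lt_inv₀ x0').2 (lt_of_le_of_ne hx1 x1), ?_⟩
  rw [← hx]
  refine Finset.sum_congr rfl fun k _ => ?_
  rw [div_inv_eq_mul, mul_comm]

/-- the word along a cycle -/
def cyW {K M : Type*} [Group M] (s q : Equiv.Perm K) (hl : K → M) (k : K) : ℕ → M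
  | 0 => 1
  | m + 1 => cyW s q hl k m * hl (s ((q ^ m) k))

theorem dP1_pow {G K : Type*} [Group G] (s f : Equiv.Perm K) (hl : K → G) (n : ℕ) (g : G) (k : K) :
    ((dP2 f hl * (dP0 G s)⁻¹) ^ n) (g, k) = (g * cyW s (f * s) hl k n, ((f * s) ^ n) k) := by
  induction n with
  | zero => simp [cyW]
  | succ n ih =>
    rw [pow_succ', Equiv.Perm.mul_apply, ih, pow_succ', cyW, ← mul_assoc]
    rfl

theorem perV_of {G K : Type*} [Group G] (s f : Equiv.Perm K) (hl : K → G) (N : ℕ) (k0 : K)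
    (hq : (f * s) ^ N = 1) (hc : ∀ k, ∃ i : ℕ, ((f * s) ^ i) k0 = k)
    (hw : cyW s (f * s) hl k0 N = 1) (d : G × K) :
    ((dP2 f hl * (dP0 G s)⁻¹) ^ N) d = d := by
  obtain ⟨g, k⟩ := d
  obtain ⟨i, rfl⟩ := hc k
  have h1 : ((dP2 f hl * (dP0 G s)⁻¹) ^ i) (g * (cyW s (f * s) hl k0 i)⁻¹, k0) =
      (g, ((f * s) ^ i) k0) := by rw [dP1_pow]; simp
  rw [← h1, ← Equiv.Perm.mul_apply, ← pow_add, add_comm, pow_add, Equiv.Perm.mul_apply]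
  congr 1
  rw [dP1_pow, hw, hq]; simp

theorem dP2_pow_fix {G K : Type*} [Group G] (f : Equiv.Perm K) (hl : K → G) (g : G) (k : K)
    (hk : f k = k) (n : ℕ) : ((dP2 f hl) ^ n) (g, k) = (g * hl k ^ n, k) := by
  induction n with
  | zero => simp
  | succ n ih =>
    rw [pow_succ', Equiv.Perm.mul_apply, ih, pow_succ, ← mul_assoc]
    change (_, f k) = _
    rw [hk]

theorem telescope {K : Type*} (s f : Equiv.Perm K) (H Φ : K → PSL2R) (θ : K → ℝ) (C S : ℝ)
    (h : S ^ 2 = C ^ 2 - 1) (h' : (-S) ^ 2 = C ^ 2 - 1)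
    (hΦ : ∀ k, Φ k = Φ (s k) * rot C S h (θ (s k)))
    (hH : ∀ k, H k = Φ k * (rot C S h (θ k) * rot C (-S) h' (θ k)) * (Φ (f k))⁻¹)
    (k0 : K) (m : ℕ) :
    cyW s (f * s) H k0 m = Φ k0 * rot C (-S) h' (∑ i ∈ Finset.range m, θ (s (((f * s) ^ i) k0))) *
      (Φ (((f * s) ^ m) k0))⁻¹ := by
  induction m with
  | zero => simp [cyW, rot_zero]
  | succ m ih =>
    rw [cyW, ih, Finset.sum_range_succ, rot_add, hH, pow_succ' (f * s), Equiv.Perm.mul_apply (f * s),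
      Equiv.Perm.mul_apply f s, ← mul_assoc (Φ (s _)), ← hΦ]
    group


open scoped commutatorElement

def sh (n : ℕ) : Equiv.Perm (Fin (n + 1)) := Equiv.addRight 1

theorem sh_apply (n : ℕ) (k : Fin (n + 1)) : sh n k = k + 1 := rfl

theorem sh_val (n : ℕ) (k : Fin (n + 1)) : (sh n k).val = if k.val = n then 0 else k.val + 1 := by
  rw [sh_apply, Fin.val_add_one]
  simp [Fin.ext_iff]

theorem sh_pow (n i : ℕ) (k : Fin (n + 1)) : ((sh n) ^ i) k = k + (Fin.ofNat (n + 1) i) := by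
  induction i with
  | zero => 
    apply Fin.ext
    simp
  | succ i ih =>
    rw [pow_succ', Equiv.Perm.mul_apply, ih, sh_apply, add_assoc]
    congr 1
    apply Fin.ext
    simp [Fin.val_add]

theorem sh_sum (n : ℕ) (F : Fin (n + 1) → ℝ) (k : Fin (n + 1)) :
    ∑ i ∈ Finset.range (n + 1), F (((sh n) ^ i) k) = ∑ j, F j := by
  simp only [sh_pow]
  rw [Finset.sum_range, ← Equiv.sum_comp (Equiv.addLeft k) F]
  refine Finset.sum_congr rfl fun i _ => ?_
  congr 2
  apply Fin.ext
  simp [Nat.mod_eq_of_lt i.2]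

theorem sh_pow_n (n : ℕ) : (sh n) ^ (n + 1) = 1 := by
  ext k
  rw [sh_pow]
  simp

theorem sh_cyc (n : ℕ) (k k' : Fin (n + 1)) : ∃ i : ℕ, ((sh n) ^ i) k = k' := by
  refine ⟨(k' - k).val, ?_⟩
  rw [sh_pow]
  have : Fin.ofNat (n + 1) (k' - k).val = k' - k := by
    apply Fin.ext
    simp [Nat.mod_eq_of_lt (k' - k).2]
  rw [this]; simp

theorem sh_cyc_inv (n : ℕ) (k k' : Fin (n + 1)) : ∃ i : ℕ, ((sh n)⁻¹ ^ i) k = k' := by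
  obtain ⟨i, hi⟩ := sh_cyc n k' k
  refine ⟨i, ?_⟩
  rw [← hi, ← Equiv.Perm.mul_apply, inv_pow, inv_mul_cancel]; rfl

def fN (g m : ℕ) : ℕ := if m < 4 * g then (if m % 4 < 2 then m + 2 else m - 2) else m
def piN (g m : ℕ) : ℕ :=
  if m < 4 * g then (if m % 4 = 0 then m + 2 else if m % 4 = 2 then m - 2 else m) else m

def fP (g n : ℕ) (hg : 4 * g ≤ n + 1) : Equiv.Perm (Fin (n + 1)) :=
  Function.Involutive.toPerm (fun k => ⟨fN g k.val, by have := k.2; unfold fN; split_ifs <;> omega⟩)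
    (by intro k; apply Fin.ext; simp only [fN]; split_ifs <;> omega)

def piP (g n : ℕ) (hg : 4 * g ≤ n + 1) : Equiv.Perm (Fin (n + 1)) :=
  Function.Involutive.toPerm (fun k => ⟨piN g k.val, by have := k.2; unfold piN; split_ifs <;> omega⟩)
    (by intro k; apply Fin.ext; simp only [piN]; split_ifs <;> omega)

theorem fP_val (g n : ℕ) (hg) (k : Fin (n + 1)) : (fP g n hg k).val = fN g k.val := rfl
theorem piP_val (g n : ℕ) (hg) (k : Fin (n + 1)) : (piP g n hg k).val = piN g k.val := rfl

theorem fP_sq (g n : ℕ) (hg) (k : Fin (n + 1)) : fP g n hg (fP g n hg k) = k := by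
  apply Fin.ext; simp only [fP_val, fN]; split_ifs <;> omega
theorem piP_sq (g n : ℕ) (hg) (k : Fin (n + 1)) : piP g n hg (piP g n hg k) = k := by
  apply Fin.ext; simp only [piP_val, piN]; split_ifs <;> omega

theorem q_apply (g n : ℕ) (hg) (k : Fin (n + 1)) :
    (fP g n hg * sh n) k = piP g n hg (sh n (piP g n hg k)) := by
  have := k.2
  apply Fin.ext
  rw [Equiv.Perm.mul_apply, fP_val, sh_val, piP_val, sh_val, piP_val]
  simp only [piN, fN]
  split_ifs <;> omega

theorem q_pow (g n : ℕ) (hg) (i : ℕ) (k : Fin (n + 1)) :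
    ((fP g n hg * sh n) ^ i) k = piP g n hg (((sh n) ^ i) (piP g n hg k)) := by
  induction i with
  | zero => simp [piP_sq]
  | succ i ih =>
    rw [pow_succ', Equiv.Perm.mul_apply, ih, q_apply, piP_sq, pow_succ', Equiv.Perm.mul_apply]

theorem q_pow_n (g n : ℕ) (hg) : (fP g n hg * sh n) ^ (n + 1) = 1 := by
  ext k
  rw [q_pow, sh_pow_n, Equiv.Perm.one_apply, piP_sq]; rfl

theorem q_sum (g n : ℕ) (hg) (F : Fin (n + 1) → ℝ) (k : Fin (n + 1)) :
    ∑ i ∈ Finset.range (n + 1), F (((fP g n hg * sh n) ^ i) k) = ∑ j, F j := by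
  simp only [q_pow]
  rw [sh_sum n (fun j => F (piP g n hg j)), Equiv.sum_comp]

theorem q_cyc (g n : ℕ) (hg) (k k' : Fin (n + 1)) : ∃ i : ℕ, ((fP g n hg * sh n) ^ i) k = k' := by
  obtain ⟨i, hi⟩ := sh_cyc n (piP g n hg k) (piP g n hg k')
  exact ⟨i, by rw [q_pow, hi, piP_sq]⟩

theorem sq_last (g n : ℕ) (hg) (i : ℕ) (hi : i ≤ n) :
    (sh n (((fP g n hg * sh n) ^ i) (Fin.last n))).val = fN g (piN g i) := by
  have h1 : sh n (((fP g n hg * sh n) ^ i) (Fin.last n)) =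
      fP g n hg (((fP g n hg * sh n) ^ (i + 1)) (Fin.last n)) := by
    rw [pow_succ', Equiv.Perm.mul_apply, Equiv.Perm.mul_apply (fP g n hg), fP_sq]
  have h2 : piP g n hg (Fin.last n) = Fin.last n := by
    apply Fin.ext; rw [piP_val]; simp only [piN, Fin.val_last]; split_ifs <;> omega
  rw [h1, fP_val, q_pow, piP_val, h2, sh_pow]
  congr 2
  rw [Fin.val_add]
  simp only [Fin.val_last, Fin.val_ofNat]
  rcases hi.lt_or_eq with h | h
  · rw [Nat.mod_eq_of_lt (show i + 1 < n + 1 by omega), show n + (i + 1) = i + (n + 1) by ring,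
      Nat.add_mod_right, Nat.mod_eq_of_lt (by omega)]
  · rw [h]; simp

def xN {M : Type*} [One M] {g : ℕ} (a : Fin g → M) (i : ℕ) : M := if h : i < g then a ⟨i, h⟩ else 1

theorem xN_eq {M : Type*} [One M] {g : ℕ} (a : Fin g → M) (i : Fin g) : xN a i.val = a i := by
  simp [xN]

def hlN {M : Type*} [Group M] (g r : ℕ) (a b c : ℕ → M) (m : ℕ) : M :=
  if m < 4 * g then
    (if m % 4 = 0 then a (m / 4) else if m % 4 = 1 then (b (m / 4))⁻¹ else
      if m % 4 = 2 then (a (m / 4))⁻¹ else b (m / 4))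
  else (c (r - 1 - (m - 4 * g)))⁻¹

def prodN {M : Type*} [Group M] (u : ℕ → M) : ℕ → M
  | 0 => 1
  | m + 1 => prodN u m * u m

theorem prodN_ofFn {M : Type*} [Group M] {g : ℕ} (x : Fin g → M) (u : ℕ → M)
    (h : ∀ i : Fin g, u i.val = x i) : prodN u g = (List.ofFn x).prod := by
  induction g with
  | zero => simp [prodN]
  | succ g ih =>
    rw [List.ofFn_succ_last, List.prod_append, prodN, ih (fun i => x i.castSucc)]
    · simp [← h]
    · intro i; rw [← h]; simp

theorem prodN_add {M : Type*} [Group M] (u : ℕ → M) (m k : ℕ) :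
    prodN u (m + k) = prodN u m * prodN (fun i => u (m + i)) k := by
  induction k with
  | zero => simp [prodN]
  | succ k ih => rw [← add_assoc, prodN, ih, prodN, mul_assoc]

theorem prodN_rev {M : Type*} [Group M] (c u : ℕ → M) (r : ℕ)
    (hu : ∀ j, j < r → u j = (c (r - 1 - j))⁻¹) : prodN u r = (prodN c r)⁻¹ := by
  have key : ∀ m, m ≤ r → prodN c r = prodN c (r - m) * (prodN u m)⁻¹ := by
    intro m
    induction m with
    | zero => intro _; simp [prodN]
    | succ m ih =>
      intro hm
      rw [ih (by omega), show r - m = (r - (m + 1)) + 1 by omega, prodN, prodN, hu m (by omega),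
        show r - 1 - m = r - (m + 1) by omega]
      group
  have := key r le_rfl
  rw [this]; simp [prodN]

theorem word_prod {M : Type*} [Group M] (g r : ℕ) (a b : Fin g → M) (c : Fin r → M) :
    prodN (fun i => hlN g r (xN a) (xN b) (xN c) (fN g (piN g i))) (4 * g + r) =
      (List.ofFn fun i => ⁅a i, b i⁆).prod * ((List.ofFn c).prod)⁻¹ := by
  rw [prodN_add]
  congr 1
  · have key : ∀ m, m ≤ g →
        prodN (fun i => hlN g r (xN a) (xN b) (xN c) (fN g (piN g i))) (4 * m) =
          prodN (fun i => ⁅xN a i, xN b i⁆) m := by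
      intro m
      induction m with
      | zero => intro _; rfl
      | succ m ih =>
        intro hm
        have e0 : fN g (piN g (4 * m)) = 4 * m := by simp only [fN, piN]; split_ifs <;> omega
        have e1 : fN g (piN g (4 * m + 1)) = 4 * m + 3 := by
          simp only [fN, piN]; split_ifs <;> omega
        have e2 : fN g (piN g (4 * m + 2)) = 4 * m + 2 := by
          simp only [fN, piN]; split_ifs <;> omega
        have e3 : fN g (piN g (4 * m + 3)) = 4 * m + 1 := by
          simp only [fN, piN]; split_ifs <;> omega
        rw [show 4 * (m + 1) = 4 * m + 1 + 1 + 1 + 1 by ring]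
        simp only [prodN]
        rw [ih (by omega), show 4 * m + 1 + 1 = 4 * m + 2 by ring,
          show 4 * m + 2 + 1 = 4 * m + 3 by ring, e0, e1, e2, e3]
        have d0 : (4 * m) / 4 = m := by omega
        have d1 : (4 * m + 1) / 4 = m := by omega
        have d2 : (4 * m + 2) / 4 = m := by omega
        have d3 : (4 * m + 3) / 4 = m := by omega
        have c0 : (4 * m) % 4 = 0 := by omega
        have c1 : (4 * m + 1) % 4 = 1 := by omega
        have c2 : (4 * m + 2) % 4 = 2 := by omega
        have c3 : (4 * m + 3) % 4 = 3 := by omega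
        have l0 : 4 * m < 4 * g := by omega
        have l1 : 4 * m + 1 < 4 * g := by omega
        have l2 : 4 * m + 2 < 4 * g := by omega
        have l3 : 4 * m + 3 < 4 * g := by omega
        simp only [hlN, l0, l1, l2, l3, d0, d1, d2, d3, c0, c1, c2, c3, if_true]
        norm_num [commutatorElement_def, mul_assoc]
    rw [key g le_rfl]
    exact prodN_ofFn _ _ (fun i => by rw [xN_eq, xN_eq])
  · rw [prodN_rev (xN c), prodN_ofFn c _ (fun i => xN_eq c i)]
    intro j hj
    have e : fN g (piN g (4 * g + j)) = 4 * g + j := by simp only [fN, piN]; split_ifs <;> omega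
    simp only [e, hlN]
    rw [if_neg (by omega), show 4 * g + j - 4 * g = j by omega]

theorem cyW_word {M : Type*} [Group M] (g r n : ℕ) (hg) (hn : n + 1 = 4 * g + r)
    (a b : Fin g → M) (c : Fin r → M) :
    cyW (sh n) (fP g n hg * sh n) (fun k => hlN g r (xN a) (xN b) (xN c) k.val) (Fin.last n) (n + 1) =
      (List.ofFn fun i => ⁅a i, b i⁆).prod * ((List.ofFn c).prod)⁻¹ := by
  rw [← word_prod, ← hn]
  have key : ∀ m, m ≤ n + 1 →
    cyW (sh n) (fP g n hg * sh n) (fun k => hlN g r (xN a) (xN b) (xN c) k.val) (Fin.last n) m =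
    prodN (fun i => hlN g r (xN a) (xN b) (xN c) (fN g (piN g i))) m := by
    intro m
    induction m with
    | zero => intro _; rfl
    | succ m ih =>
      intro hm
      rw [cyW, prodN, ih (by omega), sq_last g n hg m (by omega)]
  exact key _ le_rfl


open UpperHalfPlane Matrix
open scoped commutatorElement

def nuN (g r : ℕ) (ν : Fin r → ℕ) (m : ℕ) : ℕ :=
  if m < 4 * g then 2 else (if h : r - 1 - (m - 4 * g) < r then ν ⟨r - 1 - (m - 4 * g), h⟩ else 2)

theorem nuN_ge (g r : ℕ) (ν : Fin r → ℕ) (hν : ∀ j, 2 ≤ ν j) (m : ℕ) : 2 ≤ nuN g r ν m := by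
  unfold nuN; split_ifs
  · exact le_rfl
  · exact hν _
  · exact le_rfl

theorem nuN_f (g r : ℕ) (ν : Fin r → ℕ) (m : ℕ) : nuN g r ν (fN g m) = nuN g r ν m := by
  by_cases h : m < 4 * g
  · have h' : fN g m < 4 * g := by simp only [fN]; split_ifs <;> omega
    simp only [nuN, h, h', if_true]
  · rw [fN, if_neg h]

theorem nuN_cone (g r : ℕ) (ν : Fin r → ℕ) (j : Fin r) :
    nuN g r ν (4 * g + (r - 1 - j.val)) = ν j := by
  have h1 : ¬ (4 * g + (r - 1 - j.val) < 4 * g) := by omega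
  have h2 : r - 1 - (4 * g + (r - 1 - j.val) - 4 * g) = j.val := by have := j.2; omega
  simp only [nuN, h1, if_false, h2, j.2, dif_pos]

theorem angle_sum (g r n : ℕ) (hn : n + 1 = 4 * g + r) (ν : Fin r → ℕ)
    (hyp : 0 < 2 * (g : ℚ) - 2 + ∑ j : Fin r, (1 - 1 / (ν j : ℚ))) :
    Real.pi < ∑ k : Fin (n + 1), (Real.pi / 2 - Real.pi / (2 * nuN g r ν k.val)) := by
  have hyp' : (0:ℝ) < 2 * (g : ℝ) - 2 + ∑ j : Fin r, (1 - 1 / (ν j : ℝ)) := by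
    have := (Rat.cast_lt (K := ℝ)).2 hyp
    push_cast at this
    exact this
  have h1 : ∑ k : Fin (n + 1), (Real.pi / 2 - Real.pi / (2 * nuN g r ν k.val)) =
      Real.pi / 2 * (2 * g + ∑ j : Fin r, (1 - 1 / (ν j : ℝ))) := by
    rw [← Finset.sum_range (fun k => (Real.pi / 2 - Real.pi / (2 * (nuN g r ν k : ℝ)))), hn,
      Finset.sum_range_add, mul_add]
    congr 1
    · rw [Finset.sum_congr rfl (g := fun _ => Real.pi / 4)]
      · simp; ring
      · intro k hk
        rw [Finset.mem_range] at hk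
        simp only [nuN, hk, if_true]; push_cast; ring
    · rw [← Finset.sum_range_reflect, Finset.sum_range, Finset.mul_sum]
      refine Finset.sum_congr rfl fun j _ => ?_
      rw [nuN_cone]
      rw [← div_div]; ring
  rw [h1]
  nlinarith [Real.pi_pos]

theorem hlN_f {M : Type*} [Group M] (g r : ℕ) (a b c : ℕ → M) (m : ℕ) (hk : m < 4 * g) :
    hlN g r a b c m * hlN g r a b c (fN g m) = 1 := by
  have l1 : fN g m < 4 * g := by simp only [fN]; split_ifs <;> omega
  have l2 : fN g m / 4 = m / 4 := by simp only [fN]; split_ifs <;> omega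
  have l3 : fN g m % 4 = (m + 2) % 4 := by simp only [fN]; split_ifs <;> omega
  simp only [hlN]
  rw [if_pos hk, if_pos l1, l2, l3]
  split_ifs <;> first | omega | simp

theorem fuchsian_exists (g r : ℕ) (ν : Fin r → ℕ) (hν : ∀ j, 2 ≤ ν j)
    (hyp : 0 < 2 * (g : ℚ) - 2 + ∑ j : Fin r, (1 - 1 / (ν j : ℚ))) :
    ∃ Γ : Subgroup PSL2R, DiscreteTopology Γ ∧ CompactSpace (PSL2R ⧸ Γ) ∧
      Nonempty (Γ ≃* FuchsianGroup g r ν) := by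
  obtain ⟨n, hn⟩ : ∃ n, n + 1 = 4 * g + r := by
    rcases Nat.eq_zero_or_pos (4 * g + r) with h | h
    · exfalso
      have hg : g = 0 := by omega
      have hr : r = 0 := by omega
      subst hg hr
      norm_num at hyp
    · exact ⟨4 * g + r - 1, by omega⟩
  have hg : 4 * g ≤ n + 1 := by omega
  have hpi := Real.pi_pos
  set nu : Fin (n + 1) → ℕ := fun k => nuN g r ν k.val with hnu_def
  have hnu : ∀ k, 2 ≤ nu k := fun k => nuN_ge g r ν hν _
  have hnuR : ∀ k, (2:ℝ) ≤ nu k := fun k => by exact_mod_cast hnu k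
  have phi_pos : ∀ k, 0 < Real.pi / (2 * nu k) := fun k => by
    have := hnuR k; positivity
  have phi_le : ∀ k, Real.pi / (2 * nu k) ≤ Real.pi / 4 := fun k => by
    have := hnuR k
    apply div_le_div_of_nonneg_left <;> linarith
  obtain ⟨C, hC, hsum⟩ := ivt_C (fun k => Real.pi / (2 * nu k)) phi_pos phi_le
    (angle_sum g r n hn ν hyp)
  set S := Real.sqrt (C ^ 2 - 1) with hS_def
  have hS : 0 < S := Real.sqrt_pos.2 (by nlinarith)
  have h : S ^ 2 = C ^ 2 - 1 := Real.sq_sqrt (by nlinarith)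
  have h' : (-S) ^ 2 = C ^ 2 - 1 := by rw [neg_sq, h]
  clear_value S
  set θ : Fin (n + 1) → ℝ := fun k => Real.arcsin (Real.cos (Real.pi / (2 * nu k)) / C) with hθ_def
  have hcos0 : ∀ k, 0 < Real.cos (Real.pi / (2 * nu k)) := fun k =>
    Real.cos_pos_of_mem_Ioo ⟨by linarith [phi_pos k], by linarith [phi_le k]⟩
  have hsub : ∀ k, Real.cos (Real.pi / (2 * nu k)) / C < 1 := fun k => by
    rw [div_lt_one (by linarith)]; linarith [Real.cos_le_one (Real.pi / (2 * nu k))]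
  have hsub0 : ∀ k, 0 < Real.cos (Real.pi / (2 * nu k)) / C := fun k =>
    div_pos (hcos0 k) (by linarith)
  have th_pos : ∀ k, 0 < θ k := fun k => Real.arcsin_pos.2 (hsub0 k)
  have th_lt : ∀ k, θ k < Real.pi / 2 := fun k => Real.arcsin_lt_pi_div_two.2 (hsub k)
  have hth : ∀ k, C * Real.sin (θ k) = Real.cos (Real.pi / (2 * nu k)) := fun k => by
    rw [hθ_def]; simp only
    rw [Real.sin_arcsin (by linarith [hsub0 k]) (hsub k).le]; field_simp
  set f := fP g n hg with hf
  have hfn : ∀ k, nu (f k) = nu k := fun k => nuN_f g r ν k.val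
  have hfθ : ∀ k, θ (f k) = θ k := fun k => by simp only [hθ_def, hfn]
  clear_value θ
  -- frames
  let θN : ℕ → ℝ := fun m => if hm : m < n + 1 then θ ⟨m, hm⟩ else 0
  have hθN : ∀ k : Fin (n + 1), θN k.val = θ k := fun k => dif_pos k.2
  have hθNs : ∑ i ∈ Finset.range (n + 1), θN i = Real.pi := by
    rw [Finset.sum_range, ← hsum]
    exact Finset.sum_congr rfl fun k _ => hθN k
  obtain ⟨Φ, hΦd⟩ : ∃ Φ : Fin (n + 1) → PSL2R, ∀ k,
    Φ k = rot C S h (-∑ i ∈ Finset.range (k.val + 1), θN i) := ⟨_, fun k => rfl⟩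
  have hΦ : ∀ k, Φ k = Φ (sh n k) * rot C S h (θ (sh n k)) := by
    intro k
    rw [hΦd, hΦd, ← rot_add, ← hθN, Finset.sum_range_succ _ (sh n k).val, sh_val]
    split_ifs with hk
    · rw [hk, hθNs, rot_neg, rot_pi]; simp [rot_zero]
    · congr 1; ring
  obtain ⟨H, hH⟩ : ∃ H : Fin (n + 1) → PSL2R, ∀ k, H k = Φ k *
    (rot C S h (θ k) * rot C (-S) h' (θ k)) * (Φ (f k))⁻¹ := ⟨_, fun k => rfl⟩
  have hE : ∀ k, (rot C S h (θ k) * rot C (-S) h' (θ k)) ^ (nu k) = 1 := fun k =>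
    rot_E_pow C S h h' (θ k) _ (nu k) (hnu k) rfl (hth k)
  have hHf : ∀ k : Fin (n + 1), k.val < 4 * g → H (f k) = (H k)⁻¹ := by
    intro k hk
    have h2 := hE k
    rw [show nu k = 2 by simp only [hnu_def, nuN, hk, if_true]] at h2
    rw [eq_inv_iff_mul_eq_one, hH, hH, fP_sq, hfθ]
    generalize rot C S h (θ k) * rot C (-S) h' (θ k) = E at h2
    calc _ = Φ (f k) * E ^ 2 * (Φ (f k))⁻¹ := by rw [pow_two]; group
      _ = 1 := by rw [h2]; group
  have hfc : ∀ k : Fin (n + 1), ¬ k.val < 4 * g → f k = k := by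
    intro k hk
    apply Fin.ext
    rw [hf, fP_val, fN, if_neg hk]
  have hHc : ∀ k : Fin (n + 1), ¬ k.val < 4 * g → H k ^ (nu k) = 1 := by
    intro k hk
    rw [hH, hfc k hk, conj_pow, hE]; group
  let HN : ℕ → PSL2R := fun m => if hm : m < n + 1 then H ⟨m, hm⟩ else 1
  have hHN : ∀ k : Fin (n + 1), HN k.val = H k := fun k => dif_pos k.2
  let A : Fin g → PSL2R := fun i => HN (4 * i.val)
  let B : Fin g → PSL2R := fun i => HN (4 * i.val + 3)
  let Cc : Fin r → PSL2R := fun j => (HN (4 * g + (r - 1 - j.val)))⁻¹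
  have hHl : ∀ k : Fin (n + 1), hlN g r (xN A) (xN B) (xN Cc) k.val = H k := by
    intro k
    have hk2 := k.2
    by_cases hk : k.val < 4 * g
    · have hA : xN A (k.val / 4) = HN (4 * (k.val / 4)) := by
        rw [xN, dif_pos (by omega)]
      have hB : xN B (k.val / 4) = HN (4 * (k.val / 4) + 3) := by
        rw [xN, dif_pos (by omega)]
      have hfk := hHf k hk
      rw [← hHN (f k), ← hHN k, hf, fP_val] at hfk
      rw [hlN, if_pos hk, hA, hB, ← hHN]
      split_ifs with m0 m1 m2
      · congr 1; omega
      · rw [← _root_.inv_inj, inv_inv, ← hfk]; congr 1; simp only [fN]; split_ifs <;> omega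
      · rw [← _root_.inv_inj, inv_inv, ← hfk]; congr 1; simp only [fN]; split_ifs <;> omega
      · congr 1; omega
    · rw [hlN, if_neg hk, xN, dif_pos (by omega), inv_inv, ← hHN]
      congr 1; simp only; omega
  have hlong : (List.ofFn fun i => ⁅A i, B i⁆).prod * ((List.ofFn Cc).prod)⁻¹ = 1 := by
    rw [← cyW_word g r n hg hn A B Cc, funext hHl,
      telescope (sh n) f H Φ θ C S h h' hΦ hH, q_pow_n]
    have : ∑ i ∈ Finset.range (n + 1), θ (sh n (((f * sh n) ^ i) (Fin.last n))) = Real.pi := by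
      rw [← hsum, ← q_sum g n hg θ ((f * sh n) (Fin.last n))]
      refine Finset.sum_congr rfl fun i _ => ?_
      rw [← hfθ, ← Equiv.Perm.mul_apply f, ← Equiv.Perm.mul_apply, ← Equiv.Perm.mul_apply,
        ← pow_succ, ← pow_succ']
    rw [this, rot_pi]; simp
  let ga : FuchsianGen g r → PSL2R := Sum.elim (Sum.elim A B) Cc
  have hrel : ∀ x ∈ fuchsianRels g r ν, FreeGroup.lift ga x = 1 := by
    intro x hx
    rcases hx with rfl | ⟨j, rfl⟩
    · rw [map_mul, map_inv, map_list_prod, map_list_prod, List.map_ofFn, List.map_ofFn, ← hlong]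
      congr 3
      · congr 1; funext i; simp [map_commutatorElement, ga]
      · congr 1; funext i; simp [ga]
    · have hj := j.2
      have := hHc ⟨4 * g + (r - 1 - j.val), by omega⟩ (by simp)
      simp only [hnu_def, nuN_cone] at this
      simp only [map_pow, FreeGroup.lift_apply_of, ga, Sum.elim_inr, Cc, inv_pow]
      rw [← hHN] at this
      rw [this, inv_one]
  let a : Fin g → FuchsianGroup g r ν := fun i => PresentedGroup.of (Sum.inl (Sum.inl i))
  let b : Fin g → FuchsianGroup g r ν := fun i => PresentedGroup.of (Sum.inl (Sum.inr i))
  let c : Fin r → FuchsianGroup g r ν := fun i => PresentedGroup.of (Sum.inr i)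
  let ρ : FuchsianGroup g r ν →* PSL2R := PresentedGroup.toGroup hrel
  have ρa : ∀ i, ρ (a i) = A i := fun i => PresentedGroup.toGroup.of hrel
  have ρb : ∀ i, ρ (b i) = B i := fun i => PresentedGroup.toGroup.of hrel
  have ρc : ∀ i, ρ (c i) = Cc i := fun i => PresentedGroup.toGroup.of hrel
  clear_value ρ
  let hl : Fin (n + 1) → FuchsianGroup g r ν := fun k => hlN g r (xN a) (xN b) (xN c) k.val
  have ρhl : ∀ k, ρ (hl k) = H k := by
    intro k
    rw [← hHl]
    have ea : ∀ m, ρ (xN a m) = xN A m := fun m => by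
      simp only [xN]; split_ifs <;> simp [ρa]
    have eb : ∀ m, ρ (xN b m) = xN B m := fun m => by
      simp only [xN]; split_ifs <;> simp [ρb]
    have ec : ∀ m, ρ (xN c m) = xN Cc m := fun m => by
      simp only [xN]; split_ifs <;> simp [ρc]
    simp only [hl, hlN]
    split_ifs <;> simp only [map_inv, ea, eb, ec]
  have relG : (List.ofFn fun i => ⁅a i, b i⁆).prod * ((List.ofFn c).prod)⁻¹ = 1 := by
    have := (PresentedGroup.mk_eq_one_iff (rels := fuchsianRels g r ν)).2
      (Subgroup.subset_normalClosure (Set.mem_insert _ _))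
    rw [← this]
    rw [map_mul, map_inv, map_list_prod, map_list_prod, List.map_ofFn, List.map_ofFn]
    congr 3
  have relc : ∀ j, c j ^ ν j = 1 := fun j => by
    have := (PresentedGroup.mk_eq_one_iff (rels := fuchsianRels g r ν)).2
      (Subgroup.subset_normalClosure (Set.mem_insert_of_mem _ (Set.mem_range_self j)))
    rw [map_pow] at this
    exact this
  have hlf : ∀ k : Fin (n + 1), k.val < 4 * g → hl k * hl (f k) = 1 := by
    intro k hk
    exact hlN_f g r (xN a) (xN b) (xN c) k.val hk
  have hlc : ∀ k : Fin (n + 1), ¬ k.val < 4 * g → hl k ^ (nu k) = 1 := by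
    intro k hk
    have hk2 := k.2
    have hj : r - 1 - (k.val - 4 * g) < r := by omega
    simp only [hl, hlN, hnu_def, nuN, if_neg hk, dif_pos hj, xN]
    rw [inv_pow, relc, inv_one]
  refine poincare (Fin.last n) (sh n) f hl θ nu Φ ρ C S hC hS h h' hnu hfθ hfn th_pos th_lt hth
    ?_ (fun k => ⟨_, hΦd k⟩) (fun k => by rw [ρhl, hH]) ?_ (n + 1) n.succ_pos (sh_pow_n n)
    (sh_cyc_inv n _) (fun k => by rw [sh_sum, hsum]) ?_ (fun k => by rw [hf, q_sum, hsum]) ?_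
  · intro k
    rw [hΦ, perm_ai]
  · rw [eq_top_iff, ← PresentedGroup.closure_range_of, Subgroup.closure_le]
    rintro _ ⟨x, rfl⟩
    rcases x with (i | i) | j
    · have hi := i.2
      apply Subgroup.subset_closure
      refine ⟨⟨4 * i.val, by omega⟩, ?_⟩
      simp only [hl, hlN]
      rw [if_pos (by omega), if_pos (by omega), Nat.mul_div_cancel_left _ (by omega), xN_eq]
    · have hi := i.2
      apply Subgroup.subset_closure
      refine ⟨⟨4 * i.val + 3, by omega⟩, ?_⟩
      simp only [hl, hlN]
      rw [if_pos (by omega), if_neg (by omega), if_neg (by omega), if_neg (by omega),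
        show (4 * i.val + 3) / 4 = i.val by omega, xN_eq]
    · have hj := j.2
      rw [SetLike.mem_coe, ← inv_mem_iff]
      apply Subgroup.subset_closure
      refine ⟨⟨4 * g + (r - 1 - j.val), by omega⟩, ?_⟩
      simp only [hl, hlN]
      rw [if_neg (by omega), show r - 1 - (4 * g + (r - 1 - j.val) - 4 * g) = j.val by omega, xN_eq]
  · exact perV_of (sh n) f hl (n + 1) (Fin.last n) (q_pow_n g n hg) (q_cyc g n hg _)
      ((cyW_word g r n hg hn a b c).trans relG)
  · rintro ⟨x, k⟩
    simp only
    by_cases hk : k.val < 4 * g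
    · rw [show nu k = 2 by simp only [hnu_def, nuN, hk, if_true], pow_two, Equiv.Perm.mul_apply]
      change (x * hl k * hl (f k), f (f k)) = _
      rw [mul_assoc, hlf k hk, fP_sq, mul_one]
    · rw [dP2_pow_fix f hl x k (hfc k hk), hlc k hk, mul_one]


/-- Realizability of signatures: for `g, r ≥ 0` and `νⱼ ≥ 2` with
`2g − 2 + Σ (1 − 1/νⱼ) > 0`, there is a cocompact Fuchsian group
`Γ ≤ PSL(2,ℝ)` isomorphic to the presented group `Γ(g; ν₁,…,ν_r)`. -/
theorem exists_cocompact_fuchsian_of_signature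
    (g r : ℕ) (ν : Fin r → ℕ) (hν : ∀ j, 2 ≤ ν j)
    (hyp : 0 < 2 * (g : ℚ) - 2 + ∑ j : Fin r, (1 - 1 / (ν j : ℚ))) :
    ∃ Γ : Subgroup PSL2R, DiscreteTopology Γ ∧ CompactSpace (PSL2R ⧸ Γ) ∧
      Nonempty (Γ ≃* FuchsianGroup g r ν) := by
  exact fuchsian_exists g r ν hν hyp
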